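/- Let (a,b,c) satisfy the parabolicity–regularity assumption with respect to ρ and let r ∈ ℕ with 1 ≤ r ≤ ρ. There exist families of translation-invariant kernels (Z_w^{[k]})_{w∈ℝ^{1+d}} for each multi-index k ∈ ℕ^{1+d} with |k|_s < r, and kernels (Z_w^{∂,[k]})_{w∈ℝ^{1+d}} for each k ∈ ∂_s r, such that for all w, z, z̄ ∈ ℝ^{1+d}: Z(z,z̄) = Σ_{|k|_s<r} (z̄−w)^k Z_w^{[k]}(z−z̄) + Σ_{k∈∂_s r} (z̄−w)^{k↓} Z_w^{∂,[k]}(z,z̄). Moreover the decomposition can be chosen so that: Z^{[k]} ∈ C^{ρ−|k|_s}(Φ_∞^2) ∩ Λ_{|k|_s}; Z^{∂,[k]} ∈ C^m(Ψ_{ρ−|k↓|_s−m}^2) for every integer 0 ≤ m < ρ−|k↓|_s; the family w ↦ ((t,x) ↦ 1_{t>0} t^{−1/2} Z_w^{[k]}(t,x)) belongs to Λ_r; and the maps (a,b,c) ↦ Z^{[k]} and (a,b,c) ↦ Z^{∂,[k]} are continuous from A_ρ into the respective spaces. -/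

import Mathlib

open MeasureTheory Filter
open scoped BigOperators ENNReal

namespace VarBPHZ

/-! ## Basic parabolic setting on `ℝ^{1+d}` -/

/-- A space-time point in `ℝ^{1+d}`; coordinate `0` is time, coordinates `1, …, d` are space. -/
abbrev Pt (d : ℕ) := Fin (d + 1) → ℝ

variable {d : ℕ}

/-- Parabolic scaled degree `|k|_𝔰 = 2k₀ + k₁ + ⋯ + k_d` of a multi-index. -/
def pdeg (k : Fin (d + 1) → ℕ) : ℕ := k 0 + ∑ i, k i

/-- Parabolic norm `|z|_𝔰 = |t|^{1/2} + ∑ᵢ |xᵢ|`. -/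
noncomputable def pnorm (z : Pt d) : ℝ := Real.sqrt |z 0| + ∑ i : Fin d, |z i.succ|

/-- First-order partial derivative in the `i`-th coordinate. -/
noncomputable def pd (i : Fin (d + 1)) (f : Pt d → ℝ) : Pt d → ℝ :=
  fun z => fderiv ℝ f z (Pi.single i 1)

/-- Iterated partial derivative `∂^k` for a multi-index `k`. -/
noncomputable def mderiv (k : Fin (d + 1) → ℕ) (f : Pt d → ℝ) : Pt d → ℝ :=
  (List.finRange (d + 1)).foldr (fun i g => (pd i)^[k i] g) f

/-- Mixed partial derivative `∂₁^j ∂₂^m` of a two-argument kernel. -/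
noncomputable def mderiv2 (j m : Fin (d + 1) → ℕ) (F : Pt d → Pt d → ℝ) :
    Pt d → Pt d → ℝ :=
  fun z zb => mderiv j (fun z' => mderiv m (F z') zb) z

/-- Space-time convolution `u * v (z, z̄) = ∫ u(z, ζ) v(ζ, z̄) dζ`. -/
noncomputable def conv (u v : Pt d → Pt d → ℝ) : Pt d → Pt d → ℝ :=
  fun z zb => ∫ ζ : Pt d, u z ζ * v ζ zb

/-! ## The heat calculus spaces `Ψ_r^α` and `Φ_r^α` -/

/-- `Ft` is an `F̃`-representation of `F` for the space `Ψ_r^α`; the second argument of `Ft`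
packs `(u, v) ∈ ℝ × ℝ^d` as an element of `ℝ^{1+d}`. -/
def PsiRep (α : ℝ) (Ft : Pt d → Pt d → ℝ) (F : Pt d → Pt d → ℝ) : Prop :=
  ∀ z zb : Pt d, F z zb =
    if zb 0 < z 0 then
      (z 0 - zb 0) ^ ((α - d - 2) / 2) *
        Ft zb (Fin.cons (Real.sqrt (z 0 - zb 0))
          fun i : Fin d => (z i.succ - zb i.succ) / Real.sqrt (z 0 - zb 0))
    else 0

/-- Existence (and continuity) of the derivatives of `F̃` entering the `Ψ_r^α` seminorms:
derivatives are counted parabolically in the first slot and by total order in the second. -/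
def PsiSmooth (r : ℕ) (Ft : Pt d → Pt d → ℝ) : Prop :=
  (∀ j m : Fin (d + 1) → ℕ, pdeg j + ∑ i, m i < r →
    Differentiable ℝ fun p : Pt d × Pt d => mderiv2 j m Ft p.1 p.2) ∧
  ∀ j m : Fin (d + 1) → ℕ, pdeg j + ∑ i, m i ≤ r →
    Continuous fun p : Pt d × Pt d => mderiv2 j m Ft p.1 p.2

/-- The set of numbers of which the `Ψ_r^α` seminorm `‖·‖_{α,r;T,n}` of a representation
`Ft` is the supremum. -/
def psiSet (r : ℕ) (T : ℝ) (n : ℕ) (Ft : Pt d → Pt d → ℝ) : Set ℝ :=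
  {y | ∃ (j m : Fin (d + 1) → ℕ) (w uv : Pt d),
    pdeg j + ∑ i, m i ≤ r ∧ 0 ≤ uv 0 ∧ uv 0 ≤ Real.sqrt T ∧
    y = (1 + Real.sqrt (∑ i : Fin d, uv i.succ ^ 2)) ^ n * |mderiv2 j m Ft w uv|}

/-- Membership in the heat-calculus space `Ψ_r^α`. -/
def MemPsi (α : ℝ) (r : ℕ) (F : Pt d → Pt d → ℝ) : Prop :=
  ∃ Ft, PsiRep α Ft F ∧ PsiSmooth r Ft ∧
    ∀ T : ℝ, 0 < T → ∀ n : ℕ, BddAbove (psiSet r T n Ft)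

/-- The `Ψ_r^α` seminorm `‖F‖_{α,r;T,n}` of a kernel `F`. -/
noncomputable def psiNorm (α : ℝ) (r : ℕ) (T : ℝ) (n : ℕ) (F : Pt d → Pt d → ℝ) : ℝ :=
  sInf {y | ∃ Ft, PsiRep α Ft F ∧ PsiSmooth r Ft ∧ BddAbove (psiSet r T n Ft) ∧
    y = sSup (psiSet r T n Ft)}

/-- Translation invariance of a two-argument kernel. -/
def TransInv (F : Pt d → Pt d → ℝ) : Prop := ∀ z zb h : Pt d, F (z + h) (zb + h) = F z zb

/-- Membership in `Φ_r^α`, the translation-invariant part of `Ψ_r^α`. -/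
def MemPhi (α : ℝ) (r : ℕ) (F : Pt d → Pt d → ℝ) : Prop := MemPsi α r F ∧ TransInv F

/-- `∂_w^m` of a family of kernels depending on a parameter `w`. -/
noncomputable def famDeriv (m : Fin (d + 1) → ℕ) (F : Pt d → Pt d → Pt d → ℝ) :
    Pt d → Pt d → Pt d → ℝ :=
  fun w z zb => mderiv m (fun w' => F w' z zb) w

/-- Membership in `C^m(Ψ_r^α)` for a family of kernels. -/
def MemCPsi (m : ℕ) (α : ℝ) (r : ℕ) (F : Pt d → Pt d → Pt d → ℝ) : Prop :=
  (∀ m' : Fin (d + 1) → ℕ, pdeg m' < m → ∀ z zb : Pt d,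
    Differentiable ℝ fun w => famDeriv m' F w z zb) ∧
  (∀ m' : Fin (d + 1) → ℕ, pdeg m' ≤ m → ∀ w : Pt d, MemPsi α r (famDeriv m' F w)) ∧
  ∀ T : ℝ, 0 < T → ∀ n : ℕ,
    BddAbove {y | ∃ (m' : Fin (d + 1) → ℕ) (w : Pt d), pdeg m' ≤ m ∧
      y = psiNorm α r T n (famDeriv m' F w)}

/-- The `C^m(Ψ_r^α)` seminorm `sup_w max_{|m'|_𝔰 ≤ m} ‖∂_w^{m'} F_w‖_{α,r;T,n}`. -/
noncomputable def cpsiNorm (m : ℕ) (α : ℝ) (r : ℕ) (T : ℝ) (n : ℕ)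
    (F : Pt d → Pt d → Pt d → ℝ) : ℝ :=
  sSup {y | ∃ (m' : Fin (d + 1) → ℕ) (w : Pt d), pdeg m' ≤ m ∧
    y = psiNorm α r T n (famDeriv m' F w)}

/-- Membership in `C^m(Φ_r^α)`. -/
def MemCPhi (m : ℕ) (α : ℝ) (r : ℕ) (F : Pt d → Pt d → Pt d → ℝ) : Prop :=
  MemCPsi m α r F ∧ ∀ w, TransInv (F w)

/-- The Beta function `B(a,b) = ∫₀¹ (1−s)^{a−1} s^{b−1} ds`. -/
noncomputable def betaFn (a b : ℝ) : ℝ := ∫ s in (0 : ℝ)..1, (1 - s) ^ (a - 1) * s ^ (b - 1)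

/-! ## Coefficient fields, the parabolicity–regularity assumption, `Z`, `E` and `Γ` -/

/-- Membership in the parabolic space `C^ρ`: all parabolic derivatives of order `≤ ρ`
exist, are continuous and bounded. -/
def MemCpar (ρ : ℕ) (f : Pt d → ℝ) : Prop :=
  (∀ k : Fin (d + 1) → ℕ, pdeg k < ρ → Differentiable ℝ (mderiv k f)) ∧
  ∀ k : Fin (d + 1) → ℕ, pdeg k ≤ ρ →
    Continuous (mderiv k f) ∧ ∃ M : ℝ, ∀ z, |mderiv k f z| ≤ M

/-- The `C^ρ` norm `max_{|k|_𝔰 ≤ ρ} sup |∂^k f|`. -/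
noncomputable def cparNorm (ρ : ℕ) (f : Pt d → ℝ) : ℝ :=
  sSup {y | ∃ (k : Fin (d + 1) → ℕ) (z : Pt d), pdeg k ≤ ρ ∧ y = |mderiv k f z|}

/-- A triple of coefficient fields `(a, b, c)`. -/
structure Coeffs (d : ℕ) where
  a : Pt d → Matrix (Fin d) (Fin d) ℝ
  b : Pt d → Fin d → ℝ
  c : Pt d → ℝ

/-- The parabolicity–regularity assumption, with ellipticity constant `lam` and
regularity exponent `ρ`. -/
structure ParReg (lam : ℝ) (ρ : ℕ) (A : Coeffs d) : Prop where
  symm : ∀ z, (A.a z).IsSymm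
  lower : ∀ (z : Pt d) (ζ : Fin d → ℝ), lam * ∑ i, ζ i ^ 2 ≤ ∑ i, ∑ j, A.a z i j * ζ i * ζ j
  upper : ∀ (z : Pt d) (ζ : Fin d → ℝ), ∑ i, ∑ j, A.a z i j * ζ i * ζ j ≤ lam⁻¹ * ∑ i, ζ i ^ 2
  areg : ∀ i j, MemCpar ρ fun z => A.a z i j
  breg : ∀ i, MemCpar ρ fun z => A.b z i
  creg : MemCpar ρ A.c

/-- The norm `‖(a,b,c)‖_ρ` on coefficient triples. -/
noncomputable def coeffNorm (ρ : ℕ) (A : Coeffs d) : ℝ :=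
  sSup {y | ∃ i j, y = cparNorm ρ fun z => A.a z i j} +
    sSup {y | ∃ i, y = cparNorm ρ fun z => A.b z i} + cparNorm ρ A.c

/-- Difference of two coefficient triples. -/
def coeffSub (A B : Coeffs d) : Coeffs d where
  a := fun z => A.a z - B.a z
  b := fun z => A.b z - B.b z
  c := fun z => A.c z - B.c z

/-- The distance on the space `𝐀_ρ` of coefficient fields. -/
noncomputable def coeffDist (ρ : ℕ) (A B : Coeffs d) : ℝ := coeffNorm ρ (coeffSub A B)

/-- The constant-coefficient heat kernel `W^w` with coefficients frozen at `w`. -/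
noncomputable def Wker (A : Coeffs d) (w : Pt d) (z : Pt d) : ℝ :=
  if 0 < z 0 then
    (4 * Real.pi) ^ (-(d : ℝ) / 2) * (A.a w).det ^ (-(1 : ℝ) / 2) * z 0 ^ (-(d : ℝ) / 2) *
      Real.exp (-(∑ i, ∑ j, (A.a w)⁻¹ i j * z i.succ * z j.succ) / (4 * z 0))
  else 0

/-- `Z(z, z̄) = W^{z̄}(z − z̄)`. -/
noncomputable def Zker (A : Coeffs d) : Pt d → Pt d → ℝ := fun z zb => Wker A zb (z - zb)

/-- `∂ᵢ Z`, derivative in the `i`-th spatial coordinate of the first argument. -/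
noncomputable def ZkerD (A : Coeffs d) (i : Fin d) : Pt d → Pt d → ℝ :=
  fun z zb => pd i.succ (fun y => Zker A y zb) z

/-- `∂ᵢ ∂ⱼ Z`. -/
noncomputable def ZkerDD (A : Coeffs d) (i j : Fin d) : Pt d → Pt d → ℝ :=
  fun z zb => pd i.succ (fun y => pd j.succ (fun y' => Zker A y' zb) y) z

/-- The kernel `E = LZ` away from the diagonal. -/
noncomputable def Eker (A : Coeffs d) : Pt d → Pt d → ℝ := fun z zb =>
  (∑ i, ∑ j, (A.a zb i j - A.a z i j) * ZkerDD A i j z zb) -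
    (∑ i, A.b z i * ZkerD A i z zb) - A.c z * Zker A z zb

/-- The `k`-th term `Z * (−E)^{*k}` of the Volterra series. -/
noncomputable def volterra (A : Coeffs d) : ℕ → (Pt d → Pt d → ℝ)
  | 0 => Zker A
  | k + 1 => conv (volterra A k) fun z zb => -Eker A z zb

/-- The heat kernel `Γ`, defined as the sum of the Volterra series. -/
noncomputable def GammaKer (A : Coeffs d) : Pt d → Pt d → ℝ :=
  fun z zb => ∑' k, volterra A k z zb

/-! ## The classes `Λ_r` of local families of translation-invariant kernels -/

/-- Names for the entries of the coefficient fields `a`, `a⁻¹`, `b`, `c`. -/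
inductive CoeffVar (d : ℕ) where
  | aa : Fin d → Fin d → CoeffVar d
  | ai : Fin d → Fin d → CoeffVar d
  | bb : Fin d → CoeffVar d
  | cc : CoeffVar d
deriving DecidableEq

/-- Evaluation of a formal variable `∂^l (entry)` of the coefficient field at `w`. -/
noncomputable def coeffEval (A : Coeffs d) (w : Pt d) :
    (Fin (d + 1) → ℕ) × CoeffVar d → ℝ
  | (l, CoeffVar.aa i j) => mderiv l (fun z => A.a z i j) w
  | (l, CoeffVar.ai i j) => mderiv l (fun z => (A.a z)⁻¹ i j) w
  | (l, CoeffVar.bb i) => mderiv l (fun z => A.b z i) w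
  | (l, CoeffVar.cc) => mderiv l A.c w

/-- The rational kernel `P(t,x) = t^{-1/2} Q(t^{1/2}, t^{-1/2} x)` attached to a
polynomial `Q`, extended by `0` to `t ≤ 0`. -/
noncomputable def ratKer (Q : MvPolynomial (Fin (d + 1)) ℝ) (z : Pt d) : ℝ :=
  if 0 < z 0 then
    (Real.sqrt (z 0))⁻¹ *
      MvPolynomial.eval
        (Fin.cons (Real.sqrt (z 0)) fun i : Fin d => z i.succ / Real.sqrt (z 0)) Q
  else 0

/-- The chain of differences `y_i − y_{i+1}` with `y_0 = ζ` and `y_{N+1} = 0`. -/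
noncomputable def chainDiff {N : ℕ} (ζ : Pt d) (y : Fin N → Pt d) (i : Fin (N + 1)) : Pt d :=
  (Fin.cons ζ (Fin.snoc y 0) : Fin (N + 2) → Pt d) i.castSucc -
    (Fin.cons ζ (Fin.snoc y 0) : Fin (N + 2) → Pt d) i.succ

/-- A single building block of the class `Λ_r`:
`K^w(ζ) = F(w) ∫ dy₁ ⋯ dy_N ∏ᵢ P^{[i]}(yᵢ − yᵢ₊₁) W^w(yᵢ − yᵢ₊₁)`. -/
noncomputable def lambdaAtom (A : Coeffs d)
    (p : MvPolynomial ((Fin (d + 1) → ℕ) × CoeffVar d) ℝ) (N : ℕ)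
    (Q : Fin (N + 1) → MvPolynomial (Fin (d + 1)) ℝ) (w ζ : Pt d) : ℝ :=
  MvPolynomial.eval (coeffEval A w) p *
    ∫ y : Fin N → Pt d, ∏ i : Fin (N + 1),
      (ratKer (Q i) (chainDiff ζ y i) * Wker A w (chainDiff ζ y i))

/-- Membership in `Λ_r`: finite linear combinations of the building blocks, where the
polynomial prefactor only involves derivatives `∂^l` of the coefficients with `|l|_𝔰 ≤ r`. -/
def MemLambda (A : Coeffs d) (r : ℕ) (K : Pt d → Pt d → ℝ) : Prop :=
  ∃ (M : ℕ) (p : Fin M → MvPolynomial ((Fin (d + 1) → ℕ) × CoeffVar d) ℝ)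
    (N : Fin M → ℕ) (Q : (m : Fin M) → Fin (N m + 1) → MvPolynomial (Fin (d + 1)) ℝ),
    (∀ m : Fin M, ∀ mo ∈ (p m).support, ∀ v ∈ mo.support, pdeg v.1 ≤ r) ∧
    ∀ w ζ : Pt d, K w ζ = ∑ m, lambdaAtom A (p m) (N m) (Q m) w ζ

/-! ## Finite sets of multi-indices, `k↓` and the boundary set `∂_𝔰 r` -/

/-- The (finite) set of all multi-indices of parabolic degree at most `m`. -/
noncomputable def multisLE (d m : ℕ) : Finset (Fin (d + 1) → ℕ) :=
  ((Finset.univ : Finset (Fin (d + 1) → Fin (m + 1))).image fun g i => (g i : ℕ)).filter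
    fun k => pdeg k ≤ m

/-- The (finite) set of all multi-indices of parabolic degree `< r`. -/
noncomputable def multisLT (d r : ℕ) : Finset (Fin (d + 1) → ℕ) :=
  (multisLE d r).filter fun k => pdeg k < r

/-- The least coordinate carrying a nonzero entry of `k` (junk value `0` for `k = 0`). -/
noncomputable def mIdx (k : Fin (d + 1) → ℕ) : Fin (d + 1) :=
  if h : (Finset.univ.filter fun i => k i ≠ 0).Nonempty then
    (Finset.univ.filter fun i => k i ≠ 0).min' h
  else 0

/-- `k↓ = k − e_{𝔪(k)}`. -/
noncomputable def kdown (k : Fin (d + 1) → ℕ) : Fin (d + 1) → ℕ :=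
  fun i => if i = mIdx k then k i - 1 else k i

/-- The boundary set `∂_𝔰 r = {k : |k|_𝔰 ≥ r, |k↓|_𝔰 < r}` of multi-indices. -/
noncomputable def bdryS (d r : ℕ) : Finset (Fin (d + 1) → ℕ) :=
  (multisLE d (r + 1)).filter fun k => r ≤ pdeg k ∧ pdeg (kdown k) < r

/-- The monomial `x^k`. -/
noncomputable def mono (x : Pt d) (k : Fin (d + 1) → ℕ) : ℝ := ∏ i, x i ^ k i

open scoped Classical in
/-- The (finite) set of multi-indices `l ≤ k` (componentwise). -/
noncomputable def multisBelowOf (k : Fin (d + 1) → ℕ) : Finset (Fin (d + 1) → ℕ) :=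
  (multisLE d (pdeg k)).filter fun l => l ≤ k

section Part1

/-! ### Multi-index combinatorics -/

/-- The `i`-th unit multi-index. -/
def ei (i : Fin (d + 1)) : Fin (d + 1) → ℕ := Pi.single i 1

/-- The parabolic degree of the `i`-th direction. -/
def dg (i : Fin (d + 1)) : ℕ := if i = 0 then 2 else 1

lemma pdeg_add (k l : Fin (d + 1) → ℕ) : pdeg (k + l) = pdeg k + pdeg l := by
  simp only [pdeg, Pi.add_apply, Finset.sum_add_distrib]; ring

lemma pdeg_zero : pdeg (0 : Fin (d + 1) → ℕ) = 0 := by simp [pdeg]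

lemma pdeg_ei (i : Fin (d + 1)) : pdeg (ei i) = dg i := by
  have : ∑ j, (ei i : Fin (d + 1) → ℕ) j = 1 := by simp [ei]
  rw [pdeg, this]
  unfold dg
  by_cases h : i = 0
  · subst h; simp [ei]
  · have : (ei i : Fin (d + 1) → ℕ) 0 = 0 := by
      simp [ei, Pi.single_apply, Ne.symm h]
    simp [this, h]

lemma dg_pos (i : Fin (d + 1)) : 1 ≤ dg i := by unfold dg; split_ifs <;> simp

lemma dg_le (i : Fin (d + 1)) : dg i ≤ 2 := by unfold dg; split_ifs <;> simp

lemma pdeg_add_ei (k : Fin (d + 1) → ℕ) (i : Fin (d + 1)) : pdeg (k + ei i) = pdeg k + dg i := by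
  rw [pdeg_add, pdeg_ei]

lemma ei_lt {i j : Fin (d + 1)} (h : j < i) : (ei i : Fin (d + 1) → ℕ) j = 0 := by
  simp [ei, Pi.single_apply, h.ne]

lemma sum_ei (i : Fin (d + 1)) : ∑ j, (ei i : Fin (d + 1) → ℕ) j = 1 := by simp [ei]

lemma exists_low {k : Fin (d + 1) → ℕ} (hk : k ≠ 0) :
    ∃ (k' : Fin (d + 1) → ℕ) (m : Fin (d + 1)), k = k' + ei m ∧ ∀ j < m, k' j = 0 := by
  have hne : (Finset.univ.filter fun i => k i ≠ 0).Nonempty := by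
    by_contra h
    apply hk
    funext i
    by_contra hi
    exact h ⟨i, by simpa using hi⟩
  let m := (Finset.univ.filter fun i => k i ≠ 0).min' hne
  have hm : k m ≠ 0 := by
    have := Finset.min'_mem _ hne
    simpa using this
  refine ⟨fun i => k i - ei m i, m, ?_, ?_⟩
  · funext i
    simp only [Pi.add_apply]
    by_cases h : i = m
    · subst h; simp only [ei, Pi.single_eq_same]; omega
    · simp [ei, Pi.single_apply, h]
  · intro j hj
    have : k j = 0 := by
      by_contra h
      have := Finset.min'_le (Finset.univ.filter fun i => k i ≠ 0) j (by simpa using h)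
      exact absurd hj (not_lt.mpr this)
    simp [this]

lemma multi_induct {p : (Fin (d + 1) → ℕ) → Prop} (h0 : p 0)
    (hs : ∀ k i, (∀ j < i, k j = 0) → p k → p (k + ei i)) : ∀ k, p k := by
  have : ∀ n k, ∑ i, k i = n → p k := by
    intro n
    induction n with
    | zero =>
      intro k hk
      have : k = 0 := by
        funext i
        exact (Finset.sum_eq_zero_iff.mp hk) i (Finset.mem_univ i)
      rw [this]; exact h0
    | succ n ih =>
      intro k hk
      have hk0 : k ≠ 0 := by rintro rfl; simp at hk
      obtain ⟨k', m, rfl, hm⟩ := exists_low hk0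
      apply hs _ _ hm
      apply ih
      simp only [Pi.add_apply, Finset.sum_add_distrib, sum_ei] at hk
      omega
  exact fun k => this _ k rfl

/-- Iterated application of operators in canonical order. -/
def wordOp {X : Type*} (ops : Fin (d + 1) → X → X) (k : Fin (d + 1) → ℕ) (x : X) : X :=
  (List.finRange (d + 1)).foldr (fun i g => (ops i)^[k i] g) x

lemma mderiv_eq (k : Fin (d + 1) → ℕ) (f : Pt d → ℝ) : mderiv k f = wordOp pd k f := rfl

lemma wordOp_zero {X : Type*} (ops : Fin (d + 1) → X → X) (x : X) : wordOp ops 0 x = x := by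
  unfold wordOp
  induction List.finRange (d + 1) with
  | nil => rfl
  | cons a t ih => simpa using ih

lemma foldr_canon {X : Type*} (ops : Fin (d + 1) → X → X) (k : Fin (d + 1) → ℕ) (x : X)
    (i : Fin (d + 1)) (hk : ∀ j < i, k j = 0) (l : List (Fin (d + 1)))
    (hl : l.Pairwise (· < ·)) (hi : i ∈ l) :
    l.foldr (fun i g => (ops i)^[(k + ei i) i] g) x = l.foldr (fun i g => (ops i)^[(k + ei i) i] g) x ∧
    l.foldr (fun a g => (ops a)^[(k + ei i) a] g) x =
      ops i (l.foldr (fun a g => (ops a)^[k a] g) x) := by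
  refine ⟨rfl, ?_⟩
  induction l with
  | nil => simp at hi
  | cons a t ih =>
    rw [List.pairwise_cons] at hl
    simp only [List.foldr_cons]
    by_cases ha : a = i
    · subst ha
      have : t.foldr (fun b g => (ops b)^[(k + ei a) b] g) x =
          t.foldr (fun b g => (ops b)^[k b] g) x := by
        have hne : ∀ b ∈ t, b ≠ a := fun b hb => (hl.1 b hb).ne'
        clear ih hl hi
        induction t with
        | nil => rfl
        | cons b t ih2 =>
          simp only [List.foldr_cons]
          rw [ih2 (fun c hc => hne c (List.mem_cons_of_mem _ hc))]
          have : (k + ei a) b = k b := by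
            simp [ei, Pi.single_apply, hne b (List.mem_cons_self)]
          rw [this]
      rw [this]
      have : (k + ei a) a = k a + 1 := by simp [ei]
      rw [this, Function.iterate_succ_apply']
    · have hit : i ∈ t := by
        rcases List.mem_cons.mp hi with h | h
        · exact absurd h.symm ha
        · exact h
      have hai : a < i := hl.1 i hit
      rw [ih hl.2 hit]
      have h1 : k a = 0 := hk a hai
      have h2 : (k + ei i) a = 0 := by simp [h1, ei_lt hai]
      rw [h1, h2]; rfl

lemma wordOp_canon {X : Type*} (ops : Fin (d + 1) → X → X) (k : Fin (d + 1) → ℕ) (x : X)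
    (i : Fin (d + 1)) (hk : ∀ j < i, k j = 0) :
    wordOp ops (k + ei i) x = ops i (wordOp ops k x) :=
  (foldr_canon ops k x i hk (List.finRange (d + 1)) (List.pairwise_lt_finRange _)
    (List.mem_finRange i)).2

lemma wordOp_comm {X : Type*} (ops : Fin (d + 1) → X → X) (x : X)
    (V : (Fin (d + 1) → ℕ) → Prop) (hV : ∀ k i, V (k + ei i) → V k)
    (hc : ∀ k i i', V (k + ei i + ei i') → ops i (wordOp ops k x) = wordOp ops (k + ei i) x →
      ops i' (wordOp ops k x) = wordOp ops (k + ei i') x →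
      ops i (ops i' (wordOp ops k x)) = ops i' (ops i (wordOp ops k x))) :
    ∀ k i, V (k + ei i) → ops i (wordOp ops k x) = wordOp ops (k + ei i) x := by
  intro k
  induction k using multi_induct with
  | h0 => intro i _; rw [wordOp_canon _ _ _ _ (by simp)]
  | hs k' m hm ih =>
    intro i hVi
    by_cases him : i ≤ m
    · rw [wordOp_canon ops (k' + ei m)]
      intro j hj
      simp [hm j (hj.trans_le him), ei_lt (hj.trans_le him)]
    · have hmi : m < i := not_le.mp him
      have e : k' + ei m + ei i = k' + ei i + ei m := by rw [add_assoc, add_comm (ei m), add_assoc]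
      have hV1 : V (k' + ei i) := hV _ m (e ▸ hVi)
      have h1 := ih i hV1
      have h2 : ops m (wordOp ops k' x) = wordOp ops (k' + ei m) x := (wordOp_canon _ _ _ _ hm).symm
      have h3 := hc k' i m (e ▸ hVi) h1 h2
      rw [← h2, h3, h1, e, wordOp_canon ops (k' + ei i)]
      intro j hj
      simp [hm j hj, ei_lt (hj.trans hmi)]

/-! ### Symmetry of second derivatives -/

lemma pd_comm {g : Pt d → ℝ} {i j : Fin (d + 1)} (hg : Differentiable ℝ g)
    (hi : Differentiable ℝ (pd i g)) (hj : Differentiable ℝ (pd j g)) :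
    pd i (pd j g) = pd j (pd i g) := by
  funext z
  let L : ℝ × ℝ →L[ℝ] Pt d :=
    (ContinuousLinearMap.fst ℝ ℝ ℝ).smulRight (Pi.single i 1) +
      (ContinuousLinearMap.snd ℝ ℝ ℝ).smulRight (Pi.single j 1)
  have hL : ∀ p : ℝ × ℝ, HasFDerivAt (fun p => z + L p) L p := fun p =>
    (L.hasFDerivAt).const_add z
  let F : ℝ × ℝ → ℝ := fun p => g (z + L p)
  let f' : ℝ × ℝ → (ℝ × ℝ →L[ℝ] ℝ) := fun p =>
    pd i g (z + L p) • ContinuousLinearMap.fst ℝ ℝ ℝ + pd j g (z + L p) • ContinuousLinearMap.snd ℝ ℝ ℝ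
  have h1 : ∀ p, HasFDerivAt F (f' p) p := by
    intro p
    have := ((hg (z + L p)).hasFDerivAt).comp p (hL p)
    have heq : f' p = (fderiv ℝ g (z + L p)).comp L := by ext <;> simp [f', L, pd]
    rw [heq]; exact this
  have hdi : HasFDerivAt (fun p => pd i g (z + L p)) ((fderiv ℝ (pd i g) z).comp L) 0 := by
    have := ((hi (z + L 0)).hasFDerivAt).comp (0 : ℝ × ℝ) (hL 0)
    simpa [Function.comp_def] using this
  have hdj : HasFDerivAt (fun p => pd j g (z + L p)) ((fderiv ℝ (pd j g) z).comp L) 0 := by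
    have := ((hj (z + L 0)).hasFDerivAt).comp (0 : ℝ × ℝ) (hL 0)
    simpa [Function.comp_def] using this
  have h2 := (hdi.smul_const (ContinuousLinearMap.fst ℝ ℝ ℝ)).add
    (hdj.smul_const (ContinuousLinearMap.snd ℝ ℝ ℝ))
  have h3 := second_derivative_symmetric h1 h2 (1, 0) (0, 1)
  simpa [L, pd] using h3

/-! ### Differentiability from partial derivatives -/

lemma hasFDerivAt_of_partials {E ι : Type*} [NormedAddCommGroup E] [NormedSpace ℝ E] [Fintype ι]
    [DecidableEq ι] (e : ι → E) (c : ι → E →L[ℝ] ℝ) (hec : ∀ h, ∑ i, c i h • e i = h)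
    (F : E → ℝ) (g : ι → E → ℝ) (i0 : ι)
    (hd : ∀ x i, HasDerivAt (fun t : ℝ => F (x + t • e i)) (g i x) 0)
    (hc : ∀ i, i ≠ i0 → Continuous (g i)) (x : E) :
    HasFDerivAt F (∑ i, g i x • c i) x := by
  have hd' : ∀ x i (t : ℝ), HasDerivAt (fun t : ℝ => F (x + t • e i)) (g i (x + t • e i)) t := by
    intro x i t
    have h := hd (x + t • e i) i
    have h' : HasDerivAt (fun s : ℝ => F (x + t • e i + s • e i)) (g i (x + t • e i)) (t - t) := by
      simpa using h
    have := h'.comp_sub_const t t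
    refine this.congr_of_eventuallyEq (Filter.Eventually.of_forall fun s => ?_)
    simp only []
    congr 1
    rw [add_assoc, ← add_smul]; congr 2; ring
  have key : ∀ s : Finset ι, i0 ∉ s →
      (fun h => F (x + (c i0 h • e i0 + ∑ i ∈ s, c i h • e i)) - F x -
        (c i0 h * g i0 x + ∑ i ∈ s, c i h * g i x)) =o[nhds 0] (fun h : E => h) := by
    intro s
    induction s using Finset.induction_on with
    | empty =>
      intro _
      simp only [Finset.sum_empty, add_zero]
      have h1 := (hd x i0)
      rw [hasDerivAt_iff_isLittleO] at h1
      have ht : Tendsto (fun h => c i0 h) (nhds 0) (nhds 0) := by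
        have := (c i0).continuous.tendsto 0
        simpa using this
      have h2 := h1.comp_tendsto ht
      have h3 : (fun h : E => c i0 h) =O[nhds 0] (fun h : E => h) :=
        (c i0).isBigO_id _
      refine (h2.congr (fun h => ?_) (fun h => ?_)).trans_isBigO h3
      · simp
      · simp
    | insert i s his ih =>
      intro h0
      have hi0 : i ≠ i0 := by rintro rfl; simp at h0
      have h0s : i0 ∉ s := fun h => h0 (Finset.mem_insert_of_mem h)
      have ih := ih h0s
      let Y : E → E := fun h => x + (c i0 h • e i0 + ∑ i ∈ s, c i h • e i)
      have hY : Continuous Y := by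
        show Continuous fun h => x + (c i0 h • e i0 + ∑ i ∈ s, c i h • e i)
        fun_prop
      have hY0 : Y 0 = x := by simp [Y]
      have step : (fun h => F (Y h + c i h • e i) - F (Y h) - c i h * g i x) =o[nhds 0]
          (fun h : E => h) := by
        have hb : (fun h : E => c i h) =O[nhds 0] (fun h : E => h) := (c i).isBigO_id _
        refine Asymptotics.IsLittleO.trans_isBigO ?_ hb
        rw [Asymptotics.isLittleO_iff]
        intro ε hε
        have hcont : Continuous (fun p : E × ℝ => g i (Y p.1 + p.2 • e i)) :=
          (hc i hi0).comp (by fun_prop)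
        have hc0 := hcont.tendsto (0, 0)
        rw [Metric.tendsto_nhds] at hc0
        have hc1 := hc0 ε hε
        rw [Metric.eventually_nhds_iff] at hc1
        obtain ⟨η, hη, hη'⟩ := hc1
        have ht : Tendsto (fun h => c i h) (nhds 0) (nhds 0) := by
          have := (c i).continuous.tendsto 0
          simpa using this
        have e1 : ∀ᶠ h in nhds (0 : E), dist h 0 < η := Metric.eventually_nhds_iff.mpr ⟨η, hη, fun _ h => h⟩
        have e2 : ∀ᶠ h in nhds (0 : E), dist (c i h) 0 < η := Metric.tendsto_nhds.mp ht η hη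
        filter_upwards [e1, e2] with h hh1 hh2
        have hmv := Convex.norm_image_sub_le_of_norm_hasDerivWithin_le (C := ε)
          (f := fun t : ℝ => F (Y h + t • e i) - t * g i x)
          (f' := fun t => g i (Y h + t • e i) - g i x) (s := Set.uIcc 0 (c i h)) (x := 0) (y := c i h)
          (fun t _ => by
            have := ((hd' (Y h) i t).sub ((hasDerivAt_id t).mul_const (g i x))).hasDerivWithinAt
              (s := Set.uIcc 0 (c i h))
            show HasDerivWithinAt ((fun t : ℝ => F (Y h + t • e i)) - fun y => y * g i x) _ _ _
            simpa using this)
          (fun t ht => by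
            have h1 : |t| ≤ |c i h| := by
              have := Set.abs_sub_left_of_mem_uIcc ht
              simpa using this
            have h2 : dist (h, t) ((0 : E), (0 : ℝ)) < η := by
              rw [Prod.dist_eq]
              apply max_lt hh1
              simp only [Real.dist_eq, sub_zero] at hh2 ⊢
              exact h1.trans_lt hh2
            have h3 := hη' h2
            simp only [hY0, zero_smul, add_zero] at h3
            rw [Real.dist_eq] at h3
            simpa using h3.le)
          (convex_uIcc _ _) Set.left_mem_uIcc Set.right_mem_uIcc
        simp only [zero_smul, add_zero, zero_mul, sub_zero] at hmv
        have e3 : F (Y h + c i h • e i) - F (Y h) - c i h * g i x =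
            (F (Y h + c i h • e i) - c i h * g i x) - F (Y h) := by ring
        rw [e3]; exact hmv
      have := ih.add step
      refine this.congr_left (fun h => ?_)
      simp only [Finset.sum_insert his, Y]
      have : x + (c i0 h • e i0 + (c i h • e i + ∑ i ∈ s, c i h • e i)) =
        x + (c i0 h • e i0 + ∑ i ∈ s, c i h • e i) + c i h • e i := by abel
      rw [this]; ring
  have hk := key (Finset.univ.erase i0) (Finset.notMem_erase _ _)
  rw [hasFDerivAt_iff_isLittleO_nhds_zero]
  refine hk.congr_left (fun h => ?_)
  have h1 : c i0 h • e i0 + ∑ i ∈ Finset.univ.erase i0, c i h • e i = h := by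
    rw [Finset.add_sum_erase _ (fun i => c i h • e i) (Finset.mem_univ _), hec]
  have h2 : c i0 h * g i0 x + ∑ i ∈ Finset.univ.erase i0, c i h * g i x = ∑ i, c i h * g i x :=
    Finset.add_sum_erase _ (fun i => c i h * g i x) (Finset.mem_univ _)
  rw [h1, h2]
  simp [mul_comm]

end Part1

section Part2

/-! ### Jets and the spaces `C^m(Ψ_r)` -/

/-- Multi-indices. -/
abbrev MI (d : ℕ) := Fin (d + 1) → ℕ

/-- Euclidean norm of the spatial part. -/
noncomputable def vn (uv : Pt d) : ℝ := Real.sqrt (∑ i : Fin d, uv i.succ ^ 2)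

lemma vn_nonneg (uv : Pt d) : 0 ≤ vn uv := Real.sqrt_nonneg _

lemma one_le_vn (uv : Pt d) : 1 ≤ 1 + vn uv := by have := vn_nonneg uv; linarith

lemma vn_pow_pos (uv : Pt d) (n : ℕ) : 0 < (1 + vn uv) ^ n :=
  pow_pos (by have := vn_nonneg uv; linarith) n

lemma mderiv_zero (f : Pt d → ℝ) : mderiv 0 f = f := wordOp_zero pd f

lemma mderiv_of_jet (G : MI d → Pt d → ℝ) (V : MI d → Prop) (hV : ∀ k i, V (k + ei i) → V k)
    (h : ∀ k i, V (k + ei i) → pd i (G k) = G (k + ei i)) :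
    ∀ k, V k → mderiv k (G 0) = G k := by
  intro k
  induction k using multi_induct with
  | h0 => intro _; exact mderiv_zero _
  | hs k i hk ih =>
    intro hv
    rw [mderiv_eq, wordOp_canon _ _ _ _ hk, ← mderiv_eq, ih (hV _ _ hv), h _ _ hv]

lemma pd_const_mul (c : ℝ) (i : Fin (d + 1)) (f : Pt d → ℝ) :
    pd i (fun z => c * f z) = fun z => c * pd i f z := by
  funext z
  by_cases hc : c = 0
  · subst hc; simp [pd]
  · unfold pd
    have : (fun z => c * f z) = c • f := rfl
    rw [this, fderiv_const_smul_field]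
    simp

/-- The kernel with given profile. -/
noncomputable def Kof (f : Pt d → Pt d → ℝ) (z zb : Pt d) : ℝ :=
  if zb 0 < z 0 then
      (z 0 - zb 0) ^ (((2 : ℝ) - d - 2) / 2) *
        f zb (Fin.cons (Real.sqrt (z 0 - zb 0))
          fun i : Fin d => (z i.succ - zb i.succ) / Real.sqrt (z 0 - zb 0))
    else 0

lemma psiRep_Kof (f : Pt d → Pt d → ℝ) : PsiRep 2 f (Kof f) := fun _ _ => rfl

/-- A jet of a family of kernel profiles. -/
structure Jet3 (M r : ℕ) (D : MI d → MI d → MI d → Pt d → Pt d → Pt d → ℝ) : Prop where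
  wdiff : ∀ m', pdeg m' < M → ∀ zb uv, Differentiable ℝ fun w => D m' 0 0 w zb uv
  wpd : ∀ m' i, pdeg (m' + ei i) ≤ M → ∀ w zb uv,
    pd i (fun w => D m' 0 0 w zb uv) w = D (m' + ei i) 0 0 w zb uv
  diff : ∀ m' j mm, pdeg m' ≤ M → pdeg j + ∑ i, mm i < r → ∀ w,
    Differentiable ℝ fun p : Pt d × Pt d => D m' j mm w p.1 p.2
  cont : ∀ m' j mm, pdeg m' ≤ M → pdeg j + ∑ i, mm i ≤ r → ∀ w,
    Continuous fun p : Pt d × Pt d => D m' j mm w p.1 p.2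
  uvpd : ∀ m' mm i, pdeg m' ≤ M → ∑ j, (mm + ei i) j ≤ r → ∀ w zb uv,
    pd i (fun uv => D m' 0 mm w zb uv) uv = D m' 0 (mm + ei i) w zb uv
  zbpd : ∀ m' j mm i, pdeg m' ≤ M → pdeg (j + ei i) + ∑ j, mm j ≤ r → ∀ w zb uv,
    pd i (fun zb => D m' j mm w zb uv) zb = D m' (j + ei i) mm w zb uv

/-- Weighted bound on a jet. -/
def Bd3 (M r n : ℕ) (C : ℝ) (D : MI d → MI d → MI d → Pt d → Pt d → Pt d → ℝ) : Prop :=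
  ∀ m' j mm, pdeg m' ≤ M → pdeg j + ∑ i, mm i ≤ r → ∀ w zb uv,
    (1 + vn uv) ^ n * |D m' j mm w zb uv| ≤ C

variable {M r : ℕ} {D D' : MI d → MI d → MI d → Pt d → Pt d → Pt d → ℝ}

lemma pdeg_lt_of_add_ei {m' : MI d} {i : Fin (d + 1)} (h : pdeg (m' + ei i) ≤ M) : pdeg m' < M := by
  rw [pdeg_add_ei] at h; have := dg_pos i; omega

lemma Jet3.famDeriv_eq (h : Jet3 M r D) (m' : MI d) (hm : pdeg m' ≤ M) (w : Pt d) :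
    famDeriv m' (fun w => Kof (D 0 0 0 w)) w = Kof (D m' 0 0 w) := by
  have key := fun z zb => mderiv_of_jet (fun m' w => Kof (D m' 0 0 w) z zb) (fun m' => pdeg m' ≤ M)
    (fun k i hk => (pdeg_lt_of_add_ei hk).le) (by
      intro k i hk
      unfold Kof
      split_ifs
      · rw [pd_const_mul]
        funext w
        rw [h.wpd k i hk]
      · funext w; simp [pd]) m' hm
  funext z zb
  exact congrFun (key z zb) w

lemma Jet3.famDeriv_diff (h : Jet3 M r D) (m' : MI d) (hm : pdeg m' < M) (z zb : Pt d) :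
    Differentiable ℝ fun w => famDeriv m' (fun w => Kof (D 0 0 0 w)) w z zb := by
  have : (fun w => famDeriv m' (fun w => Kof (D 0 0 0 w)) w z zb) =
      fun w => Kof (D m' 0 0 w) z zb := by
    funext w; rw [h.famDeriv_eq m' hm.le]
  rw [this]
  unfold Kof
  split_ifs
  · exact (h.wdiff m' hm _ _).const_mul _
  · exact differentiable_const _

lemma Jet3.mderiv2_eq (h : Jet3 M r D) (m' : MI d) (hm : pdeg m' ≤ M) (w : Pt d) (j mm : MI d)
    (hj : pdeg j + ∑ i, mm i ≤ r) : mderiv2 j mm (D m' 0 0 w) = D m' j mm w := by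
  have h1 : ∀ zb, mderiv mm (D m' 0 0 w zb) = D m' 0 mm w zb := fun zb =>
    mderiv_of_jet (fun mm uv => D m' 0 mm w zb uv) (fun mm => ∑ i, mm i ≤ r)
      (fun k i hk => by
        simp only [Pi.add_apply, Finset.sum_add_distrib] at hk; omega)
      (fun k i hk => by funext uv; exact h.uvpd m' k i hm hk w zb uv) mm (by omega)
  funext zb uv
  unfold mderiv2
  simp only [h1]
  exact congrFun (mderiv_of_jet (fun j zb => D m' j mm w zb uv) (fun j => pdeg j + ∑ i, mm i ≤ r)
      (fun k i hk => by rw [pdeg_add_ei] at hk; omega)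
      (fun k i hk => by funext zb; exact h.zbpd m' k mm i hm hk w zb uv) j hj) zb

lemma Jet3.smooth (h : Jet3 M r D) (m' : MI d) (hm : pdeg m' ≤ M) (w : Pt d) :
    PsiSmooth r (D m' 0 0 w) := by
  constructor
  · intro j mm hj
    rw [h.mderiv2_eq m' hm w j mm hj.le]
    exact h.diff m' j mm hm hj w
  · intro j mm hj
    rw [h.mderiv2_eq m' hm w j mm hj]
    exact h.cont m' j mm hm hj w

lemma Jet3.psi_le (h : Jet3 M r D) {n : ℕ} {C : ℝ} (hb : Bd3 M r n C D) (m' : MI d)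
    (hm : pdeg m' ≤ M) (w : Pt d) (T : ℝ) : ∀ y ∈ psiSet r T n (D m' 0 0 w), y ≤ C := by
  rintro y ⟨j, mm, zb, uv, hj, -, -, rfl⟩
  rw [h.mderiv2_eq m' hm w j mm hj]
  exact hb m' j mm hm hj w zb uv

lemma psiSet_nonneg {r n : ℕ} {T : ℝ} {Ft : Pt d → Pt d → ℝ} : ∀ y ∈ psiSet r T n Ft, 0 ≤ y := by
  rintro y ⟨j, mm, zb, uv, hj, -, -, rfl⟩
  exact mul_nonneg (pow_nonneg (by have := Real.sqrt_nonneg (∑ i : Fin d, uv i.succ ^ 2); linarith) _)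
    (abs_nonneg _)

lemma Jet3.psiNorm_le (h : Jet3 M r D) {n : ℕ} {C : ℝ} (hC : 0 ≤ C) (hb : Bd3 M r n C D) (m' : MI d)
    (hm : pdeg m' ≤ M) (w : Pt d) (T : ℝ) :
    psiNorm 2 r T n (famDeriv m' (fun w => Kof (D 0 0 0 w)) w) ≤ C := by
  rw [h.famDeriv_eq m' hm]
  unfold psiNorm
  refine le_trans (csInf_le (a := sSup (psiSet r T n (D m' 0 0 w))) ?_ ⟨D m' 0 0 w, psiRep_Kof _,
    h.smooth m' hm w, ⟨C, h.psi_le hb m' hm w T⟩, rfl⟩) (Real.sSup_le (h.psi_le hb m' hm w T) hC)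
  refine ⟨0, ?_⟩
  rintro y ⟨Ft, -, -, -, rfl⟩
  exact Real.sSup_nonneg psiSet_nonneg

lemma Jet3.mem (h : Jet3 M r D) (hb : ∀ n, ∃ C, Bd3 M r n C D) :
    MemCPsi M 2 r (fun w => Kof (D 0 0 0 w)) := by
  refine ⟨h.famDeriv_diff, ?_, ?_⟩
  · intro m' hm w
    rw [h.famDeriv_eq m' hm]
    refine ⟨D m' 0 0 w, psiRep_Kof _, h.smooth m' hm w, fun T _ n => ?_⟩
    obtain ⟨C, hC⟩ := hb n
    exact ⟨C, h.psi_le hC m' hm w T⟩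
  · intro T _ n
    obtain ⟨C, hC⟩ := hb n
    refine ⟨max C 0, ?_⟩
    rintro y ⟨m', w, hm, rfl⟩
    exact h.psiNorm_le (le_max_right _ _) (fun a b c h1 h2 w zb uv =>
      (hC a b c h1 h2 w zb uv).trans (le_max_left _ _)) m' hm w T

lemma Jet3.norm_le (h : Jet3 M r D) {n : ℕ} {C : ℝ} (hC : 0 ≤ C) (hb : Bd3 M r n C D) (T : ℝ) :
    cpsiNorm M 2 r T n (fun w => Kof (D 0 0 0 w)) ≤ C := by
  refine Real.sSup_le ?_ hC
  rintro y ⟨m', w, hm, rfl⟩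
  exact h.psiNorm_le hC hb m' hm w T

lemma pd_add_fun {f g : Pt d → ℝ} {z : Pt d} (i : Fin (d + 1)) (hf : DifferentiableAt ℝ f z)
    (hg : DifferentiableAt ℝ g z) : pd i (fun z => f z + g z) z = pd i f z + pd i g z := by
  unfold pd
  have : (fun z => f z + g z) = f + g := rfl
  rw [this, fderiv_add hf hg]; rfl

lemma Jet3.diff_uv (h : Jet3 M r D) (m' j mm : MI d) (h1 : pdeg m' ≤ M)
    (h2 : pdeg j + ∑ i, mm i < r) (w zb : Pt d) : Differentiable ℝ fun uv => D m' j mm w zb uv :=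
  (h.diff m' j mm h1 h2 w).comp (f := fun uv => (zb, uv))
    ((differentiable_const zb).prodMk differentiable_id)

lemma Jet3.diff_zb (h : Jet3 M r D) (m' j mm : MI d) (h1 : pdeg m' ≤ M)
    (h2 : pdeg j + ∑ i, mm i < r) (w uv : Pt d) : Differentiable ℝ fun zb => D m' j mm w zb uv :=
  (h.diff m' j mm h1 h2 w).comp (f := fun zb => (zb, uv))
    (differentiable_id.prodMk (differentiable_const uv))

lemma Jet3.add (h : Jet3 M r D) (h' : Jet3 M r D') :
    Jet3 M r (fun m' j mm w zb uv => D m' j mm w zb uv + D' m' j mm w zb uv) where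
  wdiff m' hm zb uv := (h.wdiff m' hm zb uv).add (h'.wdiff m' hm zb uv)
  wpd m' i hm w zb uv := by
    rw [pd_add_fun i (h.wdiff m' (pdeg_lt_of_add_ei hm) zb uv w)
      (h'.wdiff m' (pdeg_lt_of_add_ei hm) zb uv w), h.wpd _ _ hm, h'.wpd _ _ hm]
  diff m' j mm h1 h2 w := (h.diff m' j mm h1 h2 w).add (h'.diff m' j mm h1 h2 w)
  cont m' j mm h1 h2 w := (h.cont m' j mm h1 h2 w).add (h'.cont m' j mm h1 h2 w)
  uvpd m' mm i h1 h2 w zb uv := by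
    have h3 : pdeg (0 : MI d) + ∑ j, mm j < r := by
      simp only [Pi.add_apply, Finset.sum_add_distrib, sum_ei] at h2
      rw [pdeg_zero]; omega
    rw [pd_add_fun i (h.diff_uv m' 0 mm h1 h3 w zb uv) (h'.diff_uv m' 0 mm h1 h3 w zb uv),
      h.uvpd _ _ _ h1 h2, h'.uvpd _ _ _ h1 h2]
  zbpd m' j mm i h1 h2 w zb uv := by
    have h3 : pdeg j + ∑ j, mm j < r := by
      rw [pdeg_add_ei] at h2; have := dg_pos i; omega
    rw [pd_add_fun i (h.diff_zb m' j mm h1 h3 w uv zb) (h'.diff_zb m' j mm h1 h3 w uv zb),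
      h.zbpd _ _ _ _ h1 h2, h'.zbpd _ _ _ _ h1 h2]

lemma Jet3.const_mul (h : Jet3 M r D) (c : ℝ) :
    Jet3 M r (fun m' j mm w zb uv => c * D m' j mm w zb uv) where
  wdiff m' hm zb uv := (h.wdiff m' hm zb uv).const_mul c
  wpd m' i hm w zb uv := by rw [pd_const_mul]; exact congrArg (c * ·) (h.wpd _ _ hm w zb uv)
  diff m' j mm h1 h2 w := (h.diff m' j mm h1 h2 w).const_mul c
  cont m' j mm h1 h2 w := (h.cont m' j mm h1 h2 w).const_mul c
  uvpd m' mm i h1 h2 w zb uv := by rw [pd_const_mul]; exact congrArg (c * ·) (h.uvpd _ _ _ h1 h2 w zb uv)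
  zbpd m' j mm i h1 h2 w zb uv := by rw [pd_const_mul]; exact congrArg (c * ·) (h.zbpd _ _ _ _ h1 h2 w zb uv)

lemma Bd3.add {n : ℕ} {C C' : ℝ} (h : Bd3 M r n C D) (h' : Bd3 M r n C' D') :
    Bd3 M r n (C + C') (fun m' j mm w zb uv => D m' j mm w zb uv + D' m' j mm w zb uv) := by
  intro m' j mm h1 h2 w zb uv
  have e1 := h m' j mm h1 h2 w zb uv
  have e2 := h' m' j mm h1 h2 w zb uv
  calc _ ≤ (1 + vn uv) ^ n * (|D m' j mm w zb uv| + |D' m' j mm w zb uv|) :=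
        mul_le_mul_of_nonneg_left (abs_add_le _ _) (vn_pow_pos uv n).le
    _ ≤ _ := by rw [mul_add]; exact add_le_add e1 e2

lemma Bd3.const_mul {n : ℕ} {C : ℝ} (h : Bd3 M r n C D) (c : ℝ) :
    Bd3 M r n (|c| * C) (fun m' j mm w zb uv => c * D m' j mm w zb uv) := by
  intro m' j mm h1 h2 w zb uv
  have e1 := h m' j mm h1 h2 w zb uv
  rw [abs_mul]
  calc _ = |c| * ((1 + vn uv) ^ n * |D m' j mm w zb uv|) := by ring
    _ ≤ _ := mul_le_mul_of_nonneg_left e1 (abs_nonneg c)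

lemma jet3_zero : Jet3 M r (fun _ _ _ _ _ _ => 0 : MI d → MI d → MI d → Pt d → Pt d → Pt d → ℝ) where
  wdiff m' hm zb uv := differentiable_const _
  wpd m' i hm w zb uv := by simp [pd]
  diff m' j mm h1 h2 w := differentiable_const _
  cont m' j mm h1 h2 w := continuous_const
  uvpd m' mm i h1 h2 w zb uv := by simp [pd]
  zbpd m' j mm i h1 h2 w zb uv := by simp [pd]

end Part2

section Part3

/-! ### Two-variable jets -/

/-- A jet of a function of `(y, uv)`, with `σ` parabolic derivatives in `y` and infinitely many
in `uv`. -/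
structure Jet2 (σ : ℕ) (D : MI d → MI d → Pt d → Pt d → ℝ) : Prop where
  diff : ∀ j m, pdeg j < σ → Differentiable ℝ fun p : Pt d × Pt d => D j m p.1 p.2
  cont : ∀ j m, pdeg j ≤ σ → Continuous fun p : Pt d × Pt d => D j m p.1 p.2
  ypd : ∀ j m i, pdeg (j + ei i) ≤ σ → ∀ y uv,
    pd i (fun y => D j m y uv) y = D (j + ei i) m y uv
  uvdiff : ∀ j m, pdeg j ≤ σ → ∀ y, Differentiable ℝ fun uv => D j m y uv
  uvpd : ∀ j m i, pdeg j ≤ σ → ∀ y uv, pd i (fun uv => D j m y uv) uv = D j (m + ei i) y uv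
  bdd : ∀ j m, pdeg j ≤ σ → ∃ C, ∀ y uv, |D j m y uv| ≤ C

/-- Weighted bound on a two-variable jet. -/
def Bd2 (σ r n : ℕ) (C : ℝ) (D : MI d → MI d → Pt d → Pt d → ℝ) : Prop :=
  ∀ j m, pdeg j ≤ σ → ∑ i, m i ≤ r → ∀ y uv, (1 + vn uv) ^ n * |D j m y uv| ≤ C

lemma pd_of_line {f : Pt d → ℝ} {z : Pt d} {i : Fin (d + 1)} {v : ℝ} (hf : DifferentiableAt ℝ f z)
    (h : HasDerivAt (fun t : ℝ => f (z + t • Pi.single i 1)) v 0) : pd i f z = v := by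
  have h1 : HasDerivAt (fun t : ℝ => z + t • (Pi.single i 1 : Pt d)) (Pi.single i 1) 0 := by
    simpa using ((hasDerivAt_id (0 : ℝ)).smul_const (Pi.single i 1 : Pt d)).const_add z
  have h2 : HasFDerivAt f (fderiv ℝ f z) (z + (0 : ℝ) • (Pi.single i 1 : Pt d)) := by
    simpa using hf.hasFDerivAt
  exact (h2.comp_hasDerivAt (0 : ℝ) h1).unique h

lemma line_deriv {f : Pt d → ℝ} (hf : Differentiable ℝ f) (x : Pt d) (i : Fin (d + 1)) (c t : ℝ) :
    HasDerivAt (fun t : ℝ => f (x + t • (c • Pi.single i 1))) (c * pd i f (x + t • (c • Pi.single i 1)))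
      t := by
  have h1 : HasDerivAt (fun t : ℝ => x + t • (c • (Pi.single i 1 : Pt d))) (c • Pi.single i 1) t := by
    simpa using ((hasDerivAt_id t).smul_const (c • (Pi.single i 1 : Pt d))).const_add x
  have h2 := (hf (x + t • (c • (Pi.single i 1 : Pt d)))).hasFDerivAt.comp_hasDerivAt t h1
  have h3 : c * pd i f (x + t • (c • Pi.single i 1)) =
      fderiv ℝ f (x + t • (c • (Pi.single i 1 : Pt d))) (c • Pi.single i 1) := by
    rw [map_smul]; rfl
  rw [h3]; exact h2

/-- The weight of an integral jet. -/
noncomputable def om (κ : ℝ → ℝ) (θ : Fin (d + 1) → ℝ → ℝ) (m' j : MI d) (s : ℝ) : ℝ :=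
  κ s * ((∏ i, (1 - θ i s) ^ m' i) * ∏ i, θ i s ^ j i)

/-- The interpolation point of an integral jet. -/
def YY (θ : Fin (d + 1) → ℝ → ℝ) (w zb : Pt d) (s : ℝ) : Pt d := fun i => w i + θ i s * (zb i - w i)

lemma prod_pow_ei (x : Fin (d + 1) → ℝ) (k : MI d) (i : Fin (d + 1)) :
    ∏ a, x a ^ (k + ei i) a = (∏ a, x a ^ k a) * x i := by
  simp only [Pi.add_apply, pow_add, Finset.prod_mul_distrib]
  congr 1
  rw [Finset.prod_eq_single i]
  · simp [ei]
  · intro b _ hb; simp [ei, hb]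
  · simp

lemma om_j (κ : ℝ → ℝ) (θ : Fin (d + 1) → ℝ → ℝ) (m' j : MI d) (i : Fin (d + 1)) (s : ℝ) :
    om κ θ m' (j + ei i) s = om κ θ m' j s * θ i s := by
  unfold om; rw [prod_pow_ei]; ring

lemma om_m (κ : ℝ → ℝ) (θ : Fin (d + 1) → ℝ → ℝ) (m' j : MI d) (i : Fin (d + 1)) (s : ℝ) :
    om κ θ (m' + ei i) j s = om κ θ m' j s * (1 - θ i s) := by
  unfold om; rw [prod_pow_ei (fun i => 1 - θ i s)]; ring

lemma YY_zb (θ : Fin (d + 1) → ℝ → ℝ) (w zb : Pt d) (s t : ℝ) (i : Fin (d + 1)) :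
    YY θ w (zb + t • Pi.single i 1) s = YY θ w zb s + t • (θ i s • Pi.single i 1) := by
  funext a
  by_cases h : a = i
  · subst h; simp [YY]; ring
  · simp [YY, h]

lemma YY_w (θ : Fin (d + 1) → ℝ → ℝ) (w zb : Pt d) (s t : ℝ) (i : Fin (d + 1)) :
    YY θ (w + t • Pi.single i 1) zb s = YY θ w zb s + t • ((1 - θ i s) • Pi.single i 1) := by
  funext a
  by_cases h : a = i
  · subst h; simp [YY]; ring
  · simp [YY, h]

/-- Data of an integral jet. -/
structure IData (μ : Measure ℝ) (κ : ℝ → ℝ) (θ : Fin (d + 1) → ℝ → ℝ) (K : ℝ) : Prop where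
  fin : IsFiniteMeasure μ
  κc : Continuous κ
  θc : ∀ i, Continuous (θ i)
  ae : ∀ᵐ s ∂μ, |κ s| ≤ K ∧ ∀ i, 0 ≤ θ i s ∧ θ i s ≤ 1
  bare : ∀ (m' j : MI d) (f : Pt d → ℝ), Differentiable ℝ f → ∀ w zb : Pt d,
    ∃ g, HasDerivAt (fun t : ℝ => ∫ s, om κ θ m' j s * f (YY θ w (zb + t • Pi.single 0 1) s) ∂μ) g 0

/-- The integral jet. -/
noncomputable def IJ (μ : Measure ℝ) (κ : ℝ → ℝ) (θ : Fin (d + 1) → ℝ → ℝ)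
    (D : MI d → MI d → Pt d → Pt d → ℝ) (m' j mm : MI d) (w zb uv : Pt d) : ℝ :=
  ∫ s, om κ θ m' j s * D (m' + j) mm (YY θ w zb s) uv ∂μ

variable {μ : Measure ℝ} {κ : ℝ → ℝ} {θ : Fin (d + 1) → ℝ → ℝ} {K : ℝ}

lemma IData.om_cont (I : IData μ κ θ K) (m' j : MI d) : Continuous (om κ θ m' j) := by
  have h1 := I.κc
  have h2 := I.θc
  unfold om
  fun_prop

lemma IData.om_le (I : IData μ κ θ K) (m' j : MI d) : ∀ᵐ s ∂μ, |om κ θ m' j s| ≤ K := by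
  filter_upwards [I.ae] with s hs
  unfold om
  rw [abs_mul, abs_mul, Finset.abs_prod, Finset.abs_prod]
  have hK : 0 ≤ K := (abs_nonneg _).trans hs.1
  have h1 : ∏ i, |(1 - θ i s) ^ m' i| ≤ 1 := Finset.prod_le_one (fun i _ => abs_nonneg _)
    (fun i _ => by
      rw [abs_pow]; apply pow_le_one₀ (abs_nonneg _)
      rw [abs_le]; constructor <;> linarith [(hs.2 i).1, (hs.2 i).2])
  have h2 : ∏ i, |(θ i s) ^ j i| ≤ 1 := Finset.prod_le_one (fun i _ => abs_nonneg _)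
    (fun i _ => by
      rw [abs_pow]; apply pow_le_one₀ (abs_nonneg _)
      rw [abs_le]; constructor <;> linarith [(hs.2 i).1, (hs.2 i).2])
  have h3 : 0 ≤ ∏ i, |(θ i s) ^ j i| := Finset.prod_nonneg fun i _ => abs_nonneg _
  have h4 := mul_le_one₀ h1 h3 h2
  calc _ ≤ K * 1 := mul_le_mul hs.1 h4 (by positivity) hK
    _ = K := mul_one K

lemma IData.YY_cont (I : IData μ κ θ K) :
    Continuous fun q : ℝ × (Pt d × Pt d) => YY θ q.2.1 q.2.2 q.1 := by
  have h2 := I.θc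
  unfold YY
  fun_prop

lemma IData.integrable (I : IData μ κ θ K) (m' j : MI d) {G : ℝ → ℝ} (hG : Continuous G) {C : ℝ}
    (hC : ∀ s, |G s| ≤ C) : Integrable (fun s => om κ θ m' j s * G s) μ := by
  have := I.fin
  refine Integrable.of_bound ((I.om_cont m' j).mul hG).aestronglyMeasurable (K * C) ?_
  filter_upwards [I.om_le m' j] with s hs
  rw [Real.norm_eq_abs, abs_mul]
  exact mul_le_mul hs (hC s) (abs_nonneg _) ((abs_nonneg _).trans hs)

lemma IData.abs_le (I : IData μ κ θ K) (m' j : MI d) {G : ℝ → ℝ} {C : ℝ}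
    (hC : ∀ s, |G s| ≤ C) : |∫ s, om κ θ m' j s * G s ∂μ| ≤ K * C * μ.real Set.univ := by
  have := I.fin
  rw [← Real.norm_eq_abs]
  apply norm_integral_le_of_norm_le_const
  filter_upwards [I.om_le m' j] with s hs
  rw [Real.norm_eq_abs, abs_mul]
  exact mul_le_mul hs (hC s) (abs_nonneg _) ((abs_nonneg _).trans hs)

lemma IData.hasDeriv (I : IData μ κ θ K) (m' j : MI d) {G G' : ℝ → ℝ → ℝ} {C : ℝ}
    (hG : ∀ t, Continuous fun s => G s t) (hG' : ∀ t, Continuous fun s => G' s t)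
    (hC : ∀ s t, |G s t| ≤ C) (hC' : ∀ᵐ s ∂μ, ∀ t, |G' s t| ≤ C)
    (hd : ∀ s t, HasDerivAt (G s) (G' s t) t) (t : ℝ) :
    HasDerivAt (fun t => ∫ s, om κ θ m' j s * G s t ∂μ) (∫ s, om κ θ m' j s * G' s t ∂μ) t := by
  have := I.fin
  refine (hasDerivAt_integral_of_dominated_loc_of_deriv_le (F := fun t s => om κ θ m' j s * G s t)
    (F' := fun t s => om κ θ m' j s * G' s t) (bound := fun _ => K * C) (s := Set.univ)
    Filter.univ_mem ?_ ?_ ?_ ?_ ?_ ?_).2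
  · exact Eventually.of_forall fun t => ((I.om_cont m' j).mul (hG t)).aestronglyMeasurable
  · exact I.integrable m' j (hG t) (fun s => hC s t)
  · exact ((I.om_cont m' j).mul (hG' t)).aestronglyMeasurable
  · filter_upwards [I.om_le m' j, hC'] with s hs hs' t _
    rw [Real.norm_eq_abs, abs_mul]
    exact mul_le_mul hs (hs' t) (abs_nonneg _) ((abs_nonneg _).trans hs)
  · exact integrable_const _
  · exact Eventually.of_forall fun s t _ => (hd s t).const_mul _

lemma IData.cont (I : IData μ κ θ K) (m' j : MI d) {X : Type*} [TopologicalSpace X]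
    [FirstCountableTopology X] {G : ℝ → X → ℝ} (hG : Continuous fun q : ℝ × X => G q.1 q.2) {C : ℝ}
    (hC : ∀ s t, |G s t| ≤ C) : Continuous fun x => ∫ s, om κ θ m' j s * G s x ∂μ := by
  have := I.fin
  refine continuous_of_dominated (bound := fun _ => K * C) ?_ ?_ ?_ ?_
  · intro x
    exact ((I.om_cont m' j).mul (hG.comp (continuous_id.prodMk continuous_const))).aestronglyMeasurable
  · intro x
    filter_upwards [I.om_le m' j] with s hs
    rw [Real.norm_eq_abs, abs_mul]
    exact mul_le_mul hs (hC s x) (abs_nonneg _) ((abs_nonneg _).trans hs)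
  · exact integrable_const _
  · exact Eventually.of_forall fun s =>
      continuous_const.mul (hG.comp (continuous_const.prodMk continuous_id))

variable {σ : ℕ} {D D' : MI d → MI d → Pt d → Pt d → ℝ}

lemma Jet2.cont_YY (J : Jet2 σ D) (I : IData μ κ θ K) (j m : MI d) (hj : pdeg j ≤ σ) :
    Continuous fun q : ℝ × ((Pt d × Pt d) × Pt d) => D j m (YY θ q.2.1.1 q.2.1.2 q.1) q.2.2 := by
  have h1 := J.cont j m hj
  have h2 := I.YY_cont
  exact h1.comp ((h2.comp (continuous_fst.prodMk (continuous_fst.comp continuous_snd))).prodMk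
    (continuous_snd.comp continuous_snd))

lemma Jet2.IJ_cont (J : Jet2 σ D) (I : IData μ κ θ K) (m' j mm : MI d) (h : pdeg (m' + j) ≤ σ) :
    Continuous fun q : (Pt d × Pt d) × Pt d => IJ μ κ θ D m' j mm q.1.1 q.1.2 q.2 := by
  obtain ⟨C, hC⟩ := J.bdd (m' + j) mm h
  exact I.cont m' j (G := fun s (q : (Pt d × Pt d) × Pt d) => D (m' + j) mm (YY θ q.1.1 q.1.2 s) q.2)
    (J.cont_YY I (m' + j) mm h) (fun s q => hC _ _)

lemma Jet2.diff_y (J : Jet2 σ D) (j m : MI d) (hj : pdeg j < σ) (uv : Pt d) :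
    Differentiable ℝ fun y => D j m y uv :=
  (J.diff j m hj).comp (f := fun y => (y, uv)) (differentiable_id.prodMk (differentiable_const uv))

lemma Jet2.cont_s (J : Jet2 σ D) (I : IData μ κ θ K) (j m : MI d) (hj : pdeg j ≤ σ) (w zb uv : Pt d) :
    Continuous fun s => D j m (YY θ w zb s) uv :=
  (J.cont_YY I j m hj).comp (f := fun s => (s, ((w, zb), uv))) (by fun_prop)

lemma Jet2.IJ_zb (J : Jet2 σ D) (I : IData μ κ θ K) (m' j mm : MI d) (i : Fin (d + 1))
    (h : pdeg (m' + (j + ei i)) ≤ σ) (w zb uv : Pt d) :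
    HasDerivAt (fun t : ℝ => IJ μ κ θ D m' j mm w (zb + t • Pi.single i 1) uv)
      (IJ μ κ θ D m' (j + ei i) mm w zb uv) 0 := by
  rw [← add_assoc] at h
  have h' : pdeg (m' + j) < σ := by rw [pdeg_add_ei] at h; have := dg_pos i; omega
  obtain ⟨C, hC⟩ := J.bdd _ mm h'.le
  obtain ⟨C', hC'⟩ := J.bdd _ mm h
  have := I.hasDeriv m' j (C := max C C') (G := fun s t => D (m' + j) mm (YY θ w (zb + t • Pi.single i 1) s) uv)
    (G' := fun s t => θ i s * D (m' + j + ei i) mm (YY θ w (zb + t • Pi.single i 1) s) uv)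
    (fun t => J.cont_s I _ _ h'.le _ _ _)
    (fun t => (I.θc i).mul (J.cont_s I _ _ h _ _ _))
    (fun s t => (hC _ _).trans (le_max_left _ _))
    (by
      filter_upwards [I.ae] with s hs t
      rw [abs_mul]
      refine le_trans ?_ (le_max_right C C')
      have h1 : |θ i s| ≤ 1 := by rw [_root_.abs_le]; constructor <;> linarith [(hs.2 i).1, (hs.2 i).2]
      calc _ ≤ 1 * C' := mul_le_mul h1 (hC' _ _) (abs_nonneg _) zero_le_one
        _ = C' := one_mul _)
    (fun s t => by
      simp only [YY_zb]
      have := line_deriv (J.diff_y _ mm h' uv) (YY θ w zb s) i (θ i s) t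
      rwa [J.ypd _ _ _ h] at this) 0
  unfold IJ
  simp only [zero_smul, add_zero, ← mul_assoc, ← om_j] at this
  simpa only [add_assoc] using this

lemma Jet2.IJ_w (J : Jet2 σ D) (I : IData μ κ θ K) (m' j mm : MI d) (i : Fin (d + 1))
    (h : pdeg ((m' + ei i) + j) ≤ σ) (w zb uv : Pt d) :
    HasDerivAt (fun t : ℝ => IJ μ κ θ D m' j mm (w + t • Pi.single i 1) zb uv)
      (IJ μ κ θ D (m' + ei i) j mm w zb uv) 0 := by
  have e : m' + ei i + j = m' + j + ei i := by rw [add_assoc, add_comm (ei i), add_assoc]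
  rw [e] at h
  have h' : pdeg (m' + j) < σ := by rw [pdeg_add_ei] at h; have := dg_pos i; omega
  obtain ⟨C, hC⟩ := J.bdd _ mm h'.le
  obtain ⟨C', hC'⟩ := J.bdd _ mm h
  have := I.hasDeriv m' j (C := max C C') (G := fun s t => D (m' + j) mm (YY θ (w + t • Pi.single i 1) zb s) uv)
    (G' := fun s t => (1 - θ i s) * D (m' + j + ei i) mm (YY θ (w + t • Pi.single i 1) zb s) uv)
    (fun t => J.cont_s I _ _ h'.le _ _ _)
    (fun t => (continuous_const.sub (I.θc i)).mul (J.cont_s I _ _ h _ _ _))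
    (fun s t => (hC _ _).trans (le_max_left _ _))
    (by
      filter_upwards [I.ae] with s hs t
      rw [abs_mul]
      refine le_trans ?_ (le_max_right C C')
      have h1 : |1 - θ i s| ≤ 1 := by
        rw [_root_.abs_le]; constructor <;> linarith [(hs.2 i).1, (hs.2 i).2]
      calc _ ≤ 1 * C' := mul_le_mul h1 (hC' _ _) (abs_nonneg _) zero_le_one
        _ = C' := one_mul _)
    (fun s t => by
      simp only [YY_w]
      have := line_deriv (J.diff_y _ mm h' uv) (YY θ w zb s) i (1 - θ i s) t
      rwa [J.ypd _ _ _ h] at this) 0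
  unfold IJ
  simp only [zero_smul, add_zero, ← mul_assoc, ← om_m] at this
  rw [e]
  exact this

lemma Jet2.IJ_uv (J : Jet2 σ D) (I : IData μ κ θ K) (m' j mm : MI d) (i : Fin (d + 1))
    (h : pdeg (m' + j) ≤ σ) (w zb uv : Pt d) :
    HasDerivAt (fun t : ℝ => IJ μ κ θ D m' j mm w zb (uv + t • Pi.single i 1))
      (IJ μ κ θ D m' j (mm + ei i) w zb uv) 0 := by
  obtain ⟨C, hC⟩ := J.bdd _ mm h
  obtain ⟨C', hC'⟩ := J.bdd _ (mm + ei i) h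
  have := I.hasDeriv m' j (C := max C C') (G := fun s t => D (m' + j) mm (YY θ w zb s) (uv + t • Pi.single i 1))
    (G' := fun s t => D (m' + j) (mm + ei i) (YY θ w zb s) (uv + t • Pi.single i 1))
    (fun t => J.cont_s I _ _ h _ _ _)
    (fun t => J.cont_s I _ _ h _ _ _)
    (fun s t => (hC _ _).trans (le_max_left _ _))
    (Eventually.of_forall fun s t => (hC' _ _).trans (le_max_right _ _))
    (fun s t => by
      have := line_deriv (J.uvdiff _ mm h (YY θ w zb s)) uv i 1 t
      rw [J.uvpd _ _ _ h] at this
      simpa only [one_smul, one_mul] using this) 0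
  unfold IJ
  simpa only [zero_smul, add_zero] using this

lemma sum_single_smul (h : Pt d) : ∑ i, h i • (Pi.single i 1 : Pt d) = h := by
  funext a
  simp [Finset.sum_apply, Pi.single_apply]

lemma differentiable_of_partials (f : Pt d → ℝ) (g : Fin (d + 1) → Pt d → ℝ)
    (hd : ∀ x i, HasDerivAt (fun t : ℝ => f (x + t • Pi.single i 1)) (g i x) 0)
    (hc : ∀ i, i ≠ 0 → Continuous (g i)) : Differentiable ℝ f := fun x =>
  (hasFDerivAt_of_partials (fun i => (Pi.single i 1 : Pt d))
    (fun i => ContinuousLinearMap.proj (R := ℝ) (φ := fun _ => ℝ) i) (by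
      intro h; exact sum_single_smul h) f g 0 hd hc x).differentiableAt

lemma differentiable_of_partials₂ (f : Pt d × Pt d → ℝ) (g g' : Fin (d + 1) → Pt d × Pt d → ℝ)
    (hd : ∀ x y i, HasDerivAt (fun t : ℝ => f (x + t • Pi.single i 1, y)) (g i (x, y)) 0)
    (hd' : ∀ x y i, HasDerivAt (fun t : ℝ => f (x, y + t • Pi.single i 1)) (g' i (x, y)) 0)
    (hc : ∀ i, i ≠ 0 → Continuous (g i)) (hc' : ∀ i, Continuous (g' i)) : Differentiable ℝ f := by
  intro x
  refine (hasFDerivAt_of_partials (ι := Fin (d + 1) ⊕ Fin (d + 1))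
    (Sum.elim (fun i => ((Pi.single i 1 : Pt d), (0 : Pt d))) (fun i => ((0 : Pt d), (Pi.single i 1 : Pt d))))
    (Sum.elim (fun i => (ContinuousLinearMap.proj (R := ℝ) (φ := fun _ => ℝ) i).comp
      (ContinuousLinearMap.fst ℝ (Pt d) (Pt d))) (fun i => (ContinuousLinearMap.proj (R := ℝ)
      (φ := fun _ => ℝ) i).comp (ContinuousLinearMap.snd ℝ (Pt d) (Pt d)))) ?_ f
      (Sum.elim g g') (Sum.inl 0) ?_ ?_ x).differentiableAt
  · rintro ⟨h1, h2⟩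
    rw [Fintype.sum_sum_type]
    simp only [Sum.elim_inl, Sum.elim_inr, ContinuousLinearMap.comp_apply, ContinuousLinearMap.coe_fst',
      ContinuousLinearMap.coe_snd', ContinuousLinearMap.proj_apply, Prod.smul_mk, smul_zero]
    have e1 := sum_single_smul h1
    have e2 := sum_single_smul h2
    apply Prod.ext
    · simp only [Prod.fst_add, Prod.fst_sum, Finset.sum_const_zero, add_zero]; exact e1
    · simp only [Prod.snd_add, Prod.snd_sum, Finset.sum_const_zero, zero_add]; exact e2
  · rintro ⟨x, y⟩ (i | i)
    · simpa using hd x y i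
    · simpa using hd' x y i
  · rintro (i | i) hi
    · exact hc i (fun h => hi (by rw [h]))
    · exact hc' i

lemma Jet2.IJ_jet3 (J : Jet2 σ D) (I : IData μ κ θ K) {M r : ℕ} (hr : 1 ≤ r) (hM : M + r ≤ σ) :
    Jet3 M r (IJ μ κ θ D) := by
  have hw : ∀ m', pdeg m' < M → ∀ zb uv, Differentiable ℝ fun w => IJ μ κ θ D m' 0 0 w zb uv := by
    intro m' hm zb uv
    have hdeg : ∀ i, pdeg (m' + ei i + 0) ≤ σ := fun i => by
      rw [add_zero, pdeg_add_ei]; have := dg_le i; omega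
    refine differentiable_of_partials _ (fun i w => IJ μ κ θ D (m' + ei i) 0 0 w zb uv)
      (fun w i => J.IJ_w I m' 0 0 i (hdeg i) w zb uv) (fun i _ => ?_)
    exact (J.IJ_cont I (m' + ei i) 0 0 (hdeg i)).comp (f := fun w => ((w, zb), uv)) (by fun_prop)
  have hdiff : ∀ m' j mm, pdeg m' ≤ M → pdeg j + ∑ i, mm i < r → ∀ w,
      Differentiable ℝ fun p : Pt d × Pt d => IJ μ κ θ D m' j mm w p.1 p.2 := by
    intro m' j mm hm hj w
    have h0 : pdeg (m' + j) < σ := by rw [pdeg_add]; omega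
    have hb : ∀ x y, ∃ g, HasDerivAt (fun t : ℝ => IJ μ κ θ D m' j mm w (x + t • Pi.single 0 1) y) g 0 :=
      fun x y => I.bare m' j (fun z => D (m' + j) mm z y) (J.diff_y _ mm h0 y) w x
    choose g0 hg0 using hb
    refine differentiable_of_partials₂ _
      (fun i p => if i = 0 then g0 p.1 p.2 else IJ μ κ θ D m' (j + ei i) mm w p.1 p.2)
      (fun i p => IJ μ κ θ D m' j (mm + ei i) w p.1 p.2) ?_ ?_ ?_ ?_
    · intro x y i
      by_cases hi : i = 0
      · subst hi; simpa using hg0 x y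
      · have : dg i = 1 := by simp [dg, hi]
        simp only [hi, if_false]
        exact J.IJ_zb I m' j mm i (by rw [pdeg_add, pdeg_add_ei]; omega) w x y
    · intro x y i
      exact J.IJ_uv I m' j mm i h0.le w x y
    · intro i hi
      have : dg i = 1 := by simp [dg, hi]
      simp only [hi, if_false]
      exact (J.IJ_cont I m' (j + ei i) mm (by rw [pdeg_add, pdeg_add_ei]; omega)).comp
        (f := fun p : Pt d × Pt d => ((w, p.1), p.2)) (by fun_prop)
    · intro i
      exact (J.IJ_cont I m' j (mm + ei i) h0.le).comp
        (f := fun p : Pt d × Pt d => ((w, p.1), p.2)) (by fun_prop)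
  refine ⟨hw, ?_, hdiff, ?_, ?_, ?_⟩
  · intro m' i hm w zb uv
    apply pd_of_line (hw m' (pdeg_lt_of_add_ei hm) zb uv w)
    exact J.IJ_w I m' 0 0 i (by rw [add_zero]; omega) w zb uv
  · intro m' j mm hm hj w
    exact (J.IJ_cont I m' j mm (by rw [pdeg_add]; omega)).comp
        (f := fun p : Pt d × Pt d => ((w, p.1), p.2)) (by fun_prop)
  · intro m' mm i hm hmm w zb uv
    have h3 : pdeg (0 : MI d) + ∑ j, mm j < r := by
      simp only [Pi.add_apply, Finset.sum_add_distrib, sum_ei] at hmm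
      rw [pdeg_zero]; omega
    apply pd_of_line (((hdiff m' 0 mm hm h3 w).comp (f := fun uv => (zb, uv))
      ((differentiable_const zb).prodMk differentiable_id)) uv)
    exact J.IJ_uv I m' 0 mm i (by rw [add_zero]; omega) w zb uv
  · intro m' j mm i hm hj w zb uv
    have h3 : pdeg j + ∑ j, mm j < r := by
      rw [pdeg_add_ei] at hj; have := dg_pos i; omega
    apply pd_of_line (((hdiff m' j mm hm h3 w).comp (f := fun zb => (zb, uv))
      (differentiable_id.prodMk (differentiable_const uv))) zb)
    exact J.IJ_zb I m' j mm i (by rw [pdeg_add]; omega) w zb uv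

lemma IData.IJ_bd (I : IData μ κ θ K) {M r n : ℕ} {C : ℝ} (hM : M + r ≤ σ) (hb : Bd2 σ r n C D) :
    Bd3 M r n (K * C * μ.real Set.univ) (IJ μ κ θ D) := by
  intro m' j mm hm hj w zb uv
  have h1 : ∀ s, |(1 + vn uv) ^ n * D (m' + j) mm (YY θ w zb s) uv| ≤ C := fun s => by
    rw [abs_mul, abs_of_pos (vn_pow_pos uv n)]
    exact hb _ _ (by rw [pdeg_add]; omega) (by omega) _ _
  have h2 := I.abs_le m' j h1
  have h3 : ∫ s, om κ θ m' j s * ((1 + vn uv) ^ n * D (m' + j) mm (YY θ w zb s) uv) ∂μ =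
      (1 + vn uv) ^ n * IJ μ κ θ D m' j mm w zb uv := by
    unfold IJ
    rw [← integral_const_mul]
    congr 1; funext s; ring
  rw [h3, abs_mul, abs_of_pos (vn_pow_pos uv n)] at h2
  exact h2

lemma IData.IJ_sub_bd (I : IData μ κ θ K) {M r n : ℕ} {C : ℝ} (hM : M + r ≤ σ) (J : Jet2 σ D)
    (J' : Jet2 σ D') (hb : Bd2 σ r n C (fun j m y uv => D j m y uv - D' j m y uv)) :
    Bd3 M r n (K * C * μ.real Set.univ)
      (fun m' j mm w zb uv => IJ μ κ θ D m' j mm w zb uv + (-1) * IJ μ κ θ D' m' j mm w zb uv) := by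
  have h := I.IJ_bd hM hb
  intro m' j mm hm hj w zb uv
  have h1 := h m' j mm hm hj w zb uv
  have hd : pdeg (m' + j) ≤ σ := by rw [pdeg_add]; omega
  obtain ⟨C1, hC1⟩ := J.bdd (m' + j) mm hd
  obtain ⟨C2, hC2⟩ := J'.bdd (m' + j) mm hd
  have : IJ μ κ θ (fun j m y uv => D j m y uv - D' j m y uv) m' j mm w zb uv =
      IJ μ κ θ D m' j mm w zb uv + (-1) * IJ μ κ θ D' m' j mm w zb uv := by
    unfold IJ
    rw [neg_one_mul, ← sub_eq_add_neg, ← integral_sub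
      (I.integrable m' j (J.cont_s I _ _ hd _ _ _) (fun s => hC1 _ _))
      (I.integrable m' j (J'.cont_s I _ _ hd _ _ _) (fun s => hC2 _ _))]
    congr 1; funext s; ring
  rwa [this] at h1

end Part3

section Part4

/-! ### Taylor remainders in one variable -/

/-- The measure of the Taylor remainder of order `N`. -/
noncomputable def muL (N : ℕ) : Measure ℝ :=
  if N = 0 then Measure.dirac 1 else volume.restrict (Set.Ioc 0 1)

/-- The weight of the Taylor remainder of order `N`. -/
noncomputable def kaL (N : ℕ) (s : ℝ) : ℝ := if N = 0 then 1 else N * (1 - s) ^ (N - 1)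

lemma int_muL_zero (ψ : ℝ → ℝ) : ∫ s, kaL 0 s * ψ s ∂(muL 0) = ψ 1 := by
  simp [muL, kaL]

lemma int_muL_succ (N : ℕ) (ψ : ℝ → ℝ) : ∫ s, kaL (N + 1) s * ψ s ∂(muL (N + 1)) =
    ∫ s in (0 : ℝ)..1, ((N + 1 : ℝ) * (1 - s) ^ N) * ψ s := by
  rw [intervalIntegral.integral_of_le zero_le_one]
  simp [muL, kaL]

lemma taylor_step (N : ℕ) (ψ ψ' : ℝ → ℝ) (hd : ∀ s, HasDerivAt ψ ((N + 1 : ℝ) * ψ' s) s)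
    (hc : Continuous ψ') :
    ∫ s, kaL N s * ψ s ∂(muL N) = ψ 0 + ∫ s, kaL (N + 1) s * ψ' s ∂(muL (N + 1)) := by
  have hcψ : Continuous ψ := continuous_iff_continuousAt.mpr fun s => (hd s).continuousAt
  rcases N with _ | N
  · rw [int_muL_zero, int_muL_succ]
    have := intervalIntegral.integral_eq_sub_of_hasDerivAt (a := 0) (b := 1) (fun s _ => hd s)
      ((continuous_const.mul hc).intervalIntegrable _ _)
    simp only [Nat.cast_zero, zero_add, pow_zero, one_mul] at this ⊢
    rw [this]; ring
  · rw [int_muL_succ, int_muL_succ]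
    have hF : ∀ s : ℝ, HasDerivAt (fun s => -((1 - s) ^ (N + 1) * ψ s))
        (((N + 1 : ℝ) * (1 - s) ^ N) * ψ s - (((N + 1 : ℕ) + 1 : ℝ) * (1 - s) ^ (N + 1)) * ψ' s) s := by
      intro s
      have h1 : HasDerivAt (fun s : ℝ => (1 - s) ^ (N + 1)) (-((N + 1 : ℝ) * (1 - s) ^ N)) s := by
        have := ((hasDerivAt_id s).const_sub 1).pow (N + 1)
        refine HasDerivAt.congr_deriv (f := fun s : ℝ => (1 - s) ^ (N + 1)) this ?_
        simp
      have h2 := (h1.mul (hd s)).neg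
      refine (h2.congr_deriv ?_)
      push_cast; ring
    have hi1 : Continuous fun s : ℝ => ((N + 1 : ℝ) * (1 - s) ^ N) * ψ s := by fun_prop
    have hi2 : Continuous fun s : ℝ => (((N + 1 : ℕ) + 1 : ℝ) * (1 - s) ^ (N + 1)) * ψ' s := by fun_prop
    have := intervalIntegral.integral_eq_sub_of_hasDerivAt (a := 0) (b := 1) (fun s _ => hF s)
      ((hi1.sub hi2).intervalIntegrable _ _)
    rw [intervalIntegral.integral_sub (hi1.intervalIntegrable _ _) (hi2.intervalIntegrable _ _)] at this
    simp only [sub_self, sub_zero, one_pow, one_mul, ne_eq, Nat.add_eq_zero_iff, one_ne_zero, and_false,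
      not_false_eq_true, zero_pow, zero_mul, neg_zero, zero_sub, neg_neg] at this
    linarith

lemma taylor_1d (ψ : ℕ → ℝ → ℝ) (N : ℕ)
    (hd : ∀ p < N, ∀ s, HasDerivAt (ψ p) ((p + 1 : ℝ) * ψ (p + 1) s) s)
    (hc : ∀ p ≤ N, Continuous (ψ p)) :
    ψ 0 1 = ∑ p ∈ Finset.range N, ψ p 0 + ∫ s, kaL N s * ψ N s ∂(muL N) := by
  induction N with
  | zero => rw [int_muL_zero]; simp
  | succ N ih =>
    rw [ih (fun p hp => hd p (by omega)) (fun p hp => hc p (by omega)), Finset.sum_range_succ,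
      taylor_step N (ψ N) (ψ (N + 1)) (hd N (by omega)) (hc _ le_rfl)]
    ring

/-! ### Differentiability of averages -/

lemma avg_mono (φ : ℝ → ℝ) (hφ : Differentiable ℝ φ) (w0 : ℝ) (b : ℕ) :
    Differentiable ℝ fun t => ∫ s in (0 : ℝ)..1, s ^ b * φ (w0 + s * (t - w0)) := by
  intro t
  have hφc := hφ.continuous
  by_cases ht : t = w0
  · subst ht
    have h1 : HasFDerivAt φ (fderiv ℝ φ t) t := (hφ t).hasFDerivAt
    have h2 := h1.isBigO_sub
    obtain ⟨C, hC⟩ := h2.bound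
    rw [Metric.eventually_nhds_iff_ball] at hC
    obtain ⟨ε, hε, hC⟩ := hC
    have key := hasFDerivAt_integral_of_dominated_loc_of_lip' (𝕜 := ℝ) (μ := volume.restrict (Set.Ioc (0 : ℝ) 1))
      (F := fun x s => s ^ b * φ (t + s * (x - t))) (x₀ := t) (s := Metric.ball t ε)
      (bound := fun _ => |C|)
      (F' := fun s => (s ^ b * s) • fderiv ℝ φ t) (Metric.ball_mem_nhds t hε)
      (fun x _ => by
        have : Continuous fun s : ℝ => s ^ b * φ (t + s * (x - t)) := by fun_prop
        exact this.aestronglyMeasurable)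
      (by
        have : Continuous fun s : ℝ => s ^ b * φ (t + s * (t - t)) := by fun_prop
        exact (this.integrableOn_Icc).mono_set Set.Ioc_subset_Icc_self)
      (by
        have : Continuous fun s : ℝ => (s ^ b * s) • fderiv ℝ φ t := by fun_prop
        exact this.aestronglyMeasurable)
      (by
        filter_upwards [ae_restrict_mem measurableSet_Ioc] with s hs x hx
        have hmem : t + s * (x - t) ∈ Metric.ball t ε := by
          rw [Metric.mem_ball, Real.dist_eq] at hx ⊢
          rw [add_sub_cancel_left, abs_mul, abs_of_pos hs.1]
          nlinarith [abs_nonneg (x - t), hs.2]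
        have h3 := hC _ hmem
        rw [add_sub_cancel_left, norm_mul, Real.norm_eq_abs s, abs_of_pos hs.1] at h3
        have h4 : s ^ b * φ (t + s * (x - t)) - s ^ b * φ (t + s * (t - t)) =
            s ^ b * (φ (t + s * (x - t)) - φ t) := by simp; ring
        rw [h4, norm_mul, norm_pow, Real.norm_eq_abs s, abs_of_pos hs.1]
        have h5 : s ^ b ≤ 1 := pow_le_one₀ hs.1.le hs.2
        have h6 : 0 ≤ s ^ b := pow_nonneg hs.1.le b
        calc s ^ b * ‖φ (t + s * (x - t)) - φ t‖ ≤ 1 * ‖φ (t + s * (x - t)) - φ t‖ :=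
              mul_le_mul_of_nonneg_right h5 (norm_nonneg _)
          _ ≤ C * (s * ‖x - t‖) := by rw [one_mul]; exact h3
          _ ≤ |C| * (1 * ‖x - t‖) := by
              apply mul_le_mul (le_abs_self C) _ (mul_nonneg hs.1.le (norm_nonneg _)) (abs_nonneg _)
              exact mul_le_mul_of_nonneg_right hs.2 (norm_nonneg _)
          _ = _ := by rw [one_mul])
      (integrable_const _)
      (Eventually.of_forall fun s => by
        have h7 : HasFDerivAt (fun x : ℝ => t + s * (x - t)) (s • ContinuousLinearMap.id ℝ ℝ) t := by
          have := (((hasFDerivAt_id (𝕜 := ℝ) t).sub_const t).const_mul s).const_add t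
          simpa using this
        have h8 : HasFDerivAt φ (fderiv ℝ φ t) (t + s * (t - t)) := by simpa using h1
        have h9 := (h8.comp t h7).const_mul (s ^ b)
        refine h9.congr_fderiv ?_
        ext; simp [mul_assoc])
    have := key.2.differentiableAt
    simp only [intervalIntegral.integral_of_le zero_le_one]
    exact this
  · have hne : ∀ᶠ x in nhds t, x ≠ w0 := isOpen_ne.mem_nhds ht
    have hc : Continuous fun x => (x - w0) ^ b * φ x := by fun_prop
    have h1 : (fun t => ∫ s in (0 : ℝ)..1, s ^ b * φ (w0 + s * (t - w0))) =ᶠ[nhds t]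
        fun t => ((t - w0) ^ (b + 1))⁻¹ * ∫ x in w0..t, (x - w0) ^ b * φ x := by
      filter_upwards [hne] with x hx
      have hx' : x - w0 ≠ 0 := sub_ne_zero.mpr hx
      have h2 := intervalIntegral.mul_integral_comp_add_mul (a := 0) (b := 1)
        (f := fun y => (y - w0) ^ b * φ y) (c := x - w0) (d := w0)
      simp only [mul_zero, add_zero, mul_one, add_sub_cancel, add_sub_cancel_left] at h2
      rw [← h2]
      have h3 : ∀ s : ℝ, ((x - w0) * s) ^ b * φ (w0 + (x - w0) * s) =
          (x - w0) ^ b * (s ^ b * φ (w0 + s * (x - w0))) := by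
        intro s; rw [mul_pow, mul_comm (x - w0) s]; ring
      simp only [h3]
      rw [intervalIntegral.integral_const_mul]
      generalize (∫ s in (0 : ℝ)..1, s ^ b * φ (w0 + s * (x - w0))) = Q
      field_simp
      ring
    refine DifferentiableAt.congr_of_eventuallyEq ?_ h1
    refine DifferentiableAt.mul ?_ ?_
    · refine DifferentiableAt.inv (by fun_prop) (pow_ne_zero _ (sub_ne_zero.mpr ht))
    · exact (intervalIntegral.integral_hasDerivAt_right (hc.intervalIntegrable _ _)
        (hc.stronglyMeasurableAtFilter _ _) hc.continuousAt).differentiableAt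

lemma avg_poly (φ : ℝ → ℝ) (hφ : Differentiable ℝ φ) (w0 : ℝ) (p : Polynomial ℝ) :
    Differentiable ℝ fun t => ∫ s in (0 : ℝ)..1, p.eval s * φ (w0 + s * (t - w0)) := by
  have hφc := hφ.continuous
  induction p using Polynomial.induction_on' with
  | add p q hp hq =>
    have : (fun t => ∫ s in (0 : ℝ)..1, (p + q).eval s * φ (w0 + s * (t - w0))) =
        fun t => (∫ s in (0 : ℝ)..1, p.eval s * φ (w0 + s * (t - w0))) +
          ∫ s in (0 : ℝ)..1, q.eval s * φ (w0 + s * (t - w0)) := by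
      funext t
      rw [← intervalIntegral.integral_add]
      · congr 1; funext s; rw [Polynomial.eval_add]; ring
      · exact Continuous.intervalIntegrable (by fun_prop) _ _
      · exact Continuous.intervalIntegrable (by fun_prop) _ _
    rw [this]
    exact hp.add hq
  | monomial n a =>
    have : (fun t => ∫ s in (0 : ℝ)..1, (Polynomial.monomial n a).eval s * φ (w0 + s * (t - w0))) =
        fun t => a * ∫ s in (0 : ℝ)..1, s ^ n * φ (w0 + s * (t - w0)) := by
      funext t
      rw [← intervalIntegral.integral_const_mul]
      congr 1; funext s; simp; ring
    rw [this]
    exact (avg_mono φ hφ w0 n).const_mul a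

/-! ### The concrete integral data -/

/-- Spatial interpolation. -/
def thS (i : Fin (d + 1)) (s : ℝ) : ℝ := if i = 0 then 0 else s

/-- Temporal interpolation. -/
def thT (i : Fin (d + 1)) (s : ℝ) : ℝ := if i = 0 then s else 1

lemma bare_dirac (s0 : ℝ) (κ : ℝ → ℝ) (θ : Fin (d + 1) → ℝ → ℝ) (m' j : MI d) (f : Pt d → ℝ)
    (hf : Differentiable ℝ f) (w zb : Pt d) :
    ∃ g, HasDerivAt (fun t : ℝ => ∫ s, om κ θ m' j s * f (YY θ w (zb + t • Pi.single 0 1) s)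
      ∂(Measure.dirac s0)) g 0 := by
  simp only [integral_dirac, YY_zb]
  exact ⟨_, (line_deriv hf (YY θ w zb s0) 0 (θ 0 s0) 0).const_mul _⟩

lemma bare_S (μ : Measure ℝ) (κ : ℝ → ℝ) (m' j : MI d) (f : Pt d → ℝ) (w zb : Pt d) :
    ∃ g, HasDerivAt (fun t : ℝ => ∫ s, om κ thS m' j s * f (YY thS w (zb + t • Pi.single 0 1) s)
      ∂μ) g 0 := by
  simp only [YY_zb, thS, if_true, zero_smul, smul_zero, add_zero]
  exact ⟨_, hasDerivAt_const _ _⟩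

lemma bare_T (N : ℕ) (m' j : MI d) (f : Pt d → ℝ) (hf : Differentiable ℝ f) (w zb : Pt d) :
    ∃ g, HasDerivAt (fun t : ℝ => ∫ s, om (kaL (N + 1)) thT m' j s *
      f (YY thT w (zb + t • Pi.single 0 1) s) ∂(muL (N + 1))) g 0 := by
  let Pθ : Fin (d + 1) → Polynomial ℝ := fun i => if i = 0 then Polynomial.X else 1
  let p : Polynomial ℝ := (Polynomial.C (N + 1 : ℝ) * (1 - Polynomial.X) ^ N) *
    ((∏ i, (1 - Pθ i) ^ m' i) * ∏ i, Pθ i ^ j i)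
  have hθ : ∀ i s, (Pθ i).eval s = thT i s := by
    intro i s
    by_cases h : i = 0 <;> simp [Pθ, thT, h]
  have hp : ∀ s, om (kaL (N + 1)) thT m' j s = p.eval s := by
    intro s
    simp only [om, p, Polynomial.eval_mul, Polynomial.eval_prod, Polynomial.eval_pow,
      Polynomial.eval_sub, Polynomial.eval_one, hθ, Polynomial.eval_C, Polynomial.eval_X, kaL,
      Nat.succ_ne_zero, if_false, Nat.add_sub_cancel]
    push_cast
    rfl
  let φ : ℝ → ℝ := fun τ => f (zb + (τ - zb 0) • Pi.single 0 1)
  have hφ : Differentiable ℝ φ := hf.comp (by fun_prop)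
  have hY : ∀ s t : ℝ, f (YY thT w (zb + t • Pi.single 0 1) s) = φ (w 0 + s * ((zb 0 + t) - w 0)) := by
    intro s t
    show f _ = f _
    congr 1
    funext a
    by_cases h : a = 0
    · subst h; simp [YY, thT]
    · simp [YY, thT, h]
  have h1 := avg_poly φ hφ (w 0) p (zb 0 + 0)
  have h2 : HasDerivAt (fun t : ℝ => zb 0 + t) 1 0 := by
    simpa using (hasDerivAt_id (0 : ℝ)).const_add (zb 0)
  refine ⟨_, ((h1.hasDerivAt.comp (0 : ℝ) h2).congr_of_eventuallyEq (Eventually.of_forall fun t => ?_))⟩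
  simp only [Function.comp_def, hp, hY]
  rw [intervalIntegral.integral_of_le zero_le_one]
  simp [muL]

lemma kaL_cont (N : ℕ) : Continuous (kaL N) := by
  unfold kaL
  split_ifs <;> fun_prop

lemma muL_fin (N : ℕ) : IsFiniteMeasure (muL N) := by
  unfold muL
  split_ifs <;> infer_instance

lemma muL_ae (N : ℕ) : ∀ᵐ s ∂(muL N), 0 ≤ s ∧ s ≤ 1 := by
  unfold muL
  split_ifs
  · rw [ae_dirac_iff]
    · norm_num
    · exact measurableSet_Icc (a := (0 : ℝ)) (b := 1)
  · filter_upwards [ae_restrict_mem measurableSet_Ioc] with s hs using ⟨hs.1.le, hs.2⟩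

lemma kaL_le (N : ℕ) {s : ℝ} (h : 0 ≤ s ∧ s ≤ 1) : |kaL N s| ≤ N + 1 := by
  unfold kaL
  split_ifs with h0
  · simp [h0]
  · rw [abs_mul, abs_pow, Nat.abs_cast]
    have : |1 - s| ≤ 1 := by rw [abs_le]; constructor <;> linarith
    have := pow_le_one₀ (n := N - 1) (abs_nonneg _) this
    nlinarith [Nat.cast_nonneg (α := ℝ) N]

lemma thS_cont (i : Fin (d + 1)) : Continuous (thS i) := by
  unfold thS; split_ifs <;> fun_prop

lemma thT_cont (i : Fin (d + 1)) : Continuous (thT i) := by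
  unfold thT; split_ifs <;> fun_prop

lemma thS_mem (i : Fin (d + 1)) {s : ℝ} (h : 0 ≤ s ∧ s ≤ 1) : 0 ≤ thS i s ∧ thS i s ≤ 1 := by
  unfold thS; split_ifs <;> simp [h]

lemma thT_mem (i : Fin (d + 1)) {s : ℝ} (h : 0 ≤ s ∧ s ≤ 1) : 0 ≤ thT i s ∧ thT i s ≤ 1 := by
  unfold thT; split_ifs <;> simp [h]

lemma idataS (N : ℕ) : IData (d := d) (muL N) (kaL N) thS (N + 1) where
  fin := muL_fin N
  κc := kaL_cont N
  θc := thS_cont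
  ae := by
    filter_upwards [muL_ae N] with s hs using ⟨kaL_le N hs, fun i => thS_mem i hs⟩
  bare m' j f _ w zb := bare_S _ _ m' j f w zb

lemma idataT (N : ℕ) : IData (d := d) (muL N) (kaL N) thT (N + 1) where
  fin := muL_fin N
  κc := kaL_cont N
  θc := thT_cont
  ae := by
    filter_upwards [muL_ae N] with s hs using ⟨kaL_le N hs, fun i => thT_mem i hs⟩
  bare m' j f hf w zb := by
    rcases N with _ | N
    · have := bare_dirac 1 (kaL 0) thT m' j f hf w zb
      simpa [muL] using this
    · exact bare_T N m' j f hf w zb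

lemma idataS0 : IData (d := d) (Measure.dirac 0) (fun _ => 1) thS 1 where
  fin := inferInstance
  κc := continuous_const
  θc := thS_cont
  ae := by
    have : ∀ᵐ s ∂(Measure.dirac (0 : ℝ)), s = 0 := by
      exact (ae_dirac_iff (p := fun s : ℝ => s = 0) (measurableSet_singleton (0 : ℝ))).mpr rfl
    filter_upwards [this] with s hs
    subst hs
    exact ⟨by simp, fun i => thS_mem i (by norm_num)⟩
  bare m' j f _ w zb := bare_S _ _ m' j f w zb

lemma idataT0 : IData (d := d) (Measure.dirac 0) (fun _ => 1) thT 1 where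
  fin := inferInstance
  κc := continuous_const
  θc := thT_cont
  ae := by
    have : ∀ᵐ s ∂(Measure.dirac (0 : ℝ)), s = 0 := by
      exact (ae_dirac_iff (p := fun s : ℝ => s = 0) (measurableSet_singleton (0 : ℝ))).mpr rfl
    filter_upwards [this] with s hs
    subst hs
    exact ⟨by simp, fun i => thT_mem i (by norm_num)⟩
  bare m' j f hf w zb := bare_dirac _ _ _ m' j f hf w zb

end Part4

section Part5

/-! ### Finite index sets -/

lemma le_pdeg (k : MI d) (i : Fin (d + 1)) : k i ≤ pdeg k := by
  unfold pdeg
  have := Finset.single_le_sum (f := k) (fun i _ => Nat.zero_le _) (Finset.mem_univ i)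
  omega

lemma mem_multisLE {k : MI d} {m : ℕ} : k ∈ multisLE d m ↔ pdeg k ≤ m := by
  unfold multisLE
  rw [Finset.mem_filter]
  constructor
  · exact fun h => h.2
  · intro h
    refine ⟨Finset.mem_image.mpr ⟨fun i => ⟨k i, ?_⟩, Finset.mem_univ _, rfl⟩, h⟩
    have := le_pdeg k i; omega

lemma mem_multisLT {k : MI d} {r : ℕ} : k ∈ multisLT d r ↔ pdeg k < r := by
  unfold multisLT
  rw [Finset.mem_filter, mem_multisLE]
  exact ⟨fun h => h.2, fun h => ⟨h.le, h⟩⟩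

lemma mem_bdryS {k : MI d} {r : ℕ} :
    k ∈ bdryS d r ↔ pdeg k ≤ r + 1 ∧ r ≤ pdeg k ∧ pdeg (kdown k) < r := by
  unfold bdryS
  rw [Finset.mem_filter, mem_multisLE]

lemma mIdx_of_ne {k : MI d} (h : k 0 ≠ 0) : mIdx k = 0 := by
  unfold mIdx
  have hne : (Finset.univ.filter fun i => k i ≠ 0).Nonempty := ⟨0, by simpa using h⟩
  rw [dif_pos hne]
  apply le_antisymm
  · exact Finset.min'_le _ _ (by simpa using h)
  · exact Fin.zero_le _

lemma kdown_of_ne {k : MI d} (h : k 0 ≠ 0) : kdown k + ei 0 = k := by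
  funext i
  simp only [kdown, mIdx_of_ne h, Pi.add_apply]
  by_cases hi : i = 0
  · subst hi; simp [ei]; omega
  · simp [hi, ei]

lemma kdown_add (l : MI d) : kdown (l + ei 0) = l := by
  have h : (l + ei 0 : MI d) 0 ≠ 0 := by simp [ei]
  have := kdown_of_ne h
  exact add_right_cancel this

/-- Multi-index from its temporal and spatial parts. -/
def mcons (i : ℕ) (l : Fin d → ℕ) : MI d := Fin.cons i l

lemma pdeg_mcons (i : ℕ) (l : Fin d → ℕ) : pdeg (mcons i l) = 2 * i + ∑ a, l a := by
  simp only [pdeg, mcons, Fin.sum_univ_succ, Fin.cons_zero, Fin.cons_succ]; ring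

lemma mono_mcons (x : Pt d) (i : ℕ) (l : Fin d → ℕ) :
    mono x (mcons i l) = x 0 ^ i * ∏ a, x a.succ ^ l a := by
  simp [mono, mcons, Fin.prod_univ_succ]

/-- Multi-index factorial. -/
def mfact (k : MI d) : ℕ := ∏ i, (k i).factorial

lemma mfact_mcons (i : ℕ) (l : Fin d → ℕ) :
    mfact (mcons i l) = i.factorial * ∏ a, (l a).factorial := by
  simp [mfact, mcons, Fin.prod_univ_succ]

lemma mcons_add (i : ℕ) (l : Fin d → ℕ) (a : Fin d) :
    mcons i l + ei a.succ = mcons i (l + Pi.single a 1) := by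
  funext b
  refine Fin.cases ?_ (fun b => ?_) b
  · simp [mcons, ei]
  · by_cases h : b = a
    · subst h; simp [mcons, ei]
    · simp [mcons, ei, h]

lemma mcons_succ (i : ℕ) : (mcons i 0 : MI d) + ei 0 = mcons (i + 1) 0 := by
  funext b
  refine Fin.cases ?_ (fun b => ?_) b
  · simp [mcons, ei]
  · simp [mcons, ei]

lemma mcons_tail (k : MI d) : mcons (k 0) (fun a => k a.succ) = k := by
  funext b
  refine Fin.cases ?_ (fun b => ?_) b <;> simp [mcons]

lemma sum_multisLT (r : ℕ) (hr : 1 ≤ r) (F : MI d → ℝ) :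
    ∑ k ∈ multisLT d r, F k = ∑ i ∈ Finset.range ((r - 1) / 2 + 1), ∑ p ∈ Finset.range (r - 1 - 2 * i + 1),
      ∑ l ∈ Finset.piAntidiag (Finset.univ : Finset (Fin d)) p, F (mcons i l) := by
  have h1 : ∀ i, ∑ p ∈ Finset.range (r - 1 - 2 * i + 1),
      ∑ l ∈ Finset.piAntidiag (Finset.univ : Finset (Fin d)) p, F (mcons i l) =
      ∑ x ∈ (Finset.range (r - 1 - 2 * i + 1)).sigma
        (fun p => Finset.piAntidiag (Finset.univ : Finset (Fin d)) p), F (mcons i x.2) := fun i =>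
    Finset.sum_sigma' _ _ _
  simp only [h1]
  rw [Finset.sum_sigma']
  refine Finset.sum_bij' (fun k _ => ⟨k 0, ⟨∑ a : Fin d, k a.succ, fun a => k a.succ⟩⟩)
    (fun x _ => mcons x.1 x.2.2) ?_ ?_ ?_ ?_ ?_
  · intro k hk
    rw [mem_multisLT, ← mcons_tail k, pdeg_mcons] at hk
    simp only [Finset.mem_sigma, Finset.mem_range, Finset.mem_piAntidiag]
    refine ⟨by omega, by omega, by simp⟩
  · rintro ⟨i, p, l⟩ hx
    simp only [Finset.mem_sigma, Finset.mem_range, Finset.mem_piAntidiag] at hx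
    rw [mem_multisLT, pdeg_mcons]
    simp only
    have h3 : ∑ x, l x = p := hx.2.2.1
    omega
  · intro k hk; exact mcons_tail k
  · rintro ⟨i, p, l⟩ hx
    simp only [Finset.mem_sigma, Finset.mem_range, Finset.mem_piAntidiag] at hx
    have h3 := hx.2.2.1
    subst h3
    simp [mcons]
  · intro k hk; simp only [mcons_tail]

lemma antidiag_shift (p : ℕ) (h : Fin d → ℝ) (f : (Fin d → ℕ) → ℝ) :
    ∑ l ∈ Finset.piAntidiag (Finset.univ : Finset (Fin d)) p,
      (∏ a, h a ^ l a) / (∏ a, ((l a).factorial : ℝ)) * ∑ i, h i * f (l + Pi.single i 1) =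
    (p + 1 : ℝ) * ∑ l ∈ Finset.piAntidiag (Finset.univ : Finset (Fin d)) (p + 1),
      (∏ a, h a ^ l a) / (∏ a, ((l a).factorial : ℝ)) * f l := by
  rw [Finset.mul_sum]
  have e1 : ∀ l ∈ Finset.piAntidiag (Finset.univ : Finset (Fin d)) (p + 1),
      (p + 1 : ℝ) * ((∏ a, h a ^ l a) / (∏ a, ((l a).factorial : ℝ)) * f l) =
      ∑ i, (l i : ℝ) * ((∏ a, h a ^ l a) / (∏ a, ((l a).factorial : ℝ)) * f l) := by
    intro l hl
    rw [← Finset.sum_mul]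
    congr 1
    have := (Finset.mem_piAntidiag.mp hl).1
    have h2 : ((∑ i, l i : ℕ) : ℝ) = ((p + 1 : ℕ) : ℝ) := by exact_mod_cast this
    push_cast at h2
    rw [h2]
  rw [Finset.sum_congr rfl e1]
  simp only [Finset.mul_sum]
  rw [← Finset.sum_product', ← Finset.sum_product']
  rw [← Finset.sum_filter_of_ne (s := Finset.piAntidiag (Finset.univ : Finset (Fin d)) (p + 1) ×ˢ Finset.univ)
    (p := fun x => x.1 x.2 ≠ 0)]
  swap
  · rintro ⟨l, i⟩ _ hne h0
    apply hne
    simp only at h0 ⊢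
    rw [h0]; simp
  refine Finset.sum_bij' (fun x _ => (x.1 + Pi.single x.2 1, x.2)) (fun x _ => (x.1 - Pi.single x.2 1, x.2))
    ?_ ?_ ?_ ?_ ?_
  · rintro ⟨l, i⟩ hx
    simp only [Finset.mem_product, Finset.mem_piAntidiag, Finset.mem_univ, Finset.mem_filter] at hx ⊢
    refine ⟨⟨⟨?_, by simp⟩, trivial⟩, by simp⟩
    simp [Finset.sum_add_distrib, hx.1.1]
  · rintro ⟨l, i⟩ hx
    simp only [Finset.mem_product, Finset.mem_piAntidiag, Finset.mem_univ, Finset.mem_filter] at hx ⊢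
    refine ⟨⟨?_, by simp⟩, trivial⟩
    have hle : l = (l - Pi.single i 1) + Pi.single i 1 := by
      funext a
      by_cases ha : a = i
      · subst ha; simp; omega
      · simp [ha]
    have h1 := hx.1.1.1
    rw [hle] at h1
    simp only [Pi.add_apply, Finset.sum_add_distrib, Finset.sum_pi_single', Finset.mem_univ, if_true] at h1
    change ∑ x, (l - Pi.single i 1 : Fin d → ℕ) x = p
    omega
  · rintro ⟨l, i⟩ hx
    simp
  · rintro ⟨l, i⟩ hx
    simp only [Finset.mem_product, Finset.mem_piAntidiag, Finset.mem_univ, Finset.mem_filter] at hx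
    simp only [Prod.mk.injEq, and_true]
    funext a
    by_cases ha : a = i
    · subst ha; simp; omega
    · simp [ha]
  · rintro ⟨l, i⟩ hx
    simp only
    have e2 : ∏ a, h a ^ (l + Pi.single i 1 : Fin d → ℕ) a = (∏ a, h a ^ l a) * h i := by
      simp only [Pi.add_apply, pow_add, Finset.prod_mul_distrib]
      congr 1
      rw [Finset.prod_eq_single i]
      · simp
      · intro b _ hb; simp [hb]
      · simp
    have e3 : ∏ a, (((l + Pi.single i 1 : Fin d → ℕ) a).factorial : ℝ) =
        (∏ a, ((l a).factorial : ℝ)) * (l i + 1) := by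
      have : ∀ a, (((l + Pi.single i 1 : Fin d → ℕ) a).factorial : ℝ) =
          ((l a).factorial : ℝ) * (if a = i then (l i + 1 : ℝ) else 1) := by
        intro a
        by_cases ha : a = i
        · subst ha; simp [Nat.factorial_succ]; ring
        · simp [ha]
      simp only [this, Finset.prod_mul_distrib]
      congr 1
      simp
    rw [e2, e3]
    have h4 : (∏ a, ((l a).factorial : ℝ)) ≠ 0 := Finset.prod_ne_zero_iff.mpr fun a _ =>
      Nat.cast_ne_zero.mpr (Nat.factorial_ne_zero _)
    have h5 : ((l i : ℝ) + 1) ≠ 0 := by positivity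
    simp only [Pi.add_apply, Pi.single_eq_same]
    push_cast
    field_simp

/-! ### The remainders -/

/-- Shifted jets. -/
def shiftJ (l : MI d) (D : MI d → MI d → Pt d → Pt d → ℝ) : MI d → MI d → Pt d → Pt d → ℝ :=
  fun j m => D (l + j) m

lemma Jet2.shift {ρ : ℕ} {D : MI d → MI d → Pt d → Pt d → ℝ} (J : Jet2 ρ D) (l : MI d)
    (hl : pdeg l ≤ ρ) : Jet2 (ρ - pdeg l) (shiftJ l D) where
  diff j m hj := J.diff _ m (by rw [pdeg_add]; omega)
  cont j m hj := J.cont _ m (by rw [pdeg_add]; omega)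
  ypd j m i hj y uv := by
    have := J.ypd (l + j) m i (by rw [add_assoc, pdeg_add]; omega) y uv
    rw [add_assoc] at this; exact this
  uvdiff j m hj := J.uvdiff _ m (by rw [pdeg_add]; omega)
  uvpd j m i hj := J.uvpd _ m i (by rw [pdeg_add]; omega)
  bdd j m hj := J.bdd _ m (by rw [pdeg_add]; omega)

lemma Bd2.shift {ρ r n : ℕ} {C : ℝ} {D : MI d → MI d → Pt d → Pt d → ℝ} (h : Bd2 ρ r n C D) (l : MI d)
    (hl : pdeg l ≤ ρ) : Bd2 (ρ - pdeg l) r n C (shiftJ l D) := by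
  intro j m hj hm
  exact h _ m (by rw [pdeg_add]; omega) hm

/-- The spatial order of a multi-index. -/
def NS (l : MI d) : ℕ := ∑ a : Fin d, l a.succ

/-- Spatial part of the remainder. -/
noncomputable def RS (D : MI d → MI d → Pt d → Pt d → ℝ) (l m' j mm : MI d) (w zb uv : Pt d) : ℝ :=
  IJ (muL (NS l)) (kaL (NS l)) thS (shiftJ l D) m' j mm w zb uv +
    (-1) * IJ (Measure.dirac 0) (fun _ => 1) thS (shiftJ l D) m' j mm w zb uv

/-- Temporal part of the remainder. -/
noncomputable def RT (D : MI d → MI d → Pt d → Pt d → ℝ) (l m' j mm : MI d) (w zb uv : Pt d) : ℝ :=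
  IJ (muL (l 0)) (kaL (l 0)) thT (shiftJ l D) m' j mm w zb uv +
    (-1) * IJ (Measure.dirac 0) (fun _ => 1) thT (shiftJ l D) m' j mm w zb uv

/-- Spatial remainder constant. -/
noncomputable def cS (r : ℕ) (l : MI d) : ℝ := if pdeg l + 1 = r then ((mfact l : ℝ))⁻¹ else 0

/-- Temporal remainder constant. -/
noncomputable def cT (r : ℕ) (l : MI d) : ℝ := if l = mcons ((r - 1) / 2) 0 then ((mfact l : ℝ))⁻¹ else 0

/-- The remainder. -/
noncomputable def RemJ (r : ℕ) (D : MI d → MI d → Pt d → Pt d → ℝ) (l m' j mm : MI d) (w zb uv : Pt d) : ℝ :=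
  cS r l * RS D l m' j mm w zb uv + cT r l * RT D l m' j mm w zb uv

lemma om_zero (κ : ℝ → ℝ) (θ : Fin (d + 1) → ℝ → ℝ) (s : ℝ) : om κ θ 0 0 s = κ s := by
  simp [om]

lemma RS_zero (D : MI d → MI d → Pt d → Pt d → ℝ) (l : MI d) (w zb uv : Pt d) :
    RS D l 0 0 0 w zb uv = (∫ s, kaL (NS l) s * D l 0 (YY thS w zb s) uv ∂(muL (NS l))) -
      D l 0 (YY thS w zb 0) uv := by
  simp only [RS, IJ, om_zero, shiftJ, add_zero, integral_dirac]
  ring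

lemma RT_zero (D : MI d → MI d → Pt d → Pt d → ℝ) (l : MI d) (w zb uv : Pt d) :
    RT D l 0 0 0 w zb uv = (∫ s, kaL (l 0) s * D l 0 (YY thT w zb s) uv ∂(muL (l 0))) -
      D l 0 (YY thT w zb 0) uv := by
  simp only [RT, IJ, om_zero, shiftJ, add_zero, integral_dirac]
  ring

variable {ρ : ℕ} {D D' : MI d → MI d → Pt d → Pt d → ℝ}

lemma time_taylor (J : Jet2 ρ D) (n : ℕ) (hn : 2 * n ≤ ρ) (w zb uv : Pt d) :
    D 0 0 zb uv = ∑ i ∈ Finset.range (n + 1), (zb 0 - w 0) ^ i * (i.factorial : ℝ)⁻¹ *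
        D (mcons i 0) 0 (YY thT w zb 0) uv +
      (zb 0 - w 0) ^ n * ((n.factorial : ℝ)⁻¹ * RT D (mcons n 0) 0 0 0 w zb uv) := by
  have hY : ∀ s, YY thT w zb s = YY thT w zb 0 + s • ((zb 0 - w 0) • Pi.single 0 1) := by
    intro s
    funext a
    by_cases h : a = 0
    · subst h; simp [YY, thT]
    · simp [YY, thT, h]
  have hdeg : ∀ p, pdeg (mcons p 0 : MI d) = 2 * p := fun p => by rw [pdeg_mcons]; simp
  let ψ : ℕ → ℝ → ℝ := fun p s => (zb 0 - w 0) ^ p * (p.factorial : ℝ)⁻¹ * D (mcons p 0) 0 (YY thT w zb s) uv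
  have h := taylor_1d ψ n (by
    intro p hp s
    have h1 : pdeg (mcons p 0 + ei 0 : MI d) ≤ ρ := by rw [mcons_succ, hdeg]; omega
    have h2 := line_deriv (J.diff_y (mcons p 0) 0 (by rw [hdeg]; omega) uv) (YY thT w zb 0) 0 (zb 0 - w 0) s
    rw [J.ypd _ _ _ h1, ← hY, mcons_succ] at h2
    simp only [← hY] at h2
    refine (h2.const_mul ((zb 0 - w 0) ^ p * (p.factorial : ℝ)⁻¹)).congr_deriv ?_
    simp only [ψ, Nat.factorial_succ, pow_succ]
    push_cast
    have : (p : ℝ) + 1 ≠ 0 := by positivity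
    field_simp) (by
    intro p hp
    have := J.cont_s (idataT 0) (mcons p 0) 0 (by rw [hdeg]; omega) w zb uv
    exact continuous_const.mul this)
  have h1 : ψ 0 1 = D 0 0 zb uv := by
    have e1 : (mcons 0 0 : MI d) = 0 := by
      funext b; refine Fin.cases ?_ (fun b => ?_) b <;> simp [mcons]
    have e2 : YY thT w zb 1 = zb := by
      funext a; by_cases h : a = 0 <;> simp [YY, thT, h]
    simp [ψ, e1, e2]
  rw [← h1, h, Finset.sum_range_succ, RT_zero]
  have e3 : (mcons n 0 : MI d) 0 = n := rfl
  rw [e3]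
  have e4 : ∫ s, kaL n s * ψ n s ∂(muL n) = (zb 0 - w 0) ^ n * (n.factorial : ℝ)⁻¹ *
      ∫ s, kaL n s * D (mcons n 0) 0 (YY thT w zb s) uv ∂(muL n) := by
    rw [← integral_const_mul]
    congr 1; funext s; simp only [ψ]; ring
  rw [e4]
  simp only [ψ]
  ring

lemma space_taylor (J : Jet2 ρ D) (i n : ℕ) (hn : 2 * i + n ≤ ρ) (w zb uv : Pt d) :
    D (mcons i 0) 0 (YY thT w zb 0) uv =
      ∑ p ∈ Finset.range (n + 1), ∑ l ∈ Finset.piAntidiag (Finset.univ : Finset (Fin d)) p,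
        (∏ a, (zb a.succ - w a.succ) ^ l a) / (∏ a, ((l a).factorial : ℝ)) * D (mcons i l) 0 w uv +
      ∑ l ∈ Finset.piAntidiag (Finset.univ : Finset (Fin d)) n,
        (∏ a, (zb a.succ - w a.succ) ^ l a) / (∏ a, ((l a).factorial : ℝ)) *
          RS D (mcons i l) 0 0 0 w zb uv := by
  let hx : Pt d := ∑ a : Fin d, (zb a.succ - w a.succ) • Pi.single a.succ 1
  have hx0 : hx 0 = 0 := by simp [hx, Finset.sum_apply]
  have hxs : ∀ a : Fin d, hx a.succ = zb a.succ - w a.succ := by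
    intro a
    simp [hx, Finset.sum_apply, Pi.single_apply]
  have hY : ∀ s, YY thS w zb s = w + s • hx := by
    intro s
    funext a
    refine Fin.cases ?_ (fun a => ?_) a
    · simp [YY, thS, hx0]
    · simp [YY, thS, hxs]
  have hY0 : YY thS w zb 0 = w := by rw [hY]; simp
  have hY1 : YY thS w zb 1 = YY thT w zb 0 := by
    funext a
    refine Fin.cases ?_ (fun a => ?_) a
    · simp [YY, thS, thT]
    · simp [YY, thS, thT]
  let c : (Fin d → ℕ) → ℝ := fun l => (∏ a, (zb a.succ - w a.succ) ^ l a) / (∏ a, ((l a).factorial : ℝ))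
  let ψ : ℕ → ℝ → ℝ := fun p s => ∑ l ∈ Finset.piAntidiag (Finset.univ : Finset (Fin d)) p,
    c l * D (mcons i l) 0 (YY thS w zb s) uv
  have hsum : ∀ {p : ℕ} {l : Fin d → ℕ}, l ∈ Finset.piAntidiag (Finset.univ : Finset (Fin d)) p →
      pdeg (mcons i l) = 2 * i + p := by
    intro p l hl
    rw [pdeg_mcons, (Finset.mem_piAntidiag.mp hl).1]
  have h := taylor_1d ψ n (by
    intro p hp s
    have h2 : HasDerivAt (ψ p) (∑ l ∈ Finset.piAntidiag (Finset.univ : Finset (Fin d)) p,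
        c l * ∑ a, (zb a.succ - w a.succ) * D (mcons i (l + Pi.single a 1)) 0 (YY thS w zb s) uv) s := by
      refine HasDerivAt.fun_sum fun l hl => ?_
      refine HasDerivAt.const_mul _ ?_
      have hd := J.diff_y (mcons i l) 0 (by rw [hsum hl]; omega) uv
      have h3 : HasDerivAt (fun s : ℝ => w + s • hx) hx s := by
        simpa using ((hasDerivAt_id s).smul_const hx).const_add w
      have h4 := (hd (w + s • hx)).hasFDerivAt.comp_hasDerivAt s h3
      simp only [hY]
      refine h4.congr_deriv ?_
      simp only [hx, map_sum, map_smul, smul_eq_mul]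
      refine Finset.sum_congr rfl fun a _ => ?_
      congr 1
      have := J.ypd (mcons i l) 0 a.succ (by rw [pdeg_add_ei, hsum hl]; simp [dg]; omega) (w + s • hx) uv
      rw [mcons_add] at this
      exact this
    refine h2.congr_deriv ?_
    exact antidiag_shift p (fun a => zb a.succ - w a.succ) (fun l => D (mcons i l) 0 (YY thS w zb s) uv)) (by
    intro p hp
    refine continuous_finsetSum _ fun l hl => ?_
    have := J.cont_s (idataS 0) (mcons i l) 0 (by rw [hsum hl]; omega) w zb uv
    exact continuous_const.mul this)
  have h1 : ψ 0 1 = D (mcons i 0) 0 (YY thT w zb 0) uv := by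
    simp [ψ, hY1, c]
  rw [← h1, h, Finset.sum_range_succ, add_assoc]
  have e0 : ∀ p, ψ p 0 = ∑ l ∈ Finset.piAntidiag (Finset.univ : Finset (Fin d)) p, c l * D (mcons i l) 0 w uv := by
    intro p; simp only [ψ, hY0]
  simp only [e0]
  congr 1
  rw [← Finset.sum_add_distrib]
  have e4 : ∫ s, kaL n s * ψ n s ∂(muL n) = ∑ l ∈ Finset.piAntidiag (Finset.univ : Finset (Fin d)) n,
      c l * ∫ s, kaL n s * D (mcons i l) 0 (YY thS w zb s) uv ∂(muL n) := by
    simp only [← integral_const_mul]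
    rw [← integral_finsetSum]
    · congr 1; funext s
      simp only [ψ, Finset.mul_sum]
      refine Finset.sum_congr rfl fun l _ => by ring
    · intro l hl
      refine Integrable.const_mul ?_ _
      have hd : pdeg (mcons i l) ≤ ρ := by rw [hsum hl]; omega
      obtain ⟨C, hC⟩ := J.bdd (mcons i l) 0 hd
      have := (idataS (d := d) n).integrable 0 0 (J.cont_s (idataS n) (mcons i l) 0 hd w zb uv)
        (fun s => hC _ _)
      simpa only [om_zero] using this
  rw [e4]
  refine Finset.sum_congr rfl fun l hl => ?_
  rw [RS_zero, hY0]
  have : NS (mcons i l) = n := by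
    have := (Finset.mem_piAntidiag.mp hl).1
    simpa [NS, mcons] using this
  rw [this]
  show c l * _ = c l * _ + c l * _
  ring

lemma taylor_pre (J : Jet2 ρ D) (r : ℕ) (hr : 1 ≤ r) (hrρ : r ≤ ρ) (w zb uv : Pt d) :
    D 0 0 zb uv = (∑ k ∈ multisLT d r, mono (zb - w) k * (((mfact k : ℝ))⁻¹ * D k 0 w uv)) +
      ((∑ l ∈ multisLT d r, mono (zb - w) l * (cS r l * RS D l 0 0 0 w zb uv)) +
        ∑ l ∈ multisLT d r, mono (zb - w) l * (cT r l * RT D l 0 0 0 w zb uv)) := by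
  rw [time_taylor J ((r - 1) / 2) (by omega) w zb uv, ← add_assoc]
  congr 1
  · rw [sum_multisLT r hr, sum_multisLT r hr, ← Finset.sum_add_distrib]
    refine Finset.sum_congr rfl fun i hi => ?_
    rw [Finset.mem_range] at hi
    rw [space_taylor J i (r - 1 - 2 * i) (by omega) w zb uv, mul_add]
    congr 1
    · rw [Finset.mul_sum]
      refine Finset.sum_congr rfl fun p hp => ?_
      rw [Finset.mul_sum]
      refine Finset.sum_congr rfl fun l hl => ?_
      rw [mono_mcons, mfact_mcons]
      push_cast
      simp only [Pi.sub_apply, mul_inv, div_eq_mul_inv]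
      ring
    · have hz : ∑ p ∈ Finset.range (r - 1 - 2 * i),
          ∑ l ∈ Finset.piAntidiag (Finset.univ : Finset (Fin d)) p,
          mono (zb - w) (mcons i l) * (cS r (mcons i l) * RS D (mcons i l) 0 0 0 w zb uv) = 0 := by
        refine Finset.sum_eq_zero fun p hp => ?_
        rw [Finset.mem_range] at hp
        refine Finset.sum_eq_zero fun l hl => ?_
        have : pdeg (mcons i l) + 1 ≠ r := by
          rw [pdeg_mcons, (Finset.mem_piAntidiag.mp hl).1]; omega
        rw [cS, if_neg this]; simp
      rw [Finset.sum_range_succ, hz, zero_add, Finset.mul_sum]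
      refine Finset.sum_congr rfl fun l hl => ?_
      have : pdeg (mcons i l) + 1 = r := by
        rw [pdeg_mcons, (Finset.mem_piAntidiag.mp hl).1]; omega
      rw [mono_mcons, cS, if_pos this, mfact_mcons]
      push_cast
      simp only [Pi.sub_apply, mul_inv, div_eq_mul_inv]
      ring
  · rw [Finset.sum_eq_single (mcons ((r - 1) / 2) 0)]
    · rw [cT, if_pos rfl, mono_mcons, mfact_mcons]
      simp
    · intro l _ hl
      rw [cT, if_neg hl]; simp
    · intro h
      exfalso
      apply h
      rw [mem_multisLT, pdeg_mcons]
      simp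
      omega

lemma taylor_main (J : Jet2 ρ D) (r : ℕ) (hr : 1 ≤ r) (hrρ : r ≤ ρ) (w zb uv : Pt d) :
    D 0 0 zb uv = (∑ k ∈ multisLT d r, mono (zb - w) k * (((mfact k : ℝ))⁻¹ * D k 0 w uv)) +
      ∑ k ∈ bdryS d r, mono (zb - w) (kdown k) *
        (if k 0 = 0 then 0 else RemJ r D (kdown k) 0 0 0 w zb uv) := by
  rw [taylor_pre J r hr hrρ w zb uv, ← Finset.sum_add_distrib]
  congr 1
  have e1 : ∀ l : MI d, mono (zb - w) l * (cS r l * RS D l 0 0 0 w zb uv) +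
      mono (zb - w) l * (cT r l * RT D l 0 0 0 w zb uv) = mono (zb - w) l * RemJ r D l 0 0 0 w zb uv := by
    intro l; rw [RemJ]; ring
  simp only [e1]
  rw [← Finset.sum_filter_of_ne (s := multisLT d r) (p := fun l => r ≤ pdeg l + 2)]
  swap
  · intro l hl hne
    by_contra hlt
    apply hne
    have h1 : cS r l = 0 := by rw [cS, if_neg (by omega)]
    have h2 : cT r l = 0 := by
      rw [cT, if_neg]
      rintro rfl
      rw [pdeg_mcons] at hlt
      simp at hlt
      omega
    rw [RemJ, h1, h2]; simp
  rw [← Finset.sum_filter_of_ne (s := bdryS d r) (p := fun k => k 0 ≠ 0)]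
  swap
  · intro k hk hne h0
    apply hne
    rw [if_pos h0, mul_zero]
  refine Finset.sum_bij' (fun l _ => l + ei 0) (fun k _ => kdown k) ?_ ?_ ?_ ?_ ?_
  · intro l hl
    rw [Finset.mem_filter, mem_multisLT] at hl
    rw [Finset.mem_filter, mem_bdryS, kdown_add, pdeg_add_ei]
    simp only [dg, if_true]
    refine ⟨by omega, by simp [ei]⟩
  · intro k hk
    rw [Finset.mem_filter, mem_bdryS] at hk
    rw [Finset.mem_filter, mem_multisLT]
    have := kdown_of_ne hk.2
    have h2 : pdeg k = pdeg (kdown k) + 2 := by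
      conv_lhs => rw [← this]
      rw [pdeg_add_ei]; simp [dg]
    omega
  · intro l hl; exact kdown_add l
  · intro k hk
    rw [Finset.mem_filter] at hk
    exact kdown_of_ne hk.2
  · intro l hl
    have : (l + ei 0 : MI d) 0 ≠ 0 := by simp [ei]
    rw [kdown_add, if_neg this]

lemma RemJ_jet3 (J : Jet2 ρ D) (r : ℕ) (l : MI d) {M : ℕ} (hM : M < ρ - pdeg l) :
    Jet3 M (ρ - pdeg l - M) (RemJ r D l) := by
  have Js := J.shift l (by omega)
  have hr : 1 ≤ ρ - pdeg l - M := by omega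
  have hs : M + (ρ - pdeg l - M) ≤ ρ - pdeg l := by omega
  exact (((Js.IJ_jet3 (idataS _) hr hs).add ((Js.IJ_jet3 idataS0 hr hs).const_mul (-1))).const_mul _).add
    (((Js.IJ_jet3 (idataT _) hr hs).add ((Js.IJ_jet3 idataT0 hr hs).const_mul (-1))).const_mul _)

lemma RemJ_bd (r : ℕ) (l : MI d) {M n : ℕ} {C : ℝ} (hM : M < ρ - pdeg l)
    (hb : Bd2 ρ (ρ - pdeg l - M) n C D) : ∃ C', Bd3 M (ρ - pdeg l - M) n C' (RemJ r D l) := by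
  have hs : M + (ρ - pdeg l - M) ≤ ρ - pdeg l := by omega
  have hb' := hb.shift l (by omega)
  exact ⟨_, ((((idataS _).IJ_bd hs hb').add ((idataS0.IJ_bd hs hb').const_mul (-1))).const_mul _).add
    ((((idataT _).IJ_bd hs hb').add ((idataT0.IJ_bd hs hb').const_mul (-1))).const_mul _)⟩

/-- The constant in the bound of remainders. -/
noncomputable def remC (r : ℕ) (l : MI d) : ℝ :=
  |cS r l| * (((NS l : ℝ) + 1) * (muL (NS l)).real Set.univ + 1) +
    |cT r l| * (((l 0 : ℝ) + 1) * (muL (l 0)).real Set.univ + 1)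

lemma remC_nonneg (r : ℕ) (l : MI d) : 0 ≤ remC r l := by unfold remC; positivity

lemma RemJ_sub_bd (J : Jet2 ρ D) (J' : Jet2 ρ D') (r : ℕ) (l : MI d) {M n : ℕ} {C : ℝ}
    (hM : M < ρ - pdeg l)
    (hb : Bd2 ρ (ρ - pdeg l - M) n C (fun j m y uv => D j m y uv - D' j m y uv)) :
    Bd3 M (ρ - pdeg l - M) n (remC r l * C)
      (fun m' j mm w zb uv => RemJ r D l m' j mm w zb uv + (-1) * RemJ r D' l m' j mm w zb uv) := by
  have hs : M + (ρ - pdeg l - M) ≤ ρ - pdeg l := by omega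
  have hb' := hb.shift l (by omega)
  have Js := J.shift l (by omega)
  have Js' := J'.shift l (by omega)
  have h := (((((idataS (NS l)).IJ_sub_bd hs Js Js' hb').add
    ((idataS0.IJ_sub_bd hs Js Js' hb').const_mul (-1))).const_mul (cS r l)).add
    ((((idataT (l 0)).IJ_sub_bd hs Js Js' hb').add
      ((idataT0.IJ_sub_bd hs Js Js' hb').const_mul (-1))).const_mul (cT r l)))
  intro m' j mm h1 h2 w zb uv
  have h3 := h m' j mm h1 h2 w zb uv
  refine le_trans (le_of_eq ?_) (h3.trans (le_of_eq ?_))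
  · congr 2
    simp only [RemJ, RS, RT]
    ring
  · simp [remC]
    ring

end Part5

section Part6

/-! ### Tame families, indexed by admissible coefficients -/

/-- Admissible coefficients. -/
abbrev PR (d : ℕ) (lam : ℝ) (ρ : ℕ) := {A : Coeffs d // ParReg lam ρ A}

variable {lam : ℝ} {ρ : ℕ}

/-- Weighted boundedness and continuity of a family. -/
def Tame {X : Type*} (wt : X → ℝ) (K : PR d lam ρ → X → ℝ) : Prop :=
  ∀ A : PR d lam ρ, ∃ (N : ℕ) (C : ℝ), 0 ≤ C ∧ (∀ x, |K A x| ≤ C * wt x ^ N) ∧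
    ∀ η : ℝ, 0 < η → ∃ δ : ℝ, 0 < δ ∧ ∀ A' : PR d lam ρ, coeffDist ρ A.1 A'.1 ≤ δ →
      ∀ x, |K A x - K A' x| ≤ η * wt x ^ N

section tame
variable {X : Type*} {wt : X → ℝ} {K L : PR d lam ρ → X → ℝ}

lemma Tame.of_indep (f : X → ℝ) (N : ℕ) (C : ℝ) (hC : 0 ≤ C) (h : ∀ x, |f x| ≤ C * wt x ^ N)
    (hw : ∀ x, 1 ≤ wt x) :
    Tame (lam := lam) (ρ := ρ) (d := d) wt (fun _ => f) := by
  intro A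
  refine ⟨N, C, hC, h, fun η hη => ⟨1, one_pos, fun A' _ x => ?_⟩⟩
  have := pow_nonneg (zero_le_one.trans (hw x)) N
  simp only [sub_self, abs_zero]
  positivity

lemma Tame.const (c : ℝ) (hw : ∀ x, 1 ≤ wt x) :
    Tame (lam := lam) (ρ := ρ) (d := d) wt (fun _ _ => c) :=
  Tame.of_indep _ 0 |c| (abs_nonneg _) (by simp) hw

lemma Tame.add (hw : ∀ x, 1 ≤ wt x) (hK : Tame wt K) (hL : Tame wt L) :
    Tame wt (fun A x => K A x + L A x) := by
  intro A
  obtain ⟨N, C, hC, h1, h2⟩ := hK A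
  obtain ⟨N', C', hC', h1', h2'⟩ := hL A
  have hp : ∀ x, wt x ^ N ≤ wt x ^ (N + N') := fun x => pow_le_pow_right₀ (hw x) (by omega)
  have hp' : ∀ x, wt x ^ N' ≤ wt x ^ (N + N') := fun x => pow_le_pow_right₀ (hw x) (by omega)
  refine ⟨N + N', C + C', by positivity, fun x => ?_, fun η hη => ?_⟩
  · have e1 := h1 x
    have e2 := h1' x
    have e3 := mul_le_mul_of_nonneg_left (hp x) hC
    have e4 := mul_le_mul_of_nonneg_left (hp' x) hC'
    calc _ ≤ |K A x| + |L A x| := abs_add_le _ _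
      _ ≤ _ := by linarith
  · obtain ⟨δ, hδ, h3⟩ := h2 (η / 2) (by positivity)
    obtain ⟨δ', hδ', h3'⟩ := h2' (η / 2) (by positivity)
    refine ⟨min δ δ', lt_min hδ hδ', fun A' hA x => ?_⟩
    have e1 := h3 A' (hA.trans (min_le_left _ _)) x
    have e2 := h3' A' (hA.trans (min_le_right _ _)) x
    have e3 := mul_le_mul_of_nonneg_left (hp x) (by positivity : 0 ≤ η / 2)
    have e4 := mul_le_mul_of_nonneg_left (hp' x) (by positivity : 0 ≤ η / 2)
    calc |K A x + L A x - (K A' x + L A' x)| = |(K A x - K A' x) + (L A x - L A' x)| := by ring_nf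
      _ ≤ |K A x - K A' x| + |L A x - L A' x| := abs_add_le _ _
      _ ≤ _ := by linarith

lemma Tame.mul (hw : ∀ x, 1 ≤ wt x) (hK : Tame wt K) (hL : Tame wt L) :
    Tame wt (fun A x => K A x * L A x) := by
  intro A
  obtain ⟨N, C, hC, h1, h2⟩ := hK A
  obtain ⟨N', C', hC', h1', h2'⟩ := hL A
  have hp : ∀ x, 0 ≤ wt x ^ N := fun x => pow_nonneg (zero_le_one.trans (hw x)) _
  have hp' : ∀ x, 0 ≤ wt x ^ N' := fun x => pow_nonneg (zero_le_one.trans (hw x)) _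
  refine ⟨N + N', C * C', by positivity, fun x => ?_, fun η hη => ?_⟩
  · rw [abs_mul, pow_add]
    calc _ ≤ (C * wt x ^ N) * (C' * wt x ^ N') :=
          mul_le_mul (h1 x) (h1' x) (abs_nonneg _) (mul_nonneg hC (hp x))
      _ = _ := by ring
  · have hη' : 0 < min 1 (η / (C + C' + 1)) := lt_min one_pos (by positivity)
    obtain ⟨δ, hδ, h3⟩ := h2 _ hη'
    obtain ⟨δ', hδ', h3'⟩ := h2' _ hη'
    refine ⟨min δ δ', lt_min hδ hδ', fun A' hA x => ?_⟩
    have e1 := h3 A' (hA.trans (min_le_left _ _)) x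
    have e2 := h3' A' (hA.trans (min_le_right _ _)) x
    set η' := min 1 (η / (C + C' + 1)) with hη'd
    have hle : η' ≤ η / (C + C' + 1) := min_le_right _ _
    have hle1 : η' ≤ 1 := min_le_left _ _
    have f1 : η' * (C + C' + 1) ≤ η := by rwa [le_div_iff₀ (by positivity)] at hle
    have f2 : η' * C' + C * η' + η' * η' ≤ η := by nlinarith
    calc |K A x * L A x - K A' x * L A' x|
        = |(K A x - K A' x) * L A x + K A x * (L A x - L A' x) -
          (K A x - K A' x) * (L A x - L A' x)| := by ring_nf
      _ ≤ |K A x - K A' x| * |L A x| + |K A x| * |L A x - L A' x| +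
          |K A x - K A' x| * |L A x - L A' x| := by
            rw [← abs_mul, ← abs_mul, ← abs_mul]
            exact (abs_sub _ _).trans (add_le_add_left (abs_add_le _ _) _)
      _ ≤ (η' * wt x ^ N) * (C' * wt x ^ N') + (C * wt x ^ N) * (η' * wt x ^ N') +
          (η' * wt x ^ N) * (η' * wt x ^ N') := by
            have := hp x
            have := hp' x
            have e3 := h1 x
            have e4 := h1' x
            gcongr
      _ = (η' * C' + C * η' + η' * η') * wt x ^ (N + N') := by ring
      _ ≤ η * wt x ^ (N + N') :=
          mul_le_mul_of_nonneg_right f2 (pow_nonneg (zero_le_one.trans (hw x)) _)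

lemma Tame.comp {Y : Type*} {wt' : Y → ℝ} (g : Y → X) (hg : ∀ y, wt (g y) ≤ wt' y) (hw : ∀ x, 1 ≤ wt x)
    (hK : Tame wt K) : Tame wt' (fun A y => K A (g y)) := by
  intro A
  obtain ⟨N, C, hC, h1, h2⟩ := hK A
  have hp : ∀ y, wt (g y) ^ N ≤ wt' y ^ N := fun y =>
    pow_le_pow_left₀ (zero_le_one.trans (hw _)) (hg y) N
  refine ⟨N, C, hC, fun y => (h1 _).trans (mul_le_mul_of_nonneg_left (hp y) hC), fun η hη => ?_⟩
  obtain ⟨δ, hδ, h3⟩ := h2 η hη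
  exact ⟨δ, hδ, fun A' hA y => (h3 A' hA _).trans (mul_le_mul_of_nonneg_left (hp y) hη.le)⟩

lemma Tame.sum (hw : ∀ x, 1 ≤ wt x) {ι : Type*} (s : Finset ι) (F : ι → PR d lam ρ → X → ℝ)
    (h : ∀ i ∈ s, Tame wt (F i)) : Tame wt (fun A x => ∑ i ∈ s, F i A x) := by
  classical
  induction s using Finset.induction_on with
  | empty => simpa using Tame.const 0 hw
  | insert a s ha ih =>
    simp only [Finset.sum_insert ha]
    exact (h a (by simp)).add hw (ih fun i hi => h i (by simp [hi]))

end tame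

/-! ### Polynomial dependence on the coefficients -/

/-- Formal coefficient polynomials with derivatives of order at most `N`. -/
noncomputable def cpol (d N : ℕ) : Subalgebra ℝ (MvPolynomial ((Fin (d + 1) → ℕ) × CoeffVar d) ℝ) :=
  MvPolynomial.supported ℝ {v | pdeg v.1 ≤ N}

/-- Families given by polynomials of the coefficients. -/
def Lam (N : ℕ) (K : PR d lam ρ → Pt d → ℝ) : Prop :=
  ∃ p ∈ cpol d N, ∀ A y, K A y = MvPolynomial.eval (coeffEval A.1 y) p

lemma cpol_mono {N N' : ℕ} (h : N ≤ N') : cpol d N ≤ cpol d N' :=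
  MvPolynomial.supported_mono fun _ hv => le_trans hv h

lemma Lam.mono {N N' : ℕ} {K : PR d lam ρ → Pt d → ℝ} (h : Lam N K) (hN : N ≤ N') : Lam N' K := by
  obtain ⟨p, hp, h⟩ := h
  exact ⟨p, cpol_mono hN hp, h⟩

lemma Lam.add {N : ℕ} {K L : PR d lam ρ → Pt d → ℝ} (h : Lam N K) (h' : Lam N L) :
    Lam N (fun A y => K A y + L A y) := by
  obtain ⟨p, hp, h⟩ := h
  obtain ⟨p', hp', h'⟩ := h'
  exact ⟨p + p', add_mem hp hp', fun A y => by simp only [map_add, h, h']⟩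

lemma Lam.mul {N : ℕ} {K L : PR d lam ρ → Pt d → ℝ} (h : Lam N K) (h' : Lam N L) :
    Lam N (fun A y => K A y * L A y) := by
  obtain ⟨p, hp, h⟩ := h
  obtain ⟨p', hp', h'⟩ := h'
  exact ⟨p * p', mul_mem hp hp', fun A y => by simp only [map_mul, h, h']⟩

lemma Lam.const {N : ℕ} (c : ℝ) : Lam N (fun _ _ => c : PR d lam ρ → Pt d → ℝ) :=
  ⟨MvPolynomial.C c, (cpol d N).algebraMap_mem c, fun A y => by simp⟩

lemma Lam.var {N : ℕ} (v : (Fin (d + 1) → ℕ) × CoeffVar d) (hv : pdeg v.1 ≤ N) :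
    Lam N (fun A y => coeffEval A.1 y v : PR d lam ρ → Pt d → ℝ) :=
  ⟨MvPolynomial.X v, (MvPolynomial.X_mem_supported (R := ℝ)).mpr hv, fun A y => by simp⟩

/-! ### The recursive regularity class -/

/-- Regular families with `n` remaining derivatives. -/
inductive Cp : ℕ → (PR d lam ρ → Pt d → ℝ) → Prop
  | mk (n : ℕ) (K : PR d lam ρ → Pt d → ℝ) (hc : ∀ A, Continuous (K A))
    (ht : Tame (fun _ : Pt d => 1) K) (hl : Lam (ρ - n) K) (hd : 1 ≤ n → ∀ A, Differentiable ℝ (K A))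
    (hp : ∀ i, dg i ≤ n → Cp (n - dg i) (fun A => pd i (K A))) : Cp n K

section cp
variable {K L : PR d lam ρ → Pt d → ℝ} {n : ℕ}

lemma Cp.cont (h : Cp n K) (A) : Continuous (K A) := by cases h with | mk _ _ hc => exact hc A
lemma Cp.tame (h : Cp n K) : Tame (fun _ : Pt d => 1) K := by cases h with | mk _ _ hc ht => exact ht
lemma Cp.isLam (h : Cp n K) : Lam (ρ - n) K := by cases h with | mk _ _ hc ht hl => exact hl
lemma Cp.diff (h : Cp n K) (hn : 1 ≤ n) (A) : Differentiable ℝ (K A) := by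
  cases h with | mk _ _ hc ht hl hd => exact hd hn A
lemma Cp.pd (h : Cp n K) (i) (hn : dg i ≤ n) : Cp (n - dg i) (fun A => pd i (K A)) := by
  cases h with | mk _ _ hc ht hl hd hp => exact hp i hn

lemma Cp.mono (h : Cp n K) : ∀ n' ≤ n, Cp n' K := by
  induction h with
  | mk n K hc ht hl hd hp ih =>
    intro n' hn
    exact Cp.mk n' K hc ht (hl.mono (by omega)) (fun h => hd (by omega))
      (fun i hi => ih i (by omega) _ (by omega))

lemma Cp.add (n : ℕ) : ∀ K L : PR d lam ρ → Pt d → ℝ, Cp n K → Cp n L → Cp n (fun A y => K A y + L A y) := by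
  induction n using Nat.strong_induction_on with
  | _ n ih =>
    intro K L hK hL
    refine Cp.mk n _ (fun A => (hK.cont A).add (hL.cont A)) (hK.tame.add (fun _ => le_rfl) hL.tame)
      (hK.isLam.add hL.isLam) (fun h A => (hK.diff h A).add (hL.diff h A)) (fun i hi => ?_)
    have h1 := dg_pos i
    have := ih (n - dg i) (by omega) _ _ (hK.pd i hi) (hL.pd i hi)
    convert this using 1
    funext A y
    exact pd_add_fun i (hK.diff (by omega) A y) (hL.diff (by omega) A y)

lemma pd_mul_fun {f g : Pt d → ℝ} {z : Pt d} (i : Fin (d + 1)) (hf : DifferentiableAt ℝ f z)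
    (hg : DifferentiableAt ℝ g z) : VarBPHZ.pd i (fun z => f z * g z) z =
      VarBPHZ.pd i f z * g z + f z * VarBPHZ.pd i g z := by
  unfold VarBPHZ.pd
  have : (fun z => f z * g z) = f * g := rfl
  rw [this, fderiv_mul hf hg]
  simp
  ring

lemma Cp.mul (n : ℕ) : ∀ K L : PR d lam ρ → Pt d → ℝ, Cp n K → Cp n L → Cp n (fun A y => K A y * L A y) := by
  induction n using Nat.strong_induction_on with
  | _ n ih =>
    intro K L hK hL
    refine Cp.mk n _ (fun A => (hK.cont A).mul (hL.cont A)) (hK.tame.mul (fun _ => le_rfl) hL.tame)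
      (hK.isLam.mul hL.isLam) (fun h A => (hK.diff h A).mul (hL.diff h A)) (fun i hi => ?_)
    have h1 := dg_pos i
    have := Cp.add _ _ _ (ih (n - dg i) (by omega) _ _ (hK.pd i hi) (hL.mono (n - dg i) (by omega)))
      (ih (n - dg i) (by omega) _ _ (hK.mono (n - dg i) (by omega)) (hL.pd i hi))
    convert this using 1
    funext A y
    exact pd_mul_fun i (hK.diff (by omega) A y) (hL.diff (by omega) A y)

lemma Cp.const (n : ℕ) : ∀ c : ℝ, Cp n (fun _ _ => c : PR d lam ρ → Pt d → ℝ) := by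
  induction n using Nat.strong_induction_on with
  | _ n ih =>
    intro c
    refine Cp.mk n _ (fun A => continuous_const) (Tame.const c fun _ => le_rfl)
      (Lam.const c) (fun h A => differentiable_const _) (fun i hi => ?_)
    have h1 := dg_pos i
    have := ih (n - dg i) (by omega) 0
    convert this using 1
    funext A y
    simp [VarBPHZ.pd]

lemma Cp.sum {ι : Type*} (s : Finset ι) (F : ι → PR d lam ρ → Pt d → ℝ)
    (h : ∀ i ∈ s, Cp n (F i)) : Cp n (fun A y => ∑ i ∈ s, F i A y) := by
  classical
  induction s using Finset.induction_on with
  | empty => simpa using Cp.const n 0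
  | insert a s ha ih =>
    simp only [Finset.sum_insert ha]
    exact Cp.add _ _ _ (h a (by simp)) (ih fun i hi => h i (by simp [hi]))

lemma Cp.prod {ι : Type*} (s : Finset ι) (F : ι → PR d lam ρ → Pt d → ℝ)
    (h : ∀ i ∈ s, Cp n (F i)) : Cp n (fun A y => ∏ i ∈ s, F i A y) := by
  classical
  induction s using Finset.induction_on with
  | empty => simpa using Cp.const n 1
  | insert a s ha ih =>
    simp only [Finset.prod_insert ha]
    exact Cp.mul _ _ _ (h a (by simp)) (ih fun i hi => h i (by simp [hi]))

lemma Cp.det (M : PR d lam ρ → Pt d → Matrix (Fin d) (Fin d) ℝ)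
    (h : ∀ p q, Cp n (fun A y => M A y p q)) : Cp n (fun A y => (M A y).det) := by
  simp only [Matrix.det_apply']
  refine Cp.sum _ _ fun σ _ => ?_
  exact Cp.mul _ _ _ (Cp.const _ _) (Cp.prod _ _ fun i _ => h _ _)

lemma Cp.mderiv (h : Cp n K) : ∀ l : MI d, pdeg l ≤ n → Cp (n - pdeg l) (fun A => mderiv l (K A)) := by
  intro l
  induction l using multi_induct with
  | h0 => intro _; simpa [mderiv_zero, pdeg_zero] using h
  | hs k i hk ih =>
    intro hl
    rw [pdeg_add_ei] at hl
    have := (ih (by omega)).pd i (by omega)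
    rw [pdeg_add_ei, ← Nat.sub_sub]
    convert this using 1
    funext A
    rw [mderiv_eq, wordOp_canon _ _ _ _ hk, ← mderiv_eq]

end cp

lemma pd_mderiv {f : Pt d → ℝ} (h : ∀ k : MI d, pdeg k < ρ → Differentiable ℝ (mderiv k f)) (k : MI d)
    (i : Fin (d + 1)) (hk : pdeg (k + ei i) ≤ ρ) : pd i (mderiv k f) = mderiv (k + ei i) f := by
  refine wordOp_comm pd f (fun k => pdeg k ≤ ρ) ?_ ?_ k i hk
  · intro k i hk; rw [pdeg_add_ei] at hk; omega
  · intro k i i' hk h1 h2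
    rw [pdeg_add_ei, pdeg_add_ei] at hk
    have e1 := dg_pos i
    have e2 := dg_pos i'
    refine pd_comm (h k (by omega)) ?_ ?_
    · rw [h1]; exact h _ (by rw [pdeg_add_ei]; omega)
    · rw [h2]; exact h _ (by rw [pdeg_add_ei]; omega)

lemma mderiv_sub {f g : Pt d → ℝ} (hf : ∀ k : MI d, pdeg k < ρ → Differentiable ℝ (mderiv k f))
    (hg : ∀ k : MI d, pdeg k < ρ → Differentiable ℝ (mderiv k g)) (k : MI d) (hk : pdeg k ≤ ρ) :
    mderiv k (fun z => f z - g z) = fun z => mderiv k f z - mderiv k g z := by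
  have := mderiv_of_jet (fun k z => mderiv k f z - mderiv k g z) (fun k => pdeg k ≤ ρ)
    (fun k i hk => by rw [pdeg_add_ei] at hk; omega) (fun k i hk => by
      rw [← pd_mderiv hf _ _ hk, ← pd_mderiv hg _ _ hk]
      rw [pdeg_add_ei] at hk
      have := dg_pos i
      funext z
      have h1 := hf k (by omega) z
      have h2 := hg k (by omega) z
      unfold pd
      have e : (fun z => mderiv k f z - mderiv k g z) = mderiv k f - mderiv k g := rfl
      rw [e, fderiv_sub h1 h2]; rfl) k hk
  rw [← this]
  simp only [mderiv_zero]

lemma le_cparNorm {f : Pt d → ℝ} (h : ∀ k : MI d, pdeg k ≤ ρ → ∃ M, ∀ z, |mderiv k f z| ≤ M)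
    (k : MI d) (hk : pdeg k ≤ ρ) (z : Pt d) : |mderiv k f z| ≤ cparNorm ρ f := by
  refine le_csSup ?_ ⟨k, z, hk, rfl⟩
  choose! M hM using h
  refine ⟨∑ k ∈ multisLE d ρ, |M k|, ?_⟩
  rintro y ⟨k, z, hk, rfl⟩
  exact ((hM k hk z).trans (le_abs_self _)).trans
    (Finset.single_le_sum (f := fun k => |M k|) (fun _ _ => abs_nonneg _) (mem_multisLE.mpr hk))

lemma cparNorm_nonneg (f : Pt d → ℝ) : 0 ≤ cparNorm ρ f := by
  apply Real.sSup_nonneg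
  rintro y ⟨k, z, hk, rfl⟩
  exact abs_nonneg _

lemma a_sub_le (A A' : PR d lam ρ) (p q : Fin d) (k : MI d) (hk : pdeg k ≤ ρ) (z : Pt d) :
    |mderiv k (fun z => A.1.a z p q) z - mderiv k (fun z => A'.1.a z p q) z| ≤ coeffDist ρ A.1 A'.1 := by
  have h1 := (A.2.areg p q)
  have h2 := (A'.2.areg p q)
  have e := mderiv_sub h1.1 h2.1
  have hb : ∀ k : MI d, pdeg k ≤ ρ → ∃ M, ∀ z, |mderiv k (fun z => A.1.a z p q - A'.1.a z p q) z| ≤ M := by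
    intro k hk
    obtain ⟨M, hM⟩ := (h1.2 k hk).2
    obtain ⟨M', hM'⟩ := (h2.2 k hk).2
    refine ⟨M + M', fun z => ?_⟩
    rw [e k hk]
    exact (abs_sub _ _).trans (add_le_add (hM z) (hM' z))
  have h3 := le_cparNorm hb k hk z
  rw [e k hk] at h3
  refine h3.trans ?_
  unfold coeffDist coeffNorm
  have h4 : cparNorm ρ (fun z => A.1.a z p q - A'.1.a z p q) ≤
      sSup {y | ∃ i j, y = cparNorm ρ fun z => (coeffSub A.1 A'.1).a z i j} := by
    refine le_csSup ?_ ⟨p, q, rfl⟩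
    have : {y | ∃ i j, y = cparNorm ρ fun z => (coeffSub A.1 A'.1).a z i j} =
        Set.range (fun x : Fin d × Fin d => cparNorm ρ fun z => (coeffSub A.1 A'.1).a z x.1 x.2) := by
      ext y; constructor
      · rintro ⟨i, j, rfl⟩; exact ⟨(i, j), rfl⟩
      · rintro ⟨⟨i, j⟩, rfl⟩; exact ⟨i, j, rfl⟩
    rw [this]
    exact (Set.finite_range _).bddAbove
  have h5 : 0 ≤ sSup {y | ∃ i, y = cparNorm ρ fun z => (coeffSub A.1 A'.1).b z i} := by
    apply Real.sSup_nonneg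
    rintro y ⟨i, rfl⟩
    exact cparNorm_nonneg _
  have h6 := cparNorm_nonneg (ρ := ρ) (coeffSub A.1 A'.1).c
  linarith

lemma a_tame (p q : Fin d) (k : MI d) (hk : pdeg k ≤ ρ) :
    Tame (fun _ : Pt d => 1) (fun A : PR d lam ρ => mderiv k fun z => A.1.a z p q) := by
  intro A
  obtain ⟨M, hM⟩ := ((A.2.areg p q).2 k hk).2
  refine ⟨0, |M|, abs_nonneg _, fun x => by simpa using (hM x).trans (le_abs_self _), fun η hη => ?_⟩
  exact ⟨η, hη, fun A' hA x => by simpa using (a_sub_le A A' p q k hk x).trans hA⟩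

lemma a_cp (p q : Fin d) : ∀ (n : ℕ) (k : MI d), pdeg k + n ≤ ρ →
    Cp n (fun A : PR d lam ρ => mderiv k fun z => A.1.a z p q) := by
  intro n
  induction n using Nat.strong_induction_on with
  | _ n ih =>
    intro k hk
    refine Cp.mk n _ (fun A => ((A.2.areg p q).2 k (by omega)).1) (a_tame p q k (by omega))
      (Lam.var (k, CoeffVar.aa p q) (by simp only; omega)) (fun h A => (A.2.areg p q).1 k (by omega)) (fun i hi => ?_)
    have h1 := dg_pos i
    have := ih (n - dg i) (by omega) (k + ei i) (by rw [pdeg_add_ei]; omega)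
    convert this using 1
    funext A
    exact pd_mderiv (A.2.areg p q).1 k i (by rw [pdeg_add_ei]; omega)

end Part6

section Part7

variable {lam : ℝ} {ρ : ℕ}

/-! ### Ellipticity -/

lemma quad_eq (M : Matrix (Fin d) (Fin d) ℝ) (v w : Fin d → ℝ) :
    v ⬝ᵥ (M.mulVec w) = ∑ i, ∑ j, M i j * v i * w j := by
  simp only [dotProduct, Matrix.mulVec, Finset.mul_sum]
  refine Finset.sum_congr rfl fun i _ => Finset.sum_congr rfl fun j _ => by ring

lemma dot_eq (v : Fin d → ℝ) : v ⬝ᵥ v = ∑ i, v i ^ 2 := by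
  simp only [dotProduct]
  exact Finset.sum_congr rfl fun i _ => by ring

lemma lowerM (hlam : 0 < lam) (A : PR d lam ρ) (y : Pt d) (v : Fin d → ℝ) :
    lam * (v ⬝ᵥ v) ≤ v ⬝ᵥ ((A.1.a y).mulVec v) := by
  rw [quad_eq, dot_eq]; exact A.2.lower y v

lemma upperM (A : PR d lam ρ) (y : Pt d) (v : Fin d → ℝ) :
    v ⬝ᵥ ((A.1.a y).mulVec v) ≤ lam⁻¹ * (v ⬝ᵥ v) := by
  rw [quad_eq, dot_eq]; exact A.2.upper y v

lemma a_posDef (hlam : 0 < lam) (A : PR d lam ρ) (y : Pt d) : (A.1.a y).PosDef := by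
  refine Matrix.PosDef.of_dotProduct_mulVec_pos ?_ ?_
  · have := A.2.symm y
    rw [Matrix.IsHermitian, Matrix.conjTranspose_eq_transpose_of_trivial]
    exact this
  · intro x hx
    have h := lowerM hlam A y x
    have h2 : 0 < x ⬝ᵥ x := by
      rw [dot_eq]
      obtain ⟨i, hi⟩ := Function.ne_iff.mp hx
      exact Finset.sum_pos' (fun i _ => sq_nonneg _) ⟨i, Finset.mem_univ _, by
        have : x i ≠ 0 := hi
        positivity⟩
    simp only [star_trivial]
    nlinarith

lemma det_pos (hlam : 0 < lam) (A : PR d lam ρ) (y : Pt d) : 0 < (A.1.a y).det :=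
  (a_posDef hlam A y).det_pos

lemma mul_inv_vec (hlam : 0 < lam) (A : PR d lam ρ) (y : Pt d) (v : Fin d → ℝ) :
    (A.1.a y).mulVec ((A.1.a y)⁻¹.mulVec v) = v := by
  rw [Matrix.mulVec_mulVec, Matrix.mul_nonsing_inv _ (det_pos hlam A y).ne'.isUnit, Matrix.one_mulVec]

lemma inv_entry_le (hlam : 0 < lam) (A : PR d lam ρ) (y : Pt d) (p q : Fin d) :
    |(A.1.a y)⁻¹ p q| ≤ lam⁻¹ := by
  have h := lowerM hlam A y ((A.1.a y)⁻¹.mulVec (Pi.single q 1))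
  rw [mul_inv_vec hlam] at h
  have e : ∀ p, (A.1.a y)⁻¹.mulVec (Pi.single q 1) p = (A.1.a y)⁻¹ p q := by intro p; simp
  rw [dot_eq] at h
  simp only [dotProduct_single, e, mul_one] at h
  set B := (A.1.a y)⁻¹
  have h1 : ∀ p, B p q ^ 2 ≤ ∑ i, B i q ^ 2 := fun p =>
    Finset.single_le_sum (f := fun i => B i q ^ 2) (fun _ _ => sq_nonneg _) (Finset.mem_univ p)
  have h2 : lam * B q q ^ 2 ≤ B q q := (mul_le_mul_of_nonneg_left (h1 q) hlam.le).trans h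
  have h3 : lam * B p q ^ 2 ≤ B q q := (mul_le_mul_of_nonneg_left (h1 p) hlam.le).trans h
  have h4 : lam * B q q ≤ 1 := by
    by_contra hc
    push Not at hc
    have : 0 < B q q := by by_contra h0; push Not at h0; nlinarith
    nlinarith
  refine abs_le_of_sq_le_sq ?_ (inv_pos.mpr hlam).le
  have h5 : (lam * B p q) ^ 2 ≤ 1 := by nlinarith
  have h6 : B p q = lam⁻¹ * (lam * B p q) := by field_simp
  rw [h6, mul_pow]
  exact mul_le_of_le_one_right (by positivity) h5

lemma inv_quad_ge (hlam : 0 < lam) (A : PR d lam ρ) (y : Pt d) (v : Fin d → ℝ) :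
    lam * ∑ i, v i ^ 2 ≤ ∑ i, ∑ j, (A.1.a y)⁻¹ i j * v i * v j := by
  rw [← quad_eq, ← dot_eq]
  set a := A.1.a y with ha
  set ζ := a⁻¹.mulVec v with hζ
  have hv : a.mulVec ζ = v := mul_inv_vec hlam A y v
  have hs : a.transpose = a := A.2.symm y
  have h1 := lowerM hlam A y (ζ - lam • v)
  have h2 := upperM A y v
  rw [← ha] at h1 h2
  have h0 : 0 ≤ (ζ - lam • v) ⬝ᵥ (ζ - lam • v) := by
    rw [dot_eq]; exact Finset.sum_nonneg fun i _ => sq_nonneg _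
  have h3 : ζ ⬝ᵥ a.mulVec v = v ⬝ᵥ v := by
    rw [Matrix.dotProduct_mulVec, ← Matrix.mulVec_transpose, hs, hv]
  rw [Matrix.mulVec_sub, Matrix.mulVec_smul, hv] at h1
  simp only [sub_dotProduct, dotProduct_sub, smul_dotProduct, dotProduct_smul, smul_eq_mul, h3] at h1 h0
  have h4 : lam * lam * (v ⬝ᵥ a.mulVec v) ≤ lam * (v ⬝ᵥ v) := by
    calc _ ≤ lam * lam * (lam⁻¹ * (v ⬝ᵥ v)) := mul_le_mul_of_nonneg_left h2 (by positivity)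
      _ = _ := by field_simp
  rw [dotProduct_comm v ζ]
  rw [dotProduct_comm v ζ] at h0
  have h5 := mul_nonneg hlam.le h0
  rw [dotProduct_comm ζ v] at h1 h5 ⊢
  linarith

/-! ### The inverse and the determinant -/

/-- Inverse determinant. -/
noncomputable def idet (A : PR d lam ρ) (y : Pt d) : ℝ := ((A.1.a y).det)⁻¹

lemma a_cp' (p q : Fin d) : Cp ρ (fun (A : PR d lam ρ) y => A.1.a y p q) := by
  have := a_cp (lam := lam) (ρ := ρ) p q ρ 0 (by rw [pdeg_zero]; omega)
  simpa only [mderiv_zero] using this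

lemma det_cp : Cp ρ (fun (A : PR d lam ρ) y => (A.1.a y).det) := Cp.det _ a_cp'

lemma idet_eq (A : PR d lam ρ) (y : Pt d) : idet A y = ((A.1.a y)⁻¹).det := by
  rw [idet, Matrix.det_nonsing_inv, Ring.inverse_eq_inv']

/-- Bound on the inverse determinant. -/
noncomputable def idC (d : ℕ) (lam : ℝ) : ℝ := (Nat.factorial d) * lam⁻¹ ^ d

lemma idet_le (hlam : 0 < lam) (A : PR d lam ρ) (y : Pt d) : |idet A y| ≤ idC d lam := by
  rw [idet_eq]
  have := Matrix.det_le (A := (A.1.a y)⁻¹) (abv := AbsoluteValue.abs) (x := lam⁻¹)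
    (fun i j => inv_entry_le hlam A y i j)
  simpa [idC, nsmul_eq_mul] using this

lemma idC_nonneg (hlam : 0 < lam) : 0 ≤ idC d lam := by unfold idC; positivity

lemma idet_tame (hlam : 0 < lam) : Tame (fun _ : Pt d => 1) (idet : PR d lam ρ → Pt d → ℝ) := by
  intro A
  obtain ⟨N, C, hC, h1, h2⟩ := (det_cp (lam := lam) (ρ := ρ) (d := d)).tame A
  have hc := idC_nonneg (d := d) hlam
  refine ⟨0, idC d lam, hc, fun x => by simpa using idet_le hlam A x, fun η hη => ?_⟩
  obtain ⟨δ, hδ, h3⟩ := h2 (η / (idC d lam * idC d lam + 1)) (by positivity)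
  refine ⟨δ, hδ, fun A' hA x => ?_⟩
  have h4 := h3 A' hA x
  simp only [one_pow, mul_one] at h4 ⊢
  have e : idet A x - idet A' x = -(idet A x * idet A' x) * ((A.1.a x).det - (A'.1.a x).det) := by
    have := (det_pos hlam A x).ne'
    have := (det_pos hlam A' x).ne'
    simp only [idet]; field_simp; ring
  rw [e, abs_mul, abs_neg, abs_mul]
  rw [le_div_iff₀ (by positivity)] at h4
  calc _ ≤ (idC d lam * idC d lam) * |(A.1.a x).det - (A'.1.a x).det| := by
        gcongr
        · exact idet_le hlam A x
        · exact idet_le hlam A' x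
    _ ≤ _ := by nlinarith [abs_nonneg ((A.1.a x).det - (A'.1.a x).det)]

lemma inv_lam (p q : Fin d) : Lam 0 (fun (A : PR d lam ρ) y => (A.1.a y)⁻¹ p q) := by
  have := Lam.var (N := 0) (lam := lam) (ρ := ρ) ((0 : Fin (d + 1) → ℕ), CoeffVar.ai p q) (by simp [pdeg_zero])
  simpa only [coeffEval, mderiv_zero] using this

lemma Lam.sum {N : ℕ} {ι : Type*} (s : Finset ι) (F : ι → PR d lam ρ → Pt d → ℝ)
    (h : ∀ i ∈ s, Lam N (F i)) : Lam N (fun A y => ∑ i ∈ s, F i A y) := by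
  classical
  induction s using Finset.induction_on with
  | empty => simpa using Lam.const 0
  | insert a s ha ih =>
    simp only [Finset.sum_insert ha]
    exact (h a (by simp)).add (ih fun i hi => h i (by simp [hi]))

lemma Lam.prod {N : ℕ} {ι : Type*} (s : Finset ι) (F : ι → PR d lam ρ → Pt d → ℝ)
    (h : ∀ i ∈ s, Lam N (F i)) : Lam N (fun A y => ∏ i ∈ s, F i A y) := by
  classical
  induction s using Finset.induction_on with
  | empty => simpa using Lam.const 1
  | insert a s ha ih =>
    simp only [Finset.prod_insert ha]
    exact (h a (by simp)).mul (ih fun i hi => h i (by simp [hi]))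

lemma idet_lam : Lam 0 (idet : PR d lam ρ → Pt d → ℝ) := by
  have : (idet : PR d lam ρ → Pt d → ℝ) = fun A y => ((A.1.a y)⁻¹).det := by
    funext A y; exact idet_eq A y
  rw [this]
  simp only [Matrix.det_apply']
  refine Lam.sum _ _ fun σ _ => ?_
  exact Lam.mul (Lam.const _) (Lam.prod _ _ fun i _ => inv_lam _ _)

lemma pd_inv_fun {f : Pt d → ℝ} {z : Pt d} (i : Fin (d + 1)) (hf : DifferentiableAt ℝ f z)
    (h0 : f z ≠ 0) : pd i (fun z => (f z)⁻¹) z = (-1) * (((f z)⁻¹ * (f z)⁻¹) * pd i f z) := by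
  unfold pd
  have h1 : HasFDerivAt (fun z => (f z)⁻¹) _ z :=
    (hasDerivAt_inv h0).comp_hasFDerivAt z hf.hasFDerivAt
  rw [h1.fderiv]
  simp only [FunLike.coe_smul, ContinuousLinearMap.smul_apply, Pi.smul_apply, smul_eq_mul]
  ring

lemma idet_cp (hlam : 0 < lam) : ∀ n ≤ ρ, Cp n (idet : PR d lam ρ → Pt d → ℝ) := by
  intro n
  induction n using Nat.strong_induction_on with
  | _ n ih =>
    intro hn
    have hdet := (det_cp (lam := lam) (ρ := ρ) (d := d)).mono n hn
    refine Cp.mk n _ (fun A => (hdet.cont A).inv₀ fun y => (det_pos hlam A y).ne') (idet_tame hlam)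
      (idet_lam.mono (Nat.zero_le _))
      (fun h A => (hdet.diff h A).inv fun y => (det_pos hlam A y).ne') (fun i hi => ?_)
    have h1 := dg_pos i
    have h2 := ih (n - dg i) (by omega) (by omega)
    have := Cp.mul _ _ _ (Cp.const (n - dg i) (-1)) (Cp.mul _ _ _ (Cp.mul _ _ _ h2 h2) (hdet.pd i hi))
    convert this using 1
    funext A y
    exact pd_inv_fun i (hdet.diff (by omega) A y) (det_pos hlam A y).ne'

lemma inv_cp (hlam : 0 < lam) (p q : Fin d) : Cp ρ (fun (A : PR d lam ρ) y => (A.1.a y)⁻¹ p q) := by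
  have e : (fun (A : PR d lam ρ) y => (A.1.a y)⁻¹ p q) = fun A y => idet A y *
      ((A.1.a y).updateRow q (Pi.single p 1)).det := by
    funext A y
    rw [Matrix.inv_def, Ring.inverse_eq_inv', Matrix.smul_apply, Matrix.adjugate_apply]
    rfl
  rw [e]
  refine Cp.mul _ _ _ (idet_cp hlam ρ le_rfl) (Cp.det _ fun i j => ?_)
  by_cases h : i = q
  · subst h
    simp only [Matrix.updateRow_self]
    exact Cp.const _ _
  · simp only [Matrix.updateRow_ne h]
    exact a_cp' i j

/-- The logarithmic normalisation. -/
noncomputable def beta (A : PR d lam ρ) (y : Pt d) : ℝ :=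
  -((d : ℝ) / 2) * Real.log (4 * Real.pi) + (-1 / 2) * Real.log ((A.1.a y).det)

lemma log_sub_le {x y c : ℝ} (hx : 0 < x) (hy : 0 < y) (hcx : x⁻¹ ≤ c) (hcy : y⁻¹ ≤ c) :
    |Real.log x - Real.log y| ≤ c * |x - y| := by
  have key : ∀ {x y : ℝ}, 0 < x → 0 < y → y⁻¹ ≤ c → Real.log x - Real.log y ≤ c * |x - y| := by
    intro x y hx hy hcy
    rw [← Real.log_div hx.ne' hy.ne']
    have h1 := Real.log_le_sub_one_of_pos (div_pos hx hy)
    have h2 : x / y - 1 = y⁻¹ * (x - y) := by field_simp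
    calc _ ≤ y⁻¹ * (x - y) := by rw [← h2]; exact h1
      _ ≤ y⁻¹ * |x - y| := mul_le_mul_of_nonneg_left (le_abs_self _) (inv_pos.mpr hy).le
      _ ≤ _ := mul_le_mul_of_nonneg_right hcy (abs_nonneg _)
  rw [abs_le]
  have h1 := key hx hy hcy
  have h2 := key hy hx hcx
  rw [abs_sub_comm] at h2
  constructor <;> linarith

lemma log_tame (hlam : 0 < lam) :
    Tame (fun _ : Pt d => 1) (fun (A : PR d lam ρ) y => Real.log ((A.1.a y).det)) := by
  intro A
  obtain ⟨N, C, hC, h1, h2⟩ := (det_cp (lam := lam) (ρ := ρ) (d := d)).tame A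
  have hc := idC_nonneg (d := d) hlam
  have hi : ∀ (A : PR d lam ρ) y, ((A.1.a y).det)⁻¹ ≤ idC d lam + 1 := fun A y =>
    ((le_abs_self _).trans (idet_le hlam A y)).trans (by linarith)
  refine ⟨0, (idC d lam + 1) * (C + 1), by positivity, fun x => ?_, fun η hη => ?_⟩
  · have h3 := log_sub_le (det_pos hlam A x) one_pos (hi A x) (by simp [hc])
    have h4 := h1 x
    simp only [Real.log_one, sub_zero, one_pow, pow_zero, mul_one] at h3 h4 ⊢
    refine h3.trans (mul_le_mul_of_nonneg_left ?_ (by positivity))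
    exact (abs_sub _ _).trans (by simpa using h4)
  · obtain ⟨δ, hδ, h3⟩ := h2 (η / (idC d lam + 1)) (by positivity)
    refine ⟨δ, hδ, fun A' hA x => ?_⟩
    have h4 := h3 A' hA x
    simp only [one_pow, mul_one] at h4 ⊢
    rw [le_div_iff₀ (by positivity)] at h4
    have h5 := log_sub_le (det_pos hlam A x) (det_pos hlam A' x) (hi A x) (hi A' x)
    linarith

lemma beta_tame (hlam : 0 < lam) : Tame (fun _ : Pt d => 1) (beta : PR d lam ρ → Pt d → ℝ) :=
  (Tame.const _ fun _ => le_rfl).add (fun _ => le_rfl)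
    ((Tame.const _ fun _ => le_rfl).mul (fun _ => le_rfl) (log_tame hlam))

lemma beta_cont (hlam : 0 < lam) (A : PR d lam ρ) : Continuous (beta A) :=
  continuous_const.add (continuous_const.mul ((det_cp.cont A).log fun y => (det_pos hlam A y).ne'))

lemma beta_diff (hlam : 0 < lam) (h : 1 ≤ ρ) (A : PR d lam ρ) : Differentiable ℝ (beta A) :=
  (differentiable_const _).add ((differentiable_const _).mul ((det_cp.diff h A).log fun y => (det_pos hlam A y).ne'))

lemma beta_pd (hlam : 0 < lam) (i : Fin (d + 1)) (hi : dg i ≤ ρ) :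
    Cp (ρ - dg i) (fun A : PR d lam ρ => pd i (beta A)) := by
  have h1 := dg_pos i
  have := Cp.mul _ _ _ (Cp.const (ρ - dg i) (-1 / 2)) (Cp.mul _ _ _ (idet_cp hlam (ρ - dg i) (by omega))
    ((det_cp (lam := lam) (ρ := ρ) (d := d)).pd i hi))
  convert this using 1
  funext A y
  have hd := (det_cp.diff (by omega) A y).hasFDerivAt.log (det_pos hlam A y).ne'
  have hb : HasFDerivAt (beta A) _ y := (hd.const_mul (-1 / 2)).const_add (-((d : ℝ) / 2) * Real.log (4 * Real.pi))
  unfold pd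
  rw [hb.fderiv]
  simp [idet]

lemma beta_mderiv (hlam : 0 < lam) : ∀ l : MI d, l ≠ 0 → pdeg l ≤ ρ →
    Cp (ρ - pdeg l) (fun A : PR d lam ρ => mderiv l (beta A)) := by
  intro l
  induction l using multi_induct with
  | h0 => intro h; exact absurd rfl h
  | hs k i hk ih =>
    intro _ hl
    rw [pdeg_add_ei] at hl
    have e : (fun A : PR d lam ρ => mderiv (k + ei i) (beta A)) = fun A => pd i (mderiv k (beta A)) := by
      funext A
      rw [mderiv_eq, wordOp_canon _ _ _ _ hk, ← mderiv_eq]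
    rw [e, pdeg_add_ei]
    by_cases h0 : k = 0
    · subst h0
      simp only [mderiv_zero, pdeg_zero, zero_add]
      exact beta_pd hlam i (by omega)
    · rw [← Nat.sub_sub]
      exact (ih h0 (by omega)).pd i (by omega)

end Part7

section Part8

variable {lam : ℝ} {ρ : ℕ}

/-! ### Formal jets of an exponential -/

/-- Formal jet variables. -/
abbrev JV (d : ℕ) := MI d × MI d

/-- Formal total derivative. -/
noncomputable def fD (e : JV d) : Derivation ℝ (MvPolynomial (JV d) ℝ) (MvPolynomial (JV d) ℝ) :=
  MvPolynomial.mkDerivation ℝ fun l => MvPolynomial.X (l + e)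

lemma fD_X (e l : JV d) : fD e (MvPolynomial.X l) = MvPolynomial.X (l + e) :=
  MvPolynomial.mkDerivation_X _ _ _

lemma fD_comm (e e' : JV d) (P : MvPolynomial (JV d) ℝ) : fD e (fD e' P) = fD e' (fD e P) := by
  have : ⁅fD e, fD e'⁆ = (0 : Derivation ℝ (MvPolynomial (JV d) ℝ) (MvPolynomial (JV d) ℝ)) := by
    refine MvPolynomial.derivation_ext fun l => ?_
    rw [Derivation.commutator_apply, fD_X, fD_X, fD_X, fD_X, add_right_comm, sub_self]
    rfl
  have h := congrArg (fun D => D P) this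
  simp only [Derivation.commutator_apply] at h
  exact sub_eq_zero.mp h

/-- Formal derivative of a polynomial times the exponential. -/
noncomputable def fT (e : JV d) (P : MvPolynomial (JV d) ℝ) : MvPolynomial (JV d) ℝ :=
  fD e P + P * MvPolynomial.X e

lemma fT_comm (e e' : JV d) (P : MvPolynomial (JV d) ℝ) : fT e (fT e' P) = fT e' (fT e P) := by
  simp only [fT, map_add, Derivation.leibniz, fD_X, smul_eq_mul, fD_comm e e' P, add_comm e e']
  ring

/-- The formal jet. -/
noncomputable def fP (j m : MI d) : MvPolynomial (JV d) ℝ :=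
  wordOp (fun i => fT (ei i, 0)) j (wordOp (fun i => fT (0, ei i)) m 1)

lemma fP_zero : fP (0 : MI d) 0 = 1 := by rw [fP, wordOp_zero, wordOp_zero]

lemma fP_y (j m : MI d) (i : Fin (d + 1)) : fT (ei i, 0) (fP j m) = fP (j + ei i) m :=
  wordOp_comm (fun i => fT (ei i, 0)) _ (fun _ => True) (fun _ _ _ => trivial)
    (fun _ _ _ _ _ _ => fT_comm _ _ _) j i trivial

lemma fP_v (j m : MI d) (i : Fin (d + 1)) : fT (0, ei i) (fP j m) = fP j (m + ei i) := by
  induction j using multi_induct with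
  | h0 =>
    rw [fP, wordOp_zero, fP, wordOp_zero]
    exact wordOp_comm (fun i => fT (0, ei i)) _ (fun _ => True) (fun _ _ _ => trivial)
      (fun _ _ _ _ _ _ => fT_comm _ _ _) m i trivial
  | hs k i' hk ih =>
    rw [← fP_y, ← fP_y, fT_comm, ih]

/-- Formal polynomials of bounded order not involving the base variable. -/
noncomputable def fS (d n : ℕ) : Subalgebra ℝ (MvPolynomial (JV d) ℝ) :=
  Algebra.adjoin ℝ (MvPolynomial.X '' {l : JV d | l ≠ 0 ∧ pdeg l.1 ≤ n})

lemma fS_mono {n n' : ℕ} (h : n ≤ n') : fS d n ≤ fS d n' :=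
  Algebra.adjoin_mono (Set.image_mono fun _ hl => ⟨hl.1, hl.2.trans h⟩)

lemma fS_X {n : ℕ} {l : JV d} (h0 : l ≠ 0) (h : pdeg l.1 ≤ n) : MvPolynomial.X l ∈ fS d n :=
  Algebra.subset_adjoin ⟨l, ⟨h0, h⟩, rfl⟩

lemma fS_D {n : ℕ} (e : JV d) {P : MvPolynomial (JV d) ℝ} (hP : P ∈ fS d n) :
    fD e P ∈ fS d (n + pdeg e.1) := by
  have hm : fS d n ≤ fS d (n + pdeg e.1) := fS_mono (by omega)
  refine Algebra.adjoin_induction (p := fun P _ => fD e P ∈ fS d (n + pdeg e.1)) ?_ ?_ ?_ ?_ hP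
  · rintro _ ⟨l, ⟨h0, hl⟩, rfl⟩
    rw [fD_X]
    refine fS_X ?_ (by rw [Prod.fst_add, pdeg_add]; omega)
    intro h
    apply h0
    have h1 := congrArg Prod.fst h
    have h2 := congrArg Prod.snd h
    ext a
    · have := congrFun h1 a; simp at this; simp; omega
    · have := congrFun h2 a; simp at this; simp; omega
  · intro r
    rw [Derivation.map_algebraMap]
    exact zero_mem _
  · intro x y _ _ hx hy
    rw [map_add]; exact add_mem hx hy
  · intro x y hx hy hx' hy'
    rw [Derivation.leibniz]
    exact add_mem (mul_mem (hm hx) hy') (mul_mem (hm hy) hx')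

lemma fS_T {n : ℕ} {e : JV d} (he : e ≠ 0) {P : MvPolynomial (JV d) ℝ} (hP : P ∈ fS d n) :
    fT e P ∈ fS d (n + pdeg e.1) :=
  add_mem (fS_D e hP) (mul_mem (fS_mono (by omega) hP) (fS_X he (by omega)))

lemma ei_ne (i : Fin (d + 1)) : (ei i : MI d) ≠ 0 := by
  intro h
  have := congrFun h i
  simp [ei] at this

lemma fP_mem (j m : MI d) : fP j m ∈ fS d (pdeg j) := by
  induction j using multi_induct with
  | h0 =>
    rw [pdeg_zero]
    induction m using multi_induct with
    | h0 => rw [fP_zero]; exact one_mem _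
    | hs k i _ ih =>
      rw [← fP_v]
      have := fS_T (e := ((0 : MI d), ei i)) (fun h => ei_ne i (congrArg Prod.snd h)) ih
      simpa [pdeg_zero] using this
  | hs k i _ ih =>
    rw [← fP_y, pdeg_add]
    exact fS_T (e := (ei i, (0 : MI d))) (fun h => ei_ne i (congrArg Prod.fst h)) ih

/-! ### Polynomials in the spatial variable -/

/-- Spatial derivations. -/
noncomputable def vD (i : Fin (d + 1)) :
    Derivation ℝ (MvPolynomial (Fin d) ℝ) (MvPolynomial (Fin d) ℝ) :=
  MvPolynomial.mkDerivation ℝ fun a => if i = a.succ then 1 else 0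

lemma vD_X (i : Fin (d + 1)) (a : Fin d) : vD i (MvPolynomial.X a) = if i = a.succ then 1 else 0 :=
  MvPolynomial.mkDerivation_X _ _ _

lemma vD_comm (e e' : Fin (d + 1)) (P : MvPolynomial (Fin d) ℝ) : vD e (vD e' P) = vD e' (vD e P) := by
  have : ⁅vD e, vD e'⁆ = (0 : Derivation ℝ (MvPolynomial (Fin d) ℝ) (MvPolynomial (Fin d) ℝ)) := by
    refine MvPolynomial.derivation_ext fun l => ?_
    rw [Derivation.commutator_apply, vD_X, vD_X]
    split_ifs <;> simp
  have h := congrArg (fun D => D P) this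
  simp only [Derivation.commutator_apply] at h
  exact sub_eq_zero.mp h

/-- Evaluation in the spatial part. -/
noncomputable def vE (P : MvPolynomial (Fin d) ℝ) (uv : Pt d) : ℝ :=
  MvPolynomial.eval (fun a => uv a.succ) P

lemma vE_C (c : ℝ) : vE (MvPolynomial.C c) = fun _ : Pt d => c := by funext uv; simp [vE]

lemma vE_add (p q : MvPolynomial (Fin d) ℝ) : vE (p + q) = fun uv => vE p uv + vE q uv := by
  funext uv; simp [vE]

lemma vE_mul (p q : MvPolynomial (Fin d) ℝ) : vE (p * q) = fun uv => vE p uv * vE q uv := by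
  funext uv; simp [vE]

lemma vE_X (a : Fin d) : vE (MvPolynomial.X a) = fun uv : Pt d => uv a.succ := by
  funext uv; simp [vE]

lemma vE_diff (P : MvPolynomial (Fin d) ℝ) : Differentiable ℝ (vE P) := by
  induction P using MvPolynomial.induction_on with
  | C c => rw [vE_C]; exact differentiable_const _
  | add p q hp hq => rw [vE_add]; exact hp.add hq
  | mul_X p a hp =>
    rw [vE_mul, vE_X]
    exact hp.mul (differentiable_apply _)

lemma vE_pd (P : MvPolynomial (Fin d) ℝ) (i : Fin (d + 1)) : pd i (vE P) = vE (vD i P) := by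
  induction P using MvPolynomial.induction_on with
  | C c =>
    have h1 : vE (MvPolynomial.C c) = fun _ : Pt d => c := by funext uv; simp [vE]
    have h2 : vD i (MvPolynomial.C c) = 0 := (vD i).map_algebraMap c
    rw [h1, h2]; funext uv; simp [pd, vE]
  | add p q hp hq =>
    funext uv
    have h1 : vE (p + q) = fun uv => vE p uv + vE q uv := by funext uv; simp [vE]
    rw [h1, pd_add_fun i (vE_diff p uv) (vE_diff q uv), hp, hq, map_add]
    simp [vE]
  | mul_X p a hp =>
    funext uv
    have h1 : vE (p * MvPolynomial.X a) = fun uv => vE p uv * uv a.succ := by funext uv; simp [vE]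
    have h2 : pd i (fun uv : Pt d => uv a.succ) uv = if i = a.succ then 1 else 0 := by
      have : HasFDerivAt (fun uv : Pt d => uv a.succ)
        (ContinuousLinearMap.proj (R := ℝ) (φ := fun _ : Fin (d + 1) => ℝ) a.succ) uv :=
        (ContinuousLinearMap.proj (R := ℝ) (φ := fun _ : Fin (d + 1) => ℝ) a.succ).hasFDerivAt
      unfold pd
      rw [this.fderiv]
      simp [Pi.single_apply, eq_comm]
    rw [h1, pd_mul_fun i (vE_diff p uv) (differentiable_apply _ uv), h2, hp, Derivation.leibniz, vD_X]
    simp only [vE, map_add, smul_eq_mul, map_mul, MvPolynomial.eval_X]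
    split_ifs <;> simp <;> ring

lemma abs_le_vn (uv : Pt d) (a : Fin d) : |uv a.succ| ≤ 1 + vn uv := by
  have h : |uv a.succ| ≤ vn uv := by
    rw [vn, ← Real.sqrt_sq_eq_abs]
    exact Real.sqrt_le_sqrt (Finset.single_le_sum (f := fun i : Fin d => uv i.succ ^ 2)
      (fun _ _ => sq_nonneg _) (Finset.mem_univ a))
  linarith

lemma vE_tame (P : MvPolynomial (Fin d) ℝ) :
    Tame (lam := lam) (ρ := ρ) (d := d) (fun uv : Pt d => 1 + vn uv) (fun _ => vE P) := by
  induction P using MvPolynomial.induction_on with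
  | C c => rw [vE_C]; exact Tame.const (lam := lam) (ρ := ρ) (d := d) c one_le_vn
  | add p q hp hq => rw [vE_add]; exact hp.add one_le_vn hq
  | mul_X p a hp =>
    rw [vE_mul, vE_X]
    exact hp.mul one_le_vn (Tame.of_indep (fun uv : Pt d => uv a.succ) 1 1 zero_le_one
      (fun uv => by simpa using abs_le_vn uv a) one_le_vn)

/-- Jets of the quadratic monomials. -/
noncomputable def vQ (m : MI d) (p q : Fin d) : MvPolynomial (Fin d) ℝ :=
  wordOp (fun i => vD i) m (MvPolynomial.X p * MvPolynomial.X q)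

lemma vQ_pd (m : MI d) (i : Fin (d + 1)) (p q : Fin d) : pd i (vE (vQ m p q)) = vE (vQ (m + ei i) p q) := by
  rw [vE_pd]
  congr 1
  exact wordOp_comm (fun i => (vD i : MvPolynomial (Fin d) ℝ → MvPolynomial (Fin d) ℝ)) _
    (fun _ => True) (fun _ _ _ => trivial) (fun _ _ _ _ _ _ => vD_comm _ _ _) m i trivial

end Part8

section Part9

variable {lam : ℝ} {ρ : ℕ}

/-! ### Regular families of two variables -/

/-- Families of functions of the base point and of the rescaled variable, with given derivatives. -/
structure G0 (n : ℕ) (K : PR d lam ρ → Pt d → Pt d → ℝ)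
    (Y V : Fin (d + 1) → PR d lam ρ → Pt d → Pt d → ℝ) : Prop where
  cont : ∀ A, Continuous fun p : Pt d × Pt d => K A p.1 p.2
  diff : n < ρ → ∀ A, Differentiable ℝ fun p : Pt d × Pt d => K A p.1 p.2
  uvdiff : ∀ A y, Differentiable ℝ fun uv => K A y uv
  ypd : ∀ i, n + dg i ≤ ρ → ∀ A y uv, pd i (fun y => K A y uv) y = Y i A y uv
  uvpd : ∀ i A y uv, pd i (fun uv => K A y uv) uv = V i A y uv

/-- Tameness in two variables. -/
def TameV (K : PR d lam ρ → Pt d → Pt d → ℝ) : Prop :=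
  Tame (fun p : Pt d × Pt d => 1 + vn p.2) (fun A p => K A p.1 p.2)

/-- Polynomial structure in two variables. -/
def LamV (N : ℕ) (K : PR d lam ρ → Pt d → Pt d → ℝ) : Prop :=
  ∃ (ι : Type) (_ : Fintype ι) (p : ι → MvPolynomial ((Fin (d + 1) → ℕ) × CoeffVar d) ℝ)
    (q : ι → MvPolynomial (Fin d) ℝ), (∀ a, p a ∈ cpol d N) ∧
    ∀ A y uv, K A y uv = ∑ a, MvPolynomial.eval (coeffEval A.1 y) (p a) * vE (q a) uv

section g0
variable {n : ℕ} {K L : PR d lam ρ → Pt d → Pt d → ℝ}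
  {Y V Y' V' : Fin (d + 1) → PR d lam ρ → Pt d → Pt d → ℝ}

lemma G0.diff_y (h : G0 n K Y V) (hn : n < ρ) (A) (uv : Pt d) : Differentiable ℝ fun y => K A y uv :=
  (h.diff hn A).comp (differentiable_id.prodMk (differentiable_const uv))

lemma G0.mono (h : G0 n K Y V) {n' : ℕ} (hn : n ≤ n') : G0 n' K Y V :=
  ⟨h.cont, fun h' => h.diff (by omega), h.uvdiff, fun i hi => h.ypd i (by omega), h.uvpd⟩

lemma G0.congr (h : G0 n K Y V) (hY : ∀ i, n + dg i ≤ ρ → ∀ A y uv, Y i A y uv = Y' i A y uv)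
    (hV : ∀ i A y uv, V i A y uv = V' i A y uv) : G0 n K Y' V' :=
  ⟨h.cont, h.diff, h.uvdiff, fun i hi A y uv => (h.ypd i hi A y uv).trans (hY i hi A y uv),
    fun i A y uv => (h.uvpd i A y uv).trans (hV i A y uv)⟩

lemma G0.add (h : G0 n K Y V) (h' : G0 n L Y' V') : G0 n (fun A y uv => K A y uv + L A y uv)
    (fun i A y uv => Y i A y uv + Y' i A y uv) (fun i A y uv => V i A y uv + V' i A y uv) := by
  refine ⟨fun A => (h.cont A).add (h'.cont A), fun hn A => (h.diff hn A).add (h'.diff hn A),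
    fun A y => (h.uvdiff A y).add (h'.uvdiff A y), fun i hi A y uv => ?_, fun i A y uv => ?_⟩
  · have := dg_pos i
    rw [pd_add_fun i (h.diff_y (by omega) A uv y) (h'.diff_y (by omega) A uv y), h.ypd i hi, h'.ypd i hi]
  · rw [pd_add_fun i (h.uvdiff A y uv) (h'.uvdiff A y uv), h.uvpd i, h'.uvpd i]

lemma G0.mul (h : G0 n K Y V) (h' : G0 n L Y' V') : G0 n (fun A y uv => K A y uv * L A y uv)
    (fun i A y uv => Y i A y uv * L A y uv + K A y uv * Y' i A y uv)
    (fun i A y uv => V i A y uv * L A y uv + K A y uv * V' i A y uv) := by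
  refine ⟨fun A => (h.cont A).mul (h'.cont A), fun hn A => (h.diff hn A).mul (h'.diff hn A),
    fun A y => (h.uvdiff A y).mul (h'.uvdiff A y), fun i hi A y uv => ?_, fun i A y uv => ?_⟩
  · have := dg_pos i
    rw [pd_mul_fun i (h.diff_y (by omega) A uv y) (h'.diff_y (by omega) A uv y), h.ypd i hi, h'.ypd i hi]
  · rw [pd_mul_fun i (h.uvdiff A y uv) (h'.uvdiff A y uv), h.uvpd i, h'.uvpd i]

lemma pd_const (i : Fin (d + 1)) (c : ℝ) (z : Pt d) : pd i (fun _ => c) z = 0 := by simp [pd]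

lemma G0.const (c : ℝ) : G0 n (fun (_ : PR d lam ρ) _ _ => c) (fun _ _ _ _ => 0) (fun _ _ _ _ => 0) :=
  ⟨fun _ => continuous_const, fun _ _ => differentiable_const _, fun _ _ => differentiable_const _,
    fun i _ _ _ _ => pd_const i c _, fun i _ _ _ => pd_const i c _⟩

lemma pd_exp_fun {f : Pt d → ℝ} {z : Pt d} (i : Fin (d + 1)) (hf : DifferentiableAt ℝ f z) :
    pd i (fun z => Real.exp (f z)) z = pd i f z * Real.exp (f z) := by
  unfold pd
  rw [hf.hasFDerivAt.exp.fderiv]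
  simp [mul_comm]

lemma G0.exp (h : G0 n K Y V) : G0 n (fun A y uv => Real.exp (K A y uv))
    (fun i A y uv => Y i A y uv * Real.exp (K A y uv))
    (fun i A y uv => V i A y uv * Real.exp (K A y uv)) := by
  refine ⟨fun A => (h.cont A).rexp, fun hn A => (h.diff hn A).exp,
    fun A y => (h.uvdiff A y).exp, fun i hi A y uv => ?_, fun i A y uv => ?_⟩
  · have := dg_pos i
    rw [pd_exp_fun i (h.diff_y (by omega) A uv y), h.ypd i hi]
  · rw [pd_exp_fun i (h.uvdiff A y uv), h.uvpd i]

lemma G0.sum {ι : Type*} (s : Finset ι) (K : ι → PR d lam ρ → Pt d → Pt d → ℝ)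
    (Y V : ι → Fin (d + 1) → PR d lam ρ → Pt d → Pt d → ℝ) (h : ∀ a ∈ s, G0 n (K a) (Y a) (V a)) :
    G0 n (fun A y uv => ∑ a ∈ s, K a A y uv) (fun i A y uv => ∑ a ∈ s, Y a i A y uv)
      (fun i A y uv => ∑ a ∈ s, V a i A y uv) := by
  classical
  induction s using Finset.induction_on with
  | empty => simpa using G0.const 0
  | insert a s ha ih =>
    simp only [Finset.sum_insert ha]
    exact (h a (by simp)).add (ih fun i hi => h i (by simp [hi]))

lemma G0.of_y (f : PR d lam ρ → Pt d → ℝ) (hc : ∀ A, Continuous (f A))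
    (hd : n < ρ → ∀ A, Differentiable ℝ (f A)) :
    G0 n (fun A y _ => f A y) (fun i A y _ => pd i (f A) y) (fun _ _ _ _ => 0) :=
  ⟨fun A => (hc A).comp continuous_fst, fun hn A => (hd hn A).comp differentiable_fst,
    fun A y => differentiable_const _, fun i _ A y uv => rfl, fun i A y uv => pd_const i _ _⟩

lemma G0.of_uv (f : Pt d → ℝ) (hd : Differentiable ℝ f) :
    G0 n (fun (_ : PR d lam ρ) _ uv => f uv) (fun _ _ _ _ => 0) (fun i _ _ uv => pd i f uv) :=
  ⟨fun A => hd.continuous.comp continuous_snd, fun hn A => hd.comp differentiable_snd,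
    fun A y => hd, fun i _ A y uv => pd_const i _ _, fun i A y uv => rfl⟩

lemma TameV.add (h : TameV K) (h' : TameV L) : TameV (fun A y uv => K A y uv + L A y uv) :=
  Tame.add (fun p => one_le_vn p.2) h h'

lemma TameV.mul (h : TameV K) (h' : TameV L) : TameV (fun A y uv => K A y uv * L A y uv) :=
  Tame.mul (fun p => one_le_vn p.2) h h'

lemma TameV.const (c : ℝ) : TameV (fun (_ : PR d lam ρ) _ _ => c) :=
  Tame.const c (fun p => one_le_vn p.2)

lemma TameV.of_y {f : PR d lam ρ → Pt d → ℝ} (h : Tame (fun _ : Pt d => 1) f) :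
    TameV (fun A y _ => f A y) :=
  Tame.comp (Prod.fst : Pt d × Pt d → Pt d) (fun p => one_le_vn p.2) (fun _ => le_rfl) h

lemma TameV.vE (P : MvPolynomial (Fin d) ℝ) : TameV (fun (_ : PR d lam ρ) _ uv => vE P uv) :=
  Tame.comp (Prod.snd : Pt d × Pt d → Pt d) (fun p => le_rfl) one_le_vn (vE_tame P)

lemma TameV.sum {ι : Type*} (s : Finset ι) (K : ι → PR d lam ρ → Pt d → Pt d → ℝ)
    (h : ∀ a ∈ s, TameV (K a)) : TameV (fun A y uv => ∑ a ∈ s, K a A y uv) :=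
  Tame.sum (fun p : Pt d × Pt d => one_le_vn p.2) s (fun a A (p : Pt d × Pt d) => K a A p.1 p.2) h

lemma LamV.add (h : LamV n K) (h' : LamV n L) : LamV n (fun A y uv => K A y uv + L A y uv) := by
  obtain ⟨ι, _, p, q, hp, h⟩ := h
  obtain ⟨ι', _, p', q', hp', h'⟩ := h'
  refine ⟨ι ⊕ ι', inferInstance, Sum.elim p p', Sum.elim q q', ?_, fun A y uv => ?_⟩
  · rintro (a | a)
    · exact hp a
    · exact hp' a
  · simp [h, h']

lemma LamV.mul (h : LamV n K) (h' : LamV n L) : LamV n (fun A y uv => K A y uv * L A y uv) := by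
  obtain ⟨ι, _, p, q, hp, h⟩ := h
  obtain ⟨ι', _, p', q', hp', h'⟩ := h'
  refine ⟨ι × ι', inferInstance, fun a => p a.1 * p' a.2, fun a => q a.1 * q' a.2, ?_, fun A y uv => ?_⟩
  · exact fun a => mul_mem (hp a.1) (hp' a.2)
  · beta_reduce
    rw [h, h', Finset.sum_mul_sum, Fintype.sum_prod_type]
    refine Finset.sum_congr rfl fun a _ => Finset.sum_congr rfl fun b _ => ?_
    rw [vE_mul, map_mul]
    ring

lemma LamV.of_y {f : PR d lam ρ → Pt d → ℝ} (h : Lam n f) : LamV n (fun A y _ => f A y) := by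
  obtain ⟨p, hp, h⟩ := h
  exact ⟨Unit, inferInstance, fun _ => p, fun _ => MvPolynomial.C 1, fun _ => hp, fun A y uv => by
    simp [h, vE]⟩

lemma LamV.const (c : ℝ) : LamV n (fun (_ : PR d lam ρ) _ _ => c) := LamV.of_y (Lam.const c)

lemma LamV.vE (P : MvPolynomial (Fin d) ℝ) : LamV n (fun (_ : PR d lam ρ) _ uv => vE P uv) :=
  ⟨Unit, inferInstance, fun _ => 1, fun _ => P, fun _ => one_mem _, fun A y uv => by simp⟩

lemma LamV.mono {n' : ℕ} (h : LamV n K) (hn : n ≤ n') : LamV n' K := by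
  obtain ⟨ι, _, p, q, hp, h⟩ := h
  exact ⟨ι, inferInstance, p, q, fun a => cpol_mono hn (hp a), h⟩

lemma LamV.sum {ι : Type*} (s : Finset ι) (K : ι → PR d lam ρ → Pt d → Pt d → ℝ)
    (h : ∀ a ∈ s, LamV n (K a)) : LamV n (fun A y uv => ∑ a ∈ s, K a A y uv) := by
  classical
  induction s using Finset.induction_on with
  | empty => simpa using LamV.const 0
  | insert a s ha ih =>
    simp only [Finset.sum_insert ha]
    exact (h a (by simp)).add (ih fun i hi => h i (by simp [hi]))

end g0

/-! ### The exponent and its jets -/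

/-- Jets of the exponent. -/
noncomputable def QJ (A : PR d lam ρ) (l : JV d) (y uv : Pt d) : ℝ :=
  mderiv l.1 (beta A) y * (if l.2 = 0 then 1 else 0) +
    ∑ pq : Fin d × Fin d, mderiv l.1 (fun y => (A.1.a y)⁻¹ pq.1 pq.2) y *
      ((-1 / 4) * vE (vQ l.2 pq.1 pq.2) uv)

lemma betaJ_cont (hlam : 0 < lam) (A : PR d lam ρ) (l : MI d) (hl : pdeg l ≤ ρ) :
    Continuous (mderiv l (beta A)) := by
  by_cases h : l = 0
  · subst h; rw [mderiv_zero]; exact beta_cont hlam A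
  · exact (beta_mderiv hlam l h hl).cont A

lemma betaJ_diff (hlam : 0 < lam) (A : PR d lam ρ) (l : MI d) (hl : pdeg l < ρ) :
    Differentiable ℝ (mderiv l (beta A)) := by
  by_cases h : l = 0
  · subst h; rw [mderiv_zero]; exact beta_diff hlam (by omega) A
  · exact (beta_mderiv hlam l h hl.le).diff (by omega) A

lemma betaJ_tame (hlam : 0 < lam) (l : MI d) (hl : pdeg l ≤ ρ) :
    Tame (fun _ : Pt d => 1) (fun A : PR d lam ρ => mderiv l (beta A)) := by
  by_cases h : l = 0
  · subst h; simp only [mderiv_zero]; exact beta_tame hlam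
  · exact (beta_mderiv hlam l h hl).tame

lemma invJ_diff (hlam : 0 < lam) (A : PR d lam ρ) (p q : Fin d) (l : MI d) (hl : pdeg l < ρ) :
    Differentiable ℝ (mderiv l (fun y => (A.1.a y)⁻¹ p q)) :=
  ((inv_cp hlam p q).mderiv l hl.le).diff (by omega) A

lemma QJ_G0 (hlam : 0 < lam) (l : JV d) (hl : pdeg l.1 ≤ ρ) :
    G0 (pdeg l.1) (fun (A : PR d lam ρ) y uv => QJ A l y uv)
      (fun i A y uv => QJ A (l + (ei i, 0)) y uv) (fun i A y uv => QJ A (l + (0, ei i)) y uv) := by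
  have h1 : G0 (pdeg l.1) _ _ _ := (G0.of_y (n := pdeg l.1) (fun A : PR d lam ρ => mderiv l.1 (beta A))
    (fun A => betaJ_cont hlam A l.1 hl) (fun hn A => betaJ_diff hlam A l.1 hn)).mul
      (G0.const (if l.2 = 0 then 1 else 0))
  have h2 : ∀ pq : Fin d × Fin d, G0 (pdeg l.1) _ _ _ := fun pq =>
    (G0.of_y (n := pdeg l.1) (fun A : PR d lam ρ => mderiv l.1 (fun y => (A.1.a y)⁻¹ pq.1 pq.2))
    (fun A => ((inv_cp hlam pq.1 pq.2).mderiv l.1 hl).cont A)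
    (fun hn A => invJ_diff hlam A pq.1 pq.2 l.1 hn)).mul
      ((G0.const (-1 / 4)).mul (G0.of_uv (vE (vQ l.2 pq.1 pq.2)) (vE_diff _)))
  have h3 := h1.add (G0.sum Finset.univ _ _ _ fun pq _ => h2 pq)
  refine h3.congr ?_ ?_
  · intro i hi A y uv
    have e1 := pd_mderiv (fun k hk => betaJ_diff hlam A k hk) l.1 i (by rwa [pdeg_add_ei])
    have e2 := fun p q => pd_mderiv (fun k hk => invJ_diff hlam A p q k hk) l.1 i (by rwa [pdeg_add_ei])
    simp only [e1, e2, QJ, Prod.fst_add, Prod.snd_add, add_zero, mul_zero, zero_mul]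
  · intro i A y uv
    have hne : l.2 + ei i ≠ 0 := fun h => ei_ne i (by
      funext a; have := congrFun h a; simp at this; simp [this.2])
    simp only [vQ_pd, QJ, Prod.fst_add, Prod.snd_add, add_zero, mul_zero, zero_mul, zero_add, hne, if_false]

lemma QJ_tame (hlam : 0 < lam) (l : JV d) (hl : pdeg l.1 ≤ ρ) :
    TameV (fun (A : PR d lam ρ) y uv => QJ A l y uv) :=
  ((TameV.of_y (betaJ_tame hlam l.1 hl)).mul (TameV.const _)).add (TameV.sum _ _ fun pq _ =>
    (TameV.of_y ((inv_cp hlam pq.1 pq.2).mderiv l.1 hl).tame).mul ((TameV.const _).mul (TameV.vE _)))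

lemma QJ_lam (hlam : 0 < lam) (l : JV d) (hl0 : l ≠ 0) (hl : pdeg l.1 ≤ ρ) :
    LamV (pdeg l.1) (fun (A : PR d lam ρ) y uv => QJ A l y uv) := by
  have hs : ρ - (ρ - pdeg l.1) = pdeg l.1 := by omega
  refine LamV.add ?_ (LamV.sum _ _ fun pq _ => ?_)
  · by_cases h : l.1 = 0
    · have h2 : l.2 ≠ 0 := fun h2 => hl0 (Prod.ext h h2)
      simp only [h2, if_false, mul_zero]
      exact LamV.const 0
    · have := (beta_mderiv hlam l.1 h hl).isLam
      rw [hs] at this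
      exact (LamV.of_y this).mul (LamV.const _)
  · have := ((inv_cp hlam pq.1 pq.2).mderiv l.1 hl).isLam
    rw [hs] at this
    exact (LamV.of_y this).mul ((LamV.const _).mul (LamV.vE _))

/-- Evaluation of formal jets. -/
noncomputable def ev (P : MvPolynomial (JV d) ℝ) (A : PR d lam ρ) (y uv : Pt d) : ℝ :=
  MvPolynomial.eval (fun l => QJ A l y uv) P

lemma ev_add (P Q : MvPolynomial (JV d) ℝ) : (ev (P + Q) : PR d lam ρ → Pt d → Pt d → ℝ) =
    fun A y uv => ev P A y uv + ev Q A y uv := by funext A y uv; simp [ev]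

lemma ev_mul (P Q : MvPolynomial (JV d) ℝ) : (ev (P * Q) : PR d lam ρ → Pt d → Pt d → ℝ) =
    fun A y uv => ev P A y uv * ev Q A y uv := by funext A y uv; simp [ev]

lemma ev_X (l : JV d) : (ev (MvPolynomial.X l) : PR d lam ρ → Pt d → Pt d → ℝ) =
    fun A y uv => QJ A l y uv := by funext A y uv; simp [ev]

lemma ev_alg (c : ℝ) : (ev (algebraMap ℝ (MvPolynomial (JV d) ℝ) c) : PR d lam ρ → Pt d → Pt d → ℝ) =
    fun _ _ _ => c := by funext A y uv; simp [ev, MvPolynomial.algebraMap_eq]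

lemma ev_zero : (ev 0 : PR d lam ρ → Pt d → Pt d → ℝ) = fun _ _ _ => 0 := by
  funext A y uv; simp [ev]

lemma ev_all (hlam : 0 < lam) {n : ℕ} (hn : n ≤ ρ) {P : MvPolynomial (JV d) ℝ} (hP : P ∈ fS d n) :
    G0 n (ev P : PR d lam ρ → Pt d → Pt d → ℝ) (fun i => ev (fD (ei i, 0) P)) (fun i => ev (fD (0, ei i) P)) ∧
    TameV (ev P : PR d lam ρ → Pt d → Pt d → ℝ) ∧ LamV n (ev P : PR d lam ρ → Pt d → Pt d → ℝ) := by
  refine Algebra.adjoin_induction (p := fun P _ =>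
    G0 n (ev P : PR d lam ρ → Pt d → Pt d → ℝ) (fun i => ev (fD (ei i, 0) P)) (fun i => ev (fD (0, ei i) P)) ∧
    TameV (ev P : PR d lam ρ → Pt d → Pt d → ℝ) ∧ LamV n (ev P : PR d lam ρ → Pt d → Pt d → ℝ))
    ?_ ?_ ?_ ?_ hP
  · rintro _ ⟨l, ⟨h0, hl⟩, rfl⟩
    simp only [fD_X, ev_X]
    exact ⟨(QJ_G0 hlam l (hl.trans hn)).mono hl, QJ_tame hlam l (hl.trans hn),
      (QJ_lam hlam l h0 (hl.trans hn)).mono hl⟩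
  · intro c
    simp only [Derivation.map_algebraMap, ev_alg, ev_zero]
    exact ⟨G0.const c, TameV.const c, LamV.const c⟩
  · intro x y _ _ hx hy
    simp only [map_add, ev_add]
    exact ⟨hx.1.add hy.1, hx.2.1.add hy.2.1, hx.2.2.add hy.2.2⟩
  · intro x y _ _ hx hy
    simp only [Derivation.leibniz, smul_eq_mul, ev_add, ev_mul]
    refine ⟨(hx.1.mul hy.1).congr ?_ ?_, hx.2.1.mul hy.2.1, hx.2.2.mul hy.2.2⟩
    · intros; ring
    · intros; ring

end Part9

section Part10

variable {lam : ℝ} {ρ : ℕ}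

/-! ### The jets of the Gaussian -/

/-- Jets of the Gaussian profile. -/
noncomputable def DJ (A : PR d lam ρ) (j m : MI d) (y uv : Pt d) : ℝ :=
  ev (fP j m) A y uv * Real.exp (QJ A 0 y uv)

lemma DJ_G0 (hlam : 0 < lam) (j m : MI d) (hj : pdeg j ≤ ρ) :
    G0 (pdeg j) (fun (A : PR d lam ρ) y uv => DJ A j m y uv) (fun i A y uv => DJ A (j + ei i) m y uv)
      (fun i A y uv => DJ A j (m + ei i) y uv) := by
  have h1 := (ev_all (ρ := ρ) hlam hj (fP_mem j m)).1
  have h2 := ((QJ_G0 (ρ := ρ) (d := d) hlam 0 (by simp [pdeg_zero])).exp).mono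
    (n' := pdeg j) (by simp [pdeg_zero])
  refine (h1.mul h2).congr ?_ ?_
  · intro i _ A y uv
    simp only [DJ, ← fP_y, fT, ev_add, ev_mul, ev_X, zero_add]
    ring
  · intro i A y uv
    simp only [DJ, ← fP_v, fT, ev_add, ev_mul, ev_X, zero_add]
    ring

/-- Rapidly decaying families. -/
def RapidV (K : PR d lam ρ → Pt d → Pt d → ℝ) : Prop :=
  ∀ (A : PR d lam ρ) (n : ℕ), (∃ C : ℝ, 0 ≤ C ∧ ∀ y uv, (1 + vn uv) ^ n * |K A y uv| ≤ C) ∧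
    ∀ η : ℝ, 0 < η → ∃ δ : ℝ, 0 < δ ∧ ∀ A' : PR d lam ρ, coeffDist ρ A.1 A'.1 ≤ δ →
      ∀ y uv, (1 + vn uv) ^ n * |K A y uv - K A' y uv| ≤ η

lemma RapidV.tame_mul {K L : PR d lam ρ → Pt d → Pt d → ℝ} (hK : TameV K) (hL : RapidV L) :
    RapidV (fun A y uv => K A y uv * L A y uv) := by
  intro A n
  obtain ⟨N, C, hC, h1, h2⟩ := hK A
  obtain ⟨⟨C', hC', h3⟩, h4⟩ := hL A (n + N)
  refine ⟨⟨C * C', by positivity, fun y uv => ?_⟩, fun η hη => ?_⟩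
  · have e1 := h1 (y, uv)
    have e2 := h3 y uv
    have hw := one_le_vn uv
    simp only at e1
    calc (1 + vn uv) ^ n * |K A y uv * L A y uv|
        = (1 + vn uv) ^ n * |L A y uv| * |K A y uv| := by rw [abs_mul]; ring
      _ ≤ (1 + vn uv) ^ n * |L A y uv| * (C * (1 + vn uv) ^ N) :=
          mul_le_mul_of_nonneg_left e1 (by positivity)
      _ = C * ((1 + vn uv) ^ (n + N) * |L A y uv|) := by rw [pow_add]; ring
      _ ≤ _ := mul_le_mul_of_nonneg_left e2 hC
  · obtain ⟨δ, hδ, h5⟩ := h2 (min 1 (η / (2 * (C' + 1)))) (lt_min one_pos (by positivity))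
    obtain ⟨δ', hδ', h6⟩ := h4 (η / (2 * (C + 1))) (by positivity)
    refine ⟨min δ δ', lt_min hδ hδ', fun A' hA y uv => ?_⟩
    have e1 := h1 (y, uv)
    have e2 := h5 A' (hA.trans (min_le_left _ _)) (y, uv)
    have e3 := h3 y uv
    have e4 := h6 A' (hA.trans (min_le_right _ _)) y uv
    have hw := one_le_vn uv
    simp only at e1 e2
    set W := 1 + vn uv
    have hW : 0 ≤ W ^ N := by positivity
    have e5 : |K A y uv - K A' y uv| ≤ η / (2 * (C' + 1)) * W ^ N :=
      e2.trans (mul_le_mul_of_nonneg_right (min_le_right _ _) hW)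
    have e6 : |K A y uv - K A' y uv| ≤ 1 * W ^ N :=
      e2.trans (mul_le_mul_of_nonneg_right (min_le_left _ _) hW)
    have e7 : |K A' y uv| ≤ (C + 1) * W ^ N := by
      have : |K A' y uv| ≤ |K A y uv| + |K A y uv - K A' y uv| := by
        have := abs_sub (K A y uv) (K A y uv - K A' y uv)
        simpa using this
      linarith
    have f1 : η / (2 * (C' + 1)) * C' ≤ η / 2 := by
      rw [div_mul_eq_mul_div, div_le_div_iff₀ (by positivity) (by positivity)]
      nlinarith
    have f2 : (C + 1) * (η / (2 * (C + 1))) = η / 2 := by field_simp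
    calc W ^ n * |K A y uv * L A y uv - K A' y uv * L A' y uv|
        = W ^ n * |(K A y uv - K A' y uv) * L A y uv + K A' y uv * (L A y uv - L A' y uv)| := by ring_nf
      _ ≤ W ^ n * (|K A y uv - K A' y uv| * |L A y uv| + |K A' y uv| * |L A y uv - L A' y uv|) := by
          rw [← abs_mul, ← abs_mul]
          exact mul_le_mul_of_nonneg_left (abs_add_le _ _) (by positivity)
      _ ≤ W ^ n * (η / (2 * (C' + 1)) * W ^ N * |L A y uv| + (C + 1) * W ^ N * |L A y uv - L A' y uv|) := by
          gcongr
      _ = η / (2 * (C' + 1)) * (W ^ (n + N) * |L A y uv|) +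
          (C + 1) * (W ^ (n + N) * |L A y uv - L A' y uv|) := by rw [pow_add]; ring
      _ ≤ η / (2 * (C' + 1)) * C' + (C + 1) * (η / (2 * (C + 1))) := by gcongr
      _ ≤ η := by linarith

lemma poly_exp_le (hlam : 0 < lam) (M : ℕ) (v : ℝ) (hv : 0 ≤ v) :
    (1 + v) ^ M * Real.exp (-(lam / 4) * v ^ 2) ≤ M.factorial * Real.exp (1 + 1 / lam) := by
  have h1 : (1 + v) ^ M ≤ M.factorial * Real.exp (1 + v) := by
    have := Real.pow_div_factorial_le_exp (1 + v) (by positivity) M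
    rw [div_le_iff₀ (by positivity)] at this
    linarith
  calc _ ≤ (M.factorial * Real.exp (1 + v)) * Real.exp (-(lam / 4) * v ^ 2) :=
        mul_le_mul_of_nonneg_right h1 (Real.exp_pos _).le
    _ = M.factorial * Real.exp (1 + v + -(lam / 4) * v ^ 2) := by rw [Real.exp_add (1 + v)]; ring
    _ ≤ _ := by
        refine mul_le_mul_of_nonneg_left (Real.exp_le_exp.mpr ?_) (by positivity)
        have h2 : 1 / lam - (v - lam / 4 * v ^ 2) = (lam * v / 2 - 1) ^ 2 / lam := by
          field_simp; ring
        have h3 : 0 ≤ (lam * v / 2 - 1) ^ 2 / lam := by positivity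
        linarith

lemma exp_sub_le {q q' B : ℝ} (h : q ≤ B) (h' : q' ≤ B) :
    |Real.exp q - Real.exp q'| ≤ |q - q'| * Real.exp B := by
  have key : ∀ {q q' : ℝ}, q ≤ B → Real.exp q - Real.exp q' ≤ |q - q'| * Real.exp B := by
    intro q q' h
    have h1 := Real.add_one_le_exp (q' - q)
    have h2 : Real.exp q' = Real.exp q * Real.exp (q' - q) := by rw [← Real.exp_add]; ring_nf
    have h3 := Real.exp_pos q
    calc Real.exp q - Real.exp q' = Real.exp q * (1 - Real.exp (q' - q)) := by rw [h2]; ring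
      _ ≤ Real.exp q * |q - q'| := by
          refine mul_le_mul_of_nonneg_left ?_ h3.le
          have := le_abs_self (q - q')
          linarith
      _ ≤ Real.exp B * |q - q'| := mul_le_mul_of_nonneg_right (Real.exp_le_exp.mpr h) (abs_nonneg _)
      _ = _ := mul_comm _ _
  rw [abs_le]
  have h1 := key (q' := q') h
  have h2 := key (q' := q) h'
  rw [abs_sub_comm] at h2
  constructor <;> linarith

lemma vn_sq (uv : Pt d) : vn uv ^ 2 = ∑ i : Fin d, uv i.succ ^ 2 := by
  rw [vn, Real.sq_sqrt (Finset.sum_nonneg fun _ _ => sq_nonneg _)]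

lemma QJ_zero (A : PR d lam ρ) (y uv : Pt d) : QJ A 0 y uv =
    beta A y + (-1 / 4) * ∑ i, ∑ j, (A.1.a y)⁻¹ i j * uv (Fin.succ i) * uv (Fin.succ j) := by
  simp only [QJ, Prod.fst_zero, Prod.snd_zero, mderiv_zero, vQ, wordOp_zero, vE_mul, vE_X, if_true, mul_one]
  rw [Fintype.sum_prod_type]
  simp only [Finset.mul_sum]
  congr 1
  refine Finset.sum_congr rfl fun i _ => Finset.sum_congr rfl fun j _ => ?_
  ring

lemma QJ_zero_le (hlam : 0 < lam) (A : PR d lam ρ) (y uv : Pt d) :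
    QJ A 0 y uv ≤ beta A y + -(lam / 4) * vn uv ^ 2 := by
  rw [QJ_zero, vn_sq]
  have := inv_quad_ge hlam A y (fun i => uv i.succ)
  linarith

lemma exp_rapid (hlam : 0 < lam) : RapidV (fun (A : PR d lam ρ) y uv => Real.exp (QJ A 0 y uv)) := by
  intro A n
  obtain ⟨N, C, hC, h1, h2⟩ := beta_tame (d := d) (ρ := ρ) hlam A
  obtain ⟨N', C', hC', h1', h2'⟩ := QJ_tame (d := d) (ρ := ρ) hlam 0 (by simp [pdeg_zero]) A
  simp only [one_pow, mul_one] at h1 h2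
  have hv := fun uv : Pt d => vn_nonneg uv
  have hB : ∀ y uv, QJ A 0 y uv ≤ (C + 1) + -(lam / 4) * vn uv ^ 2 := fun y uv => by
    have := QJ_zero_le hlam A y uv
    have := (le_abs_self _).trans (h1 y)
    linarith
  refine ⟨⟨Real.exp (C + 1) * (n.factorial * Real.exp (1 + 1 / lam)), by positivity, fun y uv => ?_⟩,
    fun η hη => ?_⟩
  · have e1 := poly_exp_le hlam n _ (hv uv)
    have hw := one_le_vn uv
    rw [abs_of_pos (Real.exp_pos _)]
    calc _ ≤ (1 + vn uv) ^ n * Real.exp ((C + 1) + -(lam / 4) * vn uv ^ 2) :=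
          mul_le_mul_of_nonneg_left (Real.exp_le_exp.mpr (hB y uv)) (by positivity)
      _ = Real.exp (C + 1) * ((1 + vn uv) ^ n * Real.exp (-(lam / 4) * vn uv ^ 2)) := by
          rw [Real.exp_add]; ring
      _ ≤ _ := mul_le_mul_of_nonneg_left e1 (Real.exp_pos _).le
  · set E := Real.exp (C + 1) * ((n + N').factorial * Real.exp (1 + 1 / lam)) with hE
    have hEp : 0 < E := by positivity
    obtain ⟨δ, hδ, h3⟩ := h2 1 one_pos
    obtain ⟨δ', hδ', h3'⟩ := h2' (η / E) (by positivity)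
    refine ⟨min δ δ', lt_min hδ hδ', fun A' hA y uv => ?_⟩
    have e1 := poly_exp_le hlam (n + N') _ (hv uv)
    have hw := one_le_vn uv
    have e2 := h3 A' (hA.trans (min_le_left _ _)) y
    have e3 := h3' A' (hA.trans (min_le_right _ _)) (y, uv)
    simp only at e3
    have hB' : QJ A' 0 y uv ≤ (C + 1) + -(lam / 4) * vn uv ^ 2 := by
      have f1 := QJ_zero_le hlam A' y uv
      have f2 := (le_abs_self _).trans (h1 y)
      have f3 := (abs_le.mp e2).1
      linarith
    calc _ ≤ (1 + vn uv) ^ n * ((η / E * (1 + vn uv) ^ N') *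
            Real.exp ((C + 1) + -(lam / 4) * vn uv ^ 2)) := by
          refine mul_le_mul_of_nonneg_left ((exp_sub_le (hB y uv) hB').trans ?_) (by positivity)
          exact mul_le_mul_of_nonneg_right e3 (Real.exp_pos _).le
      _ = η / E * (Real.exp (C + 1) * ((1 + vn uv) ^ (n + N') * Real.exp (-(lam / 4) * vn uv ^ 2))) := by
          rw [Real.exp_add, pow_add]; ring
      _ ≤ η / E * E := by
          rw [hE]; gcongr
      _ = η := by field_simp

lemma DJ_rapid (hlam : 0 < lam) (j m : MI d) (hj : pdeg j ≤ ρ) :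
    RapidV (fun (A : PR d lam ρ) y uv => DJ A j m y uv) :=
  RapidV.tame_mul (ev_all (ρ := ρ) hlam hj (fP_mem j m)).2.1 (exp_rapid hlam)

lemma DJ_jet (hlam : 0 < lam) (A : PR d lam ρ) : Jet2 ρ (DJ A) where
  diff j m hj := (DJ_G0 hlam j m hj.le).diff hj A
  cont j m hj := (DJ_G0 hlam j m hj).cont A
  ypd j m i hj y uv := by
    rw [pdeg_add_ei] at hj
    exact (DJ_G0 hlam j m (by omega)).ypd i hj A y uv
  uvdiff j m hj y := (DJ_G0 hlam j m hj).uvdiff A y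
  uvpd j m i hj y uv := (DJ_G0 hlam j m hj).uvpd i A y uv
  bdd j m hj := by
    obtain ⟨⟨C, _, h⟩, _⟩ := DJ_rapid hlam j m hj A 0
    exact ⟨C, fun y uv => by simpa using h y uv⟩

lemma pdeg_le_two (m : MI d) : pdeg m ≤ 2 * ∑ i, m i := by
  unfold pdeg
  rw [Fin.sum_univ_succ]
  omega

lemma DJ_bd (hlam : 0 < lam) (A : PR d lam ρ) (R n : ℕ) : ∃ C, 0 ≤ C ∧ Bd2 ρ R n C (DJ A) := by
  have h : ∀ j m : MI d, ∃ C : ℝ, 0 ≤ C ∧ (pdeg j ≤ ρ → ∀ y uv, (1 + vn uv) ^ n * |DJ A j m y uv| ≤ C) := by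
    intro j m
    by_cases hj : pdeg j ≤ ρ
    · obtain ⟨⟨C, h0, h⟩, _⟩ := DJ_rapid hlam j m hj A n
      exact ⟨C, h0, fun _ => h⟩
    · exact ⟨0, le_rfl, fun h => absurd h hj⟩
  choose C h0 h using h
  refine ⟨∑ x ∈ multisLE d ρ ×ˢ multisLE d (2 * R), C x.1 x.2, Finset.sum_nonneg fun _ _ => h0 _ _, ?_⟩
  intro j m hj hm y uv
  refine (h j m hj y uv).trans ?_
  have hm' : m ∈ multisLE d (2 * R) := mem_multisLE.mpr ((pdeg_le_two m).trans (by omega))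
  exact Finset.single_le_sum (f := fun x : MI d × MI d => C x.1 x.2) (fun _ _ => h0 _ _)
    (Finset.mem_product.mpr ⟨mem_multisLE.mpr hj, hm'⟩ : (j, m) ∈ _)

lemma fin_delta {ι : Type*} (s : Finset ι) (P : ι → ℝ → Prop)
    (hP : ∀ a δ δ', δ' ≤ δ → P a δ → P a δ') (h : ∀ a ∈ s, ∃ δ : ℝ, 0 < δ ∧ P a δ) :
    ∃ δ : ℝ, 0 < δ ∧ ∀ a ∈ s, P a δ := by
  classical
  induction s using Finset.induction_on with
  | empty => exact ⟨1, one_pos, by simp⟩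
  | insert a s ha ih =>
    obtain ⟨δ, hδ, h1⟩ := ih fun i hi => h i (by simp [hi])
    obtain ⟨δ', hδ', h2⟩ := h a (by simp)
    refine ⟨min δ δ', lt_min hδ hδ', fun b hb => ?_⟩
    rcases Finset.mem_insert.mp hb with rfl | hb
    · exact hP _ _ _ (min_le_right _ _) h2
    · exact hP _ _ _ (min_le_left _ _) (h1 b hb)

lemma DJ_bd_small (hlam : 0 < lam) (A : PR d lam ρ) (R n : ℕ) (ε : ℝ) (hε : 0 < ε) :
    ∃ δ : ℝ, 0 < δ ∧ ∀ A' : PR d lam ρ, coeffDist ρ A.1 A'.1 ≤ δ →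
      Bd2 ρ R n ε (fun j m y uv => DJ A j m y uv - DJ A' j m y uv) := by
  obtain ⟨δ, hδ, h⟩ := fin_delta (multisLE d ρ ×ˢ multisLE d (2 * R))
    (fun x δ => ∀ A' : PR d lam ρ, coeffDist ρ A.1 A'.1 ≤ δ → ∀ y uv,
      (1 + vn uv) ^ n * |DJ A x.1 x.2 y uv - DJ A' x.1 x.2 y uv| ≤ ε)
    (fun a δ δ' hle h A' hA => h A' (hA.trans hle))
    (fun x hx => (DJ_rapid hlam x.1 x.2 (mem_multisLE.mp (Finset.mem_product.mp hx).1) A n).2 ε hε)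
  refine ⟨δ, hδ, fun A' hA j m hj hm y uv => ?_⟩
  have hm' : m ∈ multisLE d (2 * R) := mem_multisLE.mpr ((pdeg_le_two m).trans (by omega))
  exact h (j, m) (Finset.mem_product.mpr ⟨mem_multisLE.mpr hj, hm'⟩) A' hA y uv

lemma Bd2.mono {σ R R' n : ℕ} {C : ℝ} {D : MI d → MI d → Pt d → Pt d → ℝ} (h : Bd2 σ R n C D)
    (hR : R' ≤ R) : Bd2 σ R' n C D := fun j m hj hm => h j m hj (hm.trans hR)

end Part10

section Part11

variable {lam : ℝ} {ρ : ℕ}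

/-! ### The translation invariant terms -/

/-- The jet of the Taylor terms. -/
noncomputable def ZJ (D : MI d → MI d → Pt d → Pt d → ℝ) (k m' j mm : MI d) (w _zb uv : Pt d) : ℝ :=
  if j = 0 then (mfact k : ℝ)⁻¹ * D (k + m') mm w uv else 0

lemma ZJ_jet3 {D : MI d → MI d → Pt d → Pt d → ℝ} (J : Jet2 ρ D) (k : MI d) (hk : pdeg k ≤ ρ) (r : ℕ) :
    Jet3 (ρ - pdeg k) r (ZJ D k) where
  wdiff m' hm zb uv := by
    simp only [ZJ, if_true]
    exact (J.diff_y (k + m') 0 (by rw [pdeg_add]; omega) uv).const_mul _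
  wpd m' i hm w zb uv := by
    simp only [ZJ, if_true]
    rw [pd_const_mul]
    beta_reduce
    rw [J.ypd _ _ _ (by rw [add_assoc, pdeg_add]; omega), add_assoc]
  diff m' j mm hm hj w := by
    unfold ZJ
    split_ifs
    · exact ((J.uvdiff (k + m') mm (by rw [pdeg_add]; omega) w).comp differentiable_snd).const_mul _
    · exact differentiable_const _
  cont m' j mm hm hj w := by
    unfold ZJ
    split_ifs
    · exact continuous_const.mul
        ((J.uvdiff (k + m') mm (by rw [pdeg_add]; omega) w).continuous.comp continuous_snd)
    · exact continuous_const
  uvpd m' mm i hm hj w zb uv := by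
    simp only [ZJ, if_true]
    rw [pd_const_mul]
    beta_reduce
    rw [J.uvpd _ _ _ (by rw [pdeg_add]; omega)]
  zbpd m' j mm i hm hj w zb uv := by
    have hne : j + ei i ≠ 0 := fun h => ei_ne i (by
      funext a; have := congrFun h a; simp at this; simp [this.2])
    simp only [ZJ, hne, if_false]
    exact pd_const i _ _

lemma mfact_ne (k : MI d) : mfact k ≠ 0 := by
  unfold mfact
  exact Finset.prod_ne_zero_iff.mpr fun i _ => Nat.factorial_ne_zero _

lemma mfact_inv_le (k : MI d) : |(mfact k : ℝ)⁻¹| ≤ 1 := by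
  have h : (1 : ℝ) ≤ mfact k := by exact_mod_cast Nat.one_le_iff_ne_zero.mpr (mfact_ne k)
  rw [abs_of_nonneg (by positivity)]
  exact inv_le_one_of_one_le₀ h

lemma ZJ_bd {D : MI d → MI d → Pt d → Pt d → ℝ} (k : MI d) (hk : pdeg k ≤ ρ) {r n : ℕ} {C : ℝ}
    (hC : 0 ≤ C) (hb : Bd2 ρ r n C D) : Bd3 (ρ - pdeg k) r n C (ZJ D k) := by
  intro m' j mm hm hj w zb uv
  unfold ZJ
  split_ifs
  · have h1 := hb (k + m') mm (by rw [pdeg_add]; omega) (by omega) w uv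
    have h2 := mfact_inv_le k
    have h3 := vn_pow_pos uv n
    rw [abs_mul]
    calc _ ≤ (1 + vn uv) ^ n * (1 * |D (k + m') mm w uv|) := by gcongr
      _ ≤ C := by rwa [one_mul]
  · simpa using hC

lemma ZJ_sub (D D' : MI d → MI d → Pt d → Pt d → ℝ) (k m' j mm : MI d) (w zb uv : Pt d) :
    ZJ (fun j m y uv => D j m y uv - D' j m y uv) k m' j mm w zb uv =
      ZJ D k m' j mm w zb uv + (-1) * ZJ D' k m' j mm w zb uv := by
  unfold ZJ
  split_ifs <;> ring

/-- The profile at unit scale. -/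
noncomputable def prof (ζ : Pt d) : Pt d :=
  Fin.cons (Real.sqrt (ζ 0)) fun i : Fin d => ζ i.succ / Real.sqrt (ζ 0)

/-- The Taylor kernels. -/
noncomputable def KZ (A : PR d lam ρ) (k : MI d) (w ζ : Pt d) : ℝ := Kof (ZJ (DJ A) k 0 0 0 w) ζ 0

lemma KZ_eq (A : PR d lam ρ) (k : MI d) (w z zb : Pt d) :
    KZ A k w (z - zb) = Kof (ZJ (DJ A) k 0 0 0 w) z zb := by
  unfold KZ Kof ZJ
  simp only [Pi.sub_apply, Pi.zero_apply, sub_zero, sub_pos]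

lemma KZ_form (A : PR d lam ρ) (k : MI d) (w ζ : Pt d) : KZ A k w ζ =
    if 0 < ζ 0 then ζ 0 ^ (((2 : ℝ) - d - 2) / 2) * ((mfact k : ℝ)⁻¹ * DJ A k 0 w (prof ζ)) else 0 := by
  unfold KZ Kof ZJ prof
  simp only [Pi.zero_apply, sub_zero, if_true, add_zero]

lemma W_eq (hlam : 0 < lam) (A : PR d lam ρ) (w ζ : Pt d) (h : 0 < ζ 0) :
    ζ 0 ^ (((2 : ℝ) - d - 2) / 2) * Real.exp (QJ A 0 w (prof ζ)) = Wker A.1 w ζ := by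
  have hd := det_pos hlam A w
  have hs : Real.sqrt (ζ 0) ^ 2 = ζ 0 := Real.sq_sqrt h.le
  have hs0 : Real.sqrt (ζ 0) ≠ 0 := (Real.sqrt_pos.mpr h).ne'
  have e1 : Real.exp (beta A w) = (4 * Real.pi) ^ (-(d : ℝ) / 2) * (A.1.a w).det ^ (-(1 : ℝ) / 2) := by
    rw [beta, Real.exp_add, Real.rpow_def_of_pos (by positivity), Real.rpow_def_of_pos hd]
    congr 2 <;> ring
  have e2 : (-1 / 4) * ∑ i, ∑ j, (A.1.a w)⁻¹ i j * prof ζ (Fin.succ i) * prof ζ (Fin.succ j) =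
      -(∑ i, ∑ j, (A.1.a w)⁻¹ i j * ζ (Fin.succ i) * ζ (Fin.succ j)) / (4 * ζ 0) := by
    have : ∀ i j : Fin d, (A.1.a w)⁻¹ i j * prof ζ (Fin.succ i) * prof ζ (Fin.succ j) =
        ((A.1.a w)⁻¹ i j * ζ (Fin.succ i) * ζ (Fin.succ j)) * (ζ 0)⁻¹ := by
      intro i j
      have h3 : (Real.sqrt (ζ 0))⁻¹ * (Real.sqrt (ζ 0))⁻¹ = (ζ 0)⁻¹ := by
        rw [← mul_inv, ← sq, hs]
      simp only [prof, Fin.cons_succ, div_eq_mul_inv]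
      rw [← h3]; ring
    simp only [this, ← Finset.sum_mul]
    field_simp
  rw [QJ_zero, Real.exp_add, e1, e2, Wker, if_pos h]
  have e3 : ((2 : ℝ) - d - 2) / 2 = -(d : ℝ) / 2 := by ring
  rw [e3]
  ring

lemma Z_eq (hlam : 0 < lam) (A : PR d lam ρ) (z zb : Pt d) :
    Zker A.1 z zb = Kof (fun zb uv => DJ A 0 0 zb uv) z zb := by
  unfold Zker Kof
  split_ifs with h
  · rw [← W_eq hlam A zb (z - zb) (by simpa using h)]
    simp [DJ, fP_zero, ev, prof]
  · rw [Wker, if_neg (by simpa using h)]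

/-! ### Membership in the local classes -/

lemma atom_zero (A : Coeffs d) (p : MvPolynomial ((Fin (d + 1) → ℕ) × CoeffVar d) ℝ)
    (Q : MvPolynomial (Fin (d + 1)) ℝ) (w ζ : Pt d) :
    lambdaAtom A p 0 (fun _ => Q) w ζ = MvPolynomial.eval (coeffEval A w) p * (ratKer Q ζ * Wker A w ζ) := by
  unfold lambdaAtom
  have hc : ∀ y : Fin 0 → Pt d, chainDiff ζ y 0 = ζ := by
    intro y
    simp [chainDiff, Fin.snoc]
  have hp : ∀ y : Fin 0 → Pt d, (∏ i : Fin (0 + 1), ratKer Q (chainDiff ζ y i) * Wker A w (chainDiff ζ y i)) =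
      ratKer Q ζ * Wker A w ζ := by
    intro y
    rw [Fin.prod_univ_succ, hc]
    simp
  simp only [hp]
  rw [integral_const]
  simp [Measure.real, volume_pi]

lemma memLam_aux (hlam : 0 < lam) (A : PR d lam ρ) (k : MI d) (hk : pdeg k ≤ ρ) (n : ℕ) (hn : pdeg k ≤ n)
    (s : MvPolynomial (Fin (d + 1)) ℝ) : MemLambda A.1 n (fun w ζ =>
      if 0 < ζ 0 then (Real.sqrt (ζ 0))⁻¹ * MvPolynomial.eval (prof ζ) s * KZ A k w ζ else 0) := by
  obtain ⟨ι, _, p, q, hp, h⟩ := (ev_all (ρ := ρ) hlam hk (fP_mem k 0)).2.2.mono hn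
  let e := Fintype.equivFin ι
  refine ⟨Fintype.card ι, fun a => MvPolynomial.C (mfact k : ℝ)⁻¹ * p (e.symm a), fun _ => 0,
    fun a _ => s * MvPolynomial.rename Fin.succ (q (e.symm a)), ?_, ?_⟩
  · intro a mo hmo v hv
    have h1 : MvPolynomial.C (mfact k : ℝ)⁻¹ * p (e.symm a) ∈ cpol d n :=
      mul_mem ((cpol d n).algebraMap_mem _) (hp _)
    exact (MvPolynomial.mem_supported.mp h1) (Finset.mem_coe.mpr ((MvPolynomial.mem_vars v).mpr ⟨mo, hmo, hv⟩))
  · intro w ζ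
    simp only [atom_zero]
    rw [e.symm.sum_comp (fun a => MvPolynomial.eval (coeffEval A.1 w) (MvPolynomial.C (mfact k : ℝ)⁻¹ * p a) *
      (ratKer (s * MvPolynomial.rename Fin.succ (q a)) ζ * Wker A.1 w ζ))]
    by_cases hζ : 0 < ζ 0
    · rw [if_pos hζ, KZ_form, if_pos hζ, ← W_eq hlam A w ζ hζ, DJ, h]
      simp only [Finset.mul_sum, Finset.sum_mul]
      refine Finset.sum_congr rfl fun a _ => ?_
      rw [ratKer, if_pos hζ]
      change _ = _ * ((Real.sqrt (ζ 0))⁻¹ * MvPolynomial.eval (prof ζ) _ * _)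
      rw [map_mul, map_mul, MvPolynomial.eval_C, MvPolynomial.eval_rename]
      have : MvPolynomial.eval (prof ζ ∘ Fin.succ) (q a) = vE (q a) (prof ζ) := rfl
      rw [this]
      ring
    · rw [if_neg hζ]
      simp [Wker, hζ]

lemma memLam1 (hlam : 0 < lam) (A : PR d lam ρ) (k : MI d) (hk : pdeg k ≤ ρ) :
    MemLambda A.1 (pdeg k) (KZ A k) := by
  have := memLam_aux hlam A k hk (pdeg k) le_rfl (MvPolynomial.X 0)
  convert this using 1
  funext w ζ
  split_ifs with h
  · have : Real.sqrt (ζ 0) ≠ 0 := (Real.sqrt_pos.mpr h).ne'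
    simp [prof, this]
  · rw [KZ_form, if_neg h]

lemma memLam2 (hlam : 0 < lam) (A : PR d lam ρ) (k : MI d) (hk : pdeg k ≤ ρ) (n : ℕ) (hn : pdeg k ≤ n) :
    MemLambda A.1 n (fun w ζ => if 0 < ζ 0 then KZ A k w ζ / Real.sqrt (ζ 0) else 0) := by
  have := memLam_aux hlam A k hk n hn 1
  convert this using 1
  funext w ζ
  split_ifs with h
  · simp [div_eq_inv_mul]
  · rfl

/-! ### The remainder terms -/

/-- The jets of the remainder kernels. -/
noncomputable def RJ (r : ℕ) (D : MI d → MI d → Pt d → Pt d → ℝ) (k m' j mm : MI d) (w zb uv : Pt d) : ℝ :=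
  if k 0 = 0 then 0 else RemJ r D (kdown k) m' j mm w zb uv

/-- The remainder kernels. -/
noncomputable def KR (r : ℕ) (A : PR d lam ρ) (k : MI d) (w z zb : Pt d) : ℝ :=
  Kof (RJ r (DJ A) k 0 0 0 w) z zb

lemma RJ_jet3 {D : MI d → MI d → Pt d → Pt d → ℝ} (J : Jet2 ρ D) (r : ℕ) (k : MI d) {M : ℕ}
    (hM : M < ρ - pdeg (kdown k)) : Jet3 M (ρ - pdeg (kdown k) - M) (RJ r D k) := by
  unfold RJ
  split_ifs
  · exact jet3_zero
  · exact RemJ_jet3 J r _ hM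

lemma RJ_bd (hlam : 0 < lam) (A : PR d lam ρ) (r : ℕ) (k : MI d) {M : ℕ}
    (hM : M < ρ - pdeg (kdown k)) (n : ℕ) : ∃ C, Bd3 M (ρ - pdeg (kdown k) - M) n C (RJ r (DJ A) k) := by
  unfold RJ
  split_ifs
  · exact ⟨0, fun _ _ _ _ _ _ _ _ => by simp⟩
  · obtain ⟨C, _, hb⟩ := DJ_bd hlam A (ρ - pdeg (kdown k) - M) n
    exact RemJ_bd r _ hM hb

lemma RJ_sub_bd {D D' : MI d → MI d → Pt d → Pt d → ℝ} (J : Jet2 ρ D) (J' : Jet2 ρ D') (r : ℕ) (k : MI d)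
    {M n : ℕ} {C : ℝ} (hC : 0 ≤ C) (hM : M < ρ - pdeg (kdown k))
    (hb : Bd2 ρ (ρ - pdeg (kdown k) - M) n C (fun j m y uv => D j m y uv - D' j m y uv)) :
    Bd3 M (ρ - pdeg (kdown k) - M) n (remC r (kdown k) * C)
      (fun m' j mm w zb uv => RJ r D k m' j mm w zb uv + (-1) * RJ r D' k m' j mm w zb uv) := by
  unfold RJ
  split_ifs
  · intro _ _ _ _ _ _ _ _
    have := remC_nonneg r (kdown k)
    simp only [mul_zero, add_zero, abs_zero]
    positivity
  · exact RemJ_sub_bd J J' r _ hM hb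

lemma Kof_add (f g : Pt d → Pt d → ℝ) (z zb : Pt d) :
    Kof (fun zb uv => f zb uv + g zb uv) z zb = Kof f z zb + Kof g z zb := by
  unfold Kof; split_ifs <;> ring

lemma Kof_mul (c : ℝ) (f : Pt d → Pt d → ℝ) (z zb : Pt d) :
    Kof (fun zb uv => c * f zb uv) z zb = c * Kof f z zb := by
  unfold Kof; split_ifs <;> ring

lemma Kof_sum {ι : Type*} (s : Finset ι) (f : ι → Pt d → Pt d → ℝ) (z zb : Pt d) :
    Kof (fun zb uv => ∑ a ∈ s, f a zb uv) z zb = ∑ a ∈ s, Kof (f a) z zb := by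
  unfold Kof
  split_ifs
  · rw [Finset.mul_sum]
  · simp

lemma Kof_coef (c : Pt d → ℝ) (f : Pt d → Pt d → ℝ) (z zb : Pt d) :
    Kof (fun zb uv => c zb * f zb uv) z zb = c zb * Kof f z zb := by
  unfold Kof; split_ifs <;> ring

lemma Kof_sub (f g : Pt d → Pt d → ℝ) (z zb : Pt d) :
    Kof (fun zb uv => f zb uv + (-1) * g zb uv) z zb = Kof f z zb - Kof g z zb := by
  unfold Kof; split_ifs <;> ring

lemma Z_decomp (hlam : 0 < lam) (A : PR d lam ρ) (r : ℕ) (hr : 1 ≤ r) (hrρ : r ≤ ρ) (w z zb : Pt d) :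
    Zker A.1 z zb = (∑ k ∈ multisLT d r, mono (zb - w) k * KZ A k w (z - zb)) +
      ∑ k ∈ bdryS d r, mono (zb - w) (kdown k) * KR r A k w z zb := by
  rw [Z_eq hlam]
  have h := fun zb uv => taylor_main (DJ_jet hlam A) r hr hrρ w zb uv
  simp only [h]
  rw [Kof_add, Kof_sum, Kof_sum]
  congr 1
  · refine Finset.sum_congr rfl fun k _ => ?_
    rw [Kof_coef (fun zb => mono (zb - w) k), KZ_eq]
    congr 2
    funext zb uv
    simp [ZJ]
  · refine Finset.sum_congr rfl fun k _ => ?_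
    rw [Kof_coef (fun zb => mono (zb - w) (kdown k))]
    rfl

lemma KZ_mem (hlam : 0 < lam) (A : PR d lam ρ) (k : MI d) (hk : pdeg k ≤ ρ) (r' : ℕ) :
    MemCPhi (ρ - pdeg k) 2 r' fun w z zb => KZ A k w (z - zb) := by
  constructor
  · simp only [KZ_eq]
    refine (ZJ_jet3 (DJ_jet hlam A) k hk r').mem fun n => ?_
    obtain ⟨C, hC, hb⟩ := DJ_bd hlam A r' n
    exact ⟨C, ZJ_bd k hk hC hb⟩
  · intro w z zb h
    simp

lemma KR_mem (hlam : 0 < lam) (A : PR d lam ρ) (r : ℕ) (k : MI d) {m : ℕ} (hm : m < ρ - pdeg (kdown k)) :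
    MemCPsi m 2 (ρ - pdeg (kdown k) - m) (KR r A k) :=
  (RJ_jet3 (DJ_jet hlam A) r k hm).mem fun n => RJ_bd hlam A r k hm n

lemma KZ_sub (hlam : 0 < lam) (A A' : PR d lam ρ) (k : MI d) (hk : pdeg k ≤ ρ) (T : ℝ) (n r' : ℕ) (ε : ℝ)
    (hε : 0 ≤ ε) (hb : Bd2 ρ r' n ε (fun j m y uv => DJ A j m y uv - DJ A' j m y uv)) :
    MemCPhi (ρ - pdeg k) 2 r' (fun w z zb => KZ A k w (z - zb) - KZ A' k w (z - zb)) ∧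
    cpsiNorm (ρ - pdeg k) 2 r' T n (fun w z zb => KZ A k w (z - zb) - KZ A' k w (z - zb)) ≤ ε := by
  have J := (ZJ_jet3 (DJ_jet hlam A) k hk r').add ((ZJ_jet3 (DJ_jet hlam A') k hk r').const_mul (-1))
  have e : (fun w z zb => KZ A k w (z - zb) - KZ A' k w (z - zb)) = fun w => Kof (fun zb uv =>
      ZJ (DJ A) k 0 0 0 w zb uv + (-1) * ZJ (DJ A') k 0 0 0 w zb uv) := by
    funext w z zb
    rw [KZ_eq, KZ_eq, Kof_sub]
  have hb' := ZJ_bd k hk hε hb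
  refine ⟨⟨?_, fun w z zb h => by simp⟩, ?_⟩
  · rw [e]
    refine J.mem fun n => ?_
    obtain ⟨C, hC, h1⟩ := DJ_bd hlam A r' n
    obtain ⟨C', hC', h1'⟩ := DJ_bd hlam A' r' n
    exact ⟨_, (ZJ_bd k hk hC h1).add ((ZJ_bd k hk hC' h1').const_mul (-1))⟩
  · rw [e]
    refine J.norm_le hε ?_ T
    intro m' j mm h1 h2 w zb uv
    beta_reduce
    rw [← ZJ_sub]
    exact hb' m' j mm h1 h2 w zb uv

lemma KR_sub (hlam : 0 < lam) (A A' : PR d lam ρ) (r : ℕ) (k : MI d) (T : ℝ) (n m : ℕ)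
    (hm : m < ρ - pdeg (kdown k)) (ε : ℝ) (hε : 0 ≤ ε)
    (hb : Bd2 ρ (ρ - pdeg (kdown k) - m) n ε (fun j m y uv => DJ A j m y uv - DJ A' j m y uv)) :
    MemCPsi m 2 (ρ - pdeg (kdown k) - m) (fun w z zb => KR r A k w z zb - KR r A' k w z zb) ∧
    cpsiNorm m 2 (ρ - pdeg (kdown k) - m) T n (fun w z zb => KR r A k w z zb - KR r A' k w z zb) ≤
      remC r (kdown k) * ε := by
  have J := (RJ_jet3 (DJ_jet hlam A) r k hm).add ((RJ_jet3 (DJ_jet hlam A') r k hm).const_mul (-1))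
  have e : (fun w z zb => KR r A k w z zb - KR r A' k w z zb) = fun w => Kof (fun zb uv =>
      RJ r (DJ A) k 0 0 0 w zb uv + (-1) * RJ r (DJ A') k 0 0 0 w zb uv) := by
    funext w z zb
    rw [Kof_sub]
    rfl
  rw [e]
  constructor
  · refine J.mem fun n => ?_
    obtain ⟨C, h1⟩ := RJ_bd hlam A r k hm n
    obtain ⟨C', h1'⟩ := RJ_bd hlam A' r k hm n
    exact ⟨_, h1.add (h1'.const_mul (-1))⟩
  · exact J.norm_le (mul_nonneg (remC_nonneg _ _) hε)
      (RJ_sub_bd (DJ_jet hlam A) (DJ_jet hlam A') r k hε hm hb) T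

end Part11

/-- Taylor decomposition of `Z` in the coefficient field.
For `1 ≤ r ≤ ρ` there are families of translation-invariant kernels `Z^{[k]}`
(`|k|_𝔰 < r`) and kernels `Z^{∂,[k]}` (`k ∈ ∂_𝔰 r`) with
`Z(z,z̄) = Σ_{|k|_𝔰<r} (z̄−w)^k Z_w^{[k]}(z−z̄) + Σ_{k∈∂_𝔰 r} (z̄−w)^{k↓} Z_w^{∂,[k]}(z,z̄)`,
such that `Z^{[k]} ∈ C^{ρ−|k|_𝔰}(Φ_∞^2) ∩ Λ_{|k|_𝔰}`,
`Z^{∂,[k]} ∈ C^m(Ψ_{ρ−|k↓|_𝔰−m}^2)` for all `0 ≤ m < ρ − |k↓|_𝔰`, the family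
`w ↦ 1_{t>0} t^{−1/2} Z_w^{[k]}` belongs to `Λ_r`, and the maps
`(a,b,c) ↦ Z^{[k]}, Z^{∂,[k]}` are continuous from `𝐀_ρ` into the respective spaces. -/
theorem Z_taylor_decomposition (d : ℕ) (hd : 1 ≤ d) (lam : ℝ) (hlam : 0 < lam)
    (ρ r : ℕ) (hr : 1 ≤ r) (hrρ : r ≤ ρ) :
    ∃ (Zk : Coeffs d → (Fin (d + 1) → ℕ) → Pt d → Pt d → ℝ)
      (Zdk : Coeffs d → (Fin (d + 1) → ℕ) → Pt d → Pt d → Pt d → ℝ),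
      (∀ A : Coeffs d, ParReg lam ρ A →
        (∀ w z zb : Pt d,
          Zker A z zb =
            (∑ k ∈ multisLT d r, mono (zb - w) k * Zk A k w (z - zb)) +
              ∑ k ∈ bdryS d r, mono (zb - w) (kdown k) * Zdk A k w z zb) ∧
        (∀ k ∈ multisLT d r,
          (∀ r' : ℕ, MemCPhi (ρ - pdeg k) 2 r' fun w z zb => Zk A k w (z - zb)) ∧
          MemLambda A (pdeg k) (Zk A k) ∧
          MemLambda A r fun w ζ =>
            if 0 < ζ 0 then Zk A k w ζ / Real.sqrt (ζ 0) else 0) ∧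
        ∀ k ∈ bdryS d r, ∀ m : ℕ, m < ρ - pdeg (kdown k) →
          MemCPsi m 2 (ρ - pdeg (kdown k) - m) (Zdk A k)) ∧
      ∀ A : Coeffs d, ParReg lam ρ A →
        ∀ T : ℝ, 0 < T → ∀ (n r' m : ℕ) (ε : ℝ), 0 < ε →
          ∃ δ : ℝ, 0 < δ ∧ ∀ A' : Coeffs d, ParReg lam ρ A' → coeffDist ρ A A' ≤ δ →
            (∀ k ∈ multisLT d r,
              MemCPhi (ρ - pdeg k) 2 r'
                (fun w z zb => Zk A k w (z - zb) - Zk A' k w (z - zb)) ∧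
              cpsiNorm (ρ - pdeg k) 2 r' T n
                (fun w z zb => Zk A k w (z - zb) - Zk A' k w (z - zb)) ≤ ε) ∧
            ∀ k ∈ bdryS d r, m < ρ - pdeg (kdown k) →
              MemCPsi m 2 (ρ - pdeg (kdown k) - m)
                (fun w z zb => Zdk A k w z zb - Zdk A' k w z zb) ∧
              cpsiNorm m 2 (ρ - pdeg (kdown k) - m) T n
                (fun w z zb => Zdk A k w z zb - Zdk A' k w z zb) ≤ ε := by
  classical
  refine ⟨fun A k w ζ => if h : ParReg lam ρ A then KZ ⟨A, h⟩ k w ζ else 0,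
    fun A k w z zb => if h : ParReg lam ρ A then KR r ⟨A, h⟩ k w z zb else 0, ?_, ?_⟩
  · intro A hA
    simp only [dif_pos hA]
    refine ⟨fun w z zb => Z_decomp hlam ⟨A, hA⟩ r hr hrρ w z zb, ?_, ?_⟩
    · intro k hk
      have hk' : pdeg k < r := mem_multisLT.mp hk
      have hkρ : pdeg k ≤ ρ := by omega
      exact ⟨fun r' => KZ_mem hlam ⟨A, hA⟩ k hkρ r', memLam1 hlam ⟨A, hA⟩ k hkρ,
        memLam2 hlam ⟨A, hA⟩ k hkρ r hk'.le⟩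
    · intro k _ m hm
      exact KR_mem hlam ⟨A, hA⟩ r k hm
  · intro A hA T _ n r' m ε hε
    have hS0 : 0 ≤ ∑ k ∈ bdryS d r, remC r (kdown k) := Finset.sum_nonneg fun k _ => remC_nonneg r _
    obtain ⟨S, hS⟩ : ∃ S : ℝ, S = 1 + ∑ k ∈ bdryS d r, remC r (kdown k) := ⟨_, rfl⟩
    have hS1 : 1 ≤ S := by linarith
    have hSpos : 0 < S := by linarith
    have hε' : 0 < ε / S := div_pos hε hSpos
    have hεle : ε / S ≤ ε := div_le_self hε.le hS1
    obtain ⟨δ, hδ, h⟩ := DJ_bd_small hlam ⟨A, hA⟩ (r' + ρ) n (ε / S) hε'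
    refine ⟨δ, hδ, fun A' hA' hd' => ?_⟩
    have hb := h ⟨A', hA'⟩ hd'
    simp only [dif_pos hA, dif_pos hA']
    constructor
    · intro k hk
      have hk' : pdeg k < r := mem_multisLT.mp hk
      have hkρ : pdeg k ≤ ρ := by omega
      have := KZ_sub hlam ⟨A, hA⟩ ⟨A', hA'⟩ k hkρ T n r' (ε / S) hε'.le (hb.mono (by omega))
      exact ⟨this.1, this.2.trans hεle⟩
    · intro k hk hm
      have := KR_sub hlam ⟨A, hA⟩ ⟨A', hA'⟩ r k T n m hm (ε / S) hε'.le (hb.mono (by omega))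
      refine ⟨this.1, this.2.trans ?_⟩
      have h1 : remC r (kdown k) ≤ S := by
        have := Finset.single_le_sum (f := fun k => remC r (kdown k)) (fun k _ => remC_nonneg r _) hk
        linarith
      calc remC r (kdown k) * (ε / S) ≤ S * (ε / S) := mul_le_mul_of_nonneg_right h1 hε'.le
        _ = ε := by field_simp


end VarBPHZ
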